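/- Let n ≥ 3, d ≥ 4 and ε > 0. There exists a constant C = C(d,n,ε) with the following property. Let f(y_1,…,y_n) ∈ ℤ[y_1,…,y_n] be a polynomial of degree d which is absolutely irreducible over ℚ, and suppose that only finitely many affine subspaces of ℚ̄^n of dimension n−2 are contained in the zero set {y ∈ ℚ̄^n : f(y) = 0}. Then for every real B ≥ 1 one has n(Y;B) ≤ C·B^{n−2+ε}. -/

import Mathlib

open MvPolynomial


namespace Sal
open Classical in
noncomputable def box (n N : ℕ) : Finset (Fin n → ℤ) :=
  Fintype.piFinset fun _ => Finset.Icc (-(N : ℤ)) N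

lemma mem_box {n N : ℕ} {y : Fin n → ℤ} : y ∈ box n N ↔ ∀ i, |y i| ≤ N := by
  simp [box, abs_le]

noncomputable def uni {R : Type*} [CommRing R] {m : ℕ} (a : Fin (m + 1)) :
    MvPolynomial (Fin (m + 1)) R ≃ₐ[R] Polynomial (MvPolynomial (Fin m) R) :=
  (renameEquiv R (finSuccEquiv' a)).trans (optionEquivLeft R (Fin m))

lemma uni_X_self {R : Type*} [CommRing R] {m : ℕ} (a : Fin (m + 1)) :
    uni (R := R) a (X a) = Polynomial.X := by
  simp [uni]

lemma uni_X_succAbove {R : Type*} [CommRing R] {m : ℕ} (a : Fin (m + 1)) (j : Fin m) :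
    uni (R := R) a (X (a.succAbove j)) = Polynomial.C (X j) := by
  simp [uni]

lemma uni_C {R : Type*} [CommRing R] {m : ℕ} (a : Fin (m + 1)) (r : R) :
    uni (R := R) a (C r) = Polynomial.C (C r) := by
  simp [uni]

lemma eval_uni {R S : Type*} [CommRing R] [CommRing S] [Algebra R S] {m : ℕ} (a : Fin (m + 1))
    (f : MvPolynomial (Fin (m + 1)) R) (u : Fin m → S) (t : S) :
    Polynomial.eval₂ (aeval u : MvPolynomial (Fin m) R →ₐ[R] S).toRingHom t (uni a f)
      = aeval (a.insertNth t u : Fin (m + 1) → S) f := by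
  induction f using MvPolynomial.induction_on with
  | C r => simp [uni_C]
  | add p q hp hq => simp only [map_add, Polynomial.eval₂_add, hp, hq]
  | mul_X p i hp =>
    rw [map_mul, Polynomial.eval₂_mul, hp, map_mul, aeval_X]
    congr 1
    refine Fin.succAboveCases a ?_ (fun j => ?_) i
    · simp [uni_X_self]
    · simp [uni_X_succAbove]

lemma uni_pderiv {R : Type*} [CommRing R] {m : ℕ} (a : Fin (m + 1))
    (f : MvPolynomial (Fin (m + 1)) R) :
    uni a (pderiv a f) = Polynomial.derivative (uni a f) := by
  induction f using MvPolynomial.induction_on with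
  | C r => simp [uni_C]
  | add p q hp hq => simp only [map_add, hp, hq]
  | mul_X p i hp =>
    have h : uni a (pderiv a (X i)) = Polynomial.derivative (uni (R := R) a (X i)) := by
      refine Fin.succAboveCases a ?_ (fun j => ?_) i
      · simp [uni_X_self]
      · simp [uni_X_succAbove, pderiv_X_of_ne (Fin.succAbove_ne a j)]
    rw [pderiv_mul, map_add, map_mul, map_mul, map_mul, Polynomial.derivative_mul, hp, h]

lemma totalDegree_renameEquiv' {R : Type*} [CommRing R] {m : ℕ} (a : Fin (m + 1))
    (f : MvPolynomial (Fin (m + 1)) R) :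
    (rename (finSuccEquiv' a) f).totalDegree = f.totalDegree :=
  totalDegree_renameEquiv (finSuccEquiv' a) f

lemma uni_natDegree {R : Type*} [CommRing R] {m : ℕ} (a : Fin (m + 1))
    (f : MvPolynomial (Fin (m + 1)) R) : (uni a f).natDegree = f.degreeOf a := by
  have := natDegree_optionEquivLeft (R := R) (rename (finSuccEquiv' a) f)
  rw [show (none : Option (Fin m)) = finSuccEquiv' a a by simp,
    degreeOf_rename_of_injective (Equiv.injective _)] at this
  exact this

lemma uni_natDegree_le {R : Type*} [CommRing R] {m : ℕ} (a : Fin (m + 1))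
    (f : MvPolynomial (Fin (m + 1)) R) : (uni a f).natDegree ≤ f.totalDegree := by
  rw [uni_natDegree]; exact degreeOf_le_totalDegree f a

lemma uni_coeff_deg {R : Type*} [CommRing R] {m : ℕ} (a : Fin (m + 1))
    (f : MvPolynomial (Fin (m + 1)) R) (i : ℕ) :
    ((uni a f).coeff i).totalDegree ≤ f.totalDegree := by
  have := totalDegree_coeff_optionEquivLeft_le (R := R) _ (rename (finSuccEquiv' a) f) i
  rwa [totalDegree_renameEquiv'] at this

lemma totalDegree_prod_le {R σ ι : Type*} [CommRing R] (s : Finset ι)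
    (g : ι → MvPolynomial σ R) (D : ℕ) (h : ∀ i ∈ s, (g i).totalDegree ≤ D) :
    (∏ i ∈ s, g i).totalDegree ≤ s.card * D :=
  (totalDegree_finsetProd s g).trans (Finset.sum_le_card_nsmul s _ D h)

lemma totalDegree_det_le {R σ : Type*} [CommRing R] {s D : ℕ}
    (A : Matrix (Fin s) (Fin s) (MvPolynomial σ R)) (h : ∀ i j, (A i j).totalDegree ≤ D) :
    A.det.totalDegree ≤ s * D := by
  rw [Matrix.det_apply]
  refine totalDegree_finsetSum_le fun σ _ => ?_
  have h1 := totalDegree_prod_le Finset.univ (fun i => A (σ i) i) D (fun i _ => h _ _)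
  rw [Finset.card_univ, Fintype.card_fin] at h1
  rcases Int.units_eq_one_or (Equiv.Perm.sign σ) with e | e <;> rw [e]
  · simpa using h1
  · simpa [totalDegree_neg] using h1

lemma res_ne_zero {A : Type*} [CommRing A] [IsDomain A] [NormalizedGCDMonoid A]
    [UniqueFactorizationMonoid A]
    (f g : Polynomial A) (hf : Irreducible f) (h0 : f.natDegree ≠ 0) (hg : ¬ f ∣ g) :
    f.resultant g ≠ 0 := by
  have hp : f.IsPrimitive := hf.isPrimitive h0
  let φ := algebraMap A (FractionRing A)
  have hφ : Function.Injective φ := IsFractionRing.injective _ _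
  have hirr : Irreducible (f.map φ) :=
    (hp.irreducible_iff_irreducible_map_fraction_map (K := FractionRing A)).1 hf
  have hnd : ¬ f.map φ ∣ g.map φ := by
    intro h
    exact hg ((hp.dvd_iff_fraction_map_dvd_fraction_map (FractionRing A)).2 h)
  have hc : IsCoprime (f.map φ) (g.map φ) := (hirr.coprime_iff_not_dvd).2 hnd
  intro h
  have h3 := Polynomial.resultant_map_map f g f.natDegree g.natDegree φ
  rw [h, map_zero] at h3
  have h4 : (f.map φ).resultant (g.map φ) = 0 := by
    rw [Polynomial.natDegree_map_eq_of_injective hφ, Polynomial.natDegree_map_eq_of_injective hφ]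
    exact h3
  exact (Polynomial.resultant_eq_zero_iff.1 h4).2 hc

lemma uni_rename {R : Type*} [CommRing R] {m : ℕ} (a : Fin (m + 1)) (P : MvPolynomial (Fin m) R) :
    uni a (rename a.succAbove P) = Polynomial.C P := by
  have : ((uni a : MvPolynomial (Fin (m + 1)) R ≃ₐ[R] _) : _ →ₐ[R] _).comp (rename a.succAbove) =
    Polynomial.CAlgHom := by
    ext i : 1
    simp [uni_X_succAbove]
  exact DFunLike.congr_fun this P

/-- elimination -/
lemma elim' {K : Type*} [Field K] {m : ℕ} (a : Fin (m + 1)) (f g : MvPolynomial (Fin (m + 1)) K)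
    (hf : Irreducible f) (hg : ¬ f ∣ g) (D : ℕ) (hfD : f.totalDegree ≤ D)
    (hgD : g.totalDegree ≤ D) :
    ∃ P : MvPolynomial (Fin m) K, P ≠ 0 ∧ P.totalDegree ≤ 2 * D * D + D ∧
      ∃ u v, rename a.succAbove P = u * f + v * g := by
  let _ : NormalizedGCDMonoid (MvPolynomial (Fin m) K) :=
    Classical.choice inferInstance
  have hirr : Irreducible (uni a f) := (MulEquiv.irreducible_iff (uni a)).2 hf
  by_cases h0 : (uni a f).natDegree = 0
  · refine ⟨(uni a f).coeff 0, ?_, ?_, ?_⟩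
    · intro h
      rw [Polynomial.eq_C_of_natDegree_eq_zero h0, h] at hirr
      simp at hirr
    · exact (uni_coeff_deg a f 0).trans (by nlinarith)
    · refine ⟨1, 0, (uni a).injective ?_⟩
      rw [uni_rename, ← Polynomial.eq_C_of_natDegree_eq_zero h0, one_mul, zero_mul, add_zero]
  · have hr := res_ne_zero (uni a f) (uni a g) hirr h0 (by
      intro h; apply hg
      obtain ⟨q, hq⟩ := h
      refine ⟨(uni a).symm q, ?_⟩
      apply (uni a).injective
      simp [hq])
    refine ⟨_, hr, ?_, ?_⟩
    · have hm := uni_natDegree_le a f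
      have hn := uni_natDegree_le a g
      refine (totalDegree_det_le (D := D) _ ?_).trans ?_
      · intro i j
        unfold Polynomial.sylvester
        simp only [Matrix.of_apply]
        refine Fin.addCases (fun j => ?_) (fun j => ?_) j
        · simp only [Fin.addCases_left]
          split_ifs
          · exact (uni_coeff_deg a _ _).trans ‹_›
          · simp
        · simp only [Fin.addCases_right]
          split_ifs
          · exact (uni_coeff_deg a _ _).trans ‹_›
          · simp
      · nlinarith
    · obtain ⟨p, q, -, -, e⟩ := Polynomial.exists_mul_add_mul_eq_C_resultant (uni a f) (uni a g)
        le_rfl le_rfl (Or.inl h0)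
      refine ⟨(uni a).symm p, (uni a).symm q, (uni a).injective ?_⟩
      rw [uni_rename, ← e, map_add, map_mul, map_mul, AlgEquiv.apply_symm_apply, AlgEquiv.apply_symm_apply]
      ring

lemma elim {K : Type*} [Field K] {m : ℕ} (a : Fin (m + 1)) (f g : MvPolynomial (Fin (m + 1)) K)
    (hf : Irreducible f) (hg : ¬ f ∣ g) (D : ℕ) (hfD : f.totalDegree ≤ D)
    (hgD : g.totalDegree ≤ D) :
    ∃ P : MvPolynomial (Fin m) K, P ≠ 0 ∧ P.totalDegree ≤ 2 * D * D + D ∧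
      ∀ x, eval x f = 0 → eval x g = 0 → eval (fun j => x (a.succAbove j)) P = 0 := by
  obtain ⟨P, h0, h1, u, v, h⟩ := elim' a f g hf hg D hfD hgD
  refine ⟨P, h0, h1, fun x hx hy => ?_⟩
  have := congrArg (eval x) h
  rw [eval_rename, map_add, map_mul, map_mul, hx, hy] at this
  have h9 : eval (x ∘ a.succAbove) P = 0 := by simpa using this
  exact h9

end Sal


namespace Sal

open Classical in
lemma sz_card {R : Type*} [CommRing R] [IsDomain R] {m : ℕ} (P : MvPolynomial (Fin (m + 1)) R)
    (hP : P ≠ 0) (S : Finset R) (D : ℕ) (hD : P.totalDegree ≤ D) :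
    ((Fintype.piFinset fun _ => S).filter (fun x => eval x P = 0)).card ≤ D * S.card ^ m := by
  have h := schwartz_zippel_totalDegree hP S
  rcases Nat.eq_zero_or_pos S.card with h0 | h0
  · have : S = ∅ := Finset.card_eq_zero.1 h0
    subst this
    simp
  · have hpos : (0 : ℚ≥0) < (S.card : ℚ≥0) := by exact_mod_cast h0
    rw [div_le_div_iff₀ (by positivity) hpos] at h
    have h2 : ((Fintype.piFinset fun _ : Fin (m + 1) => S).filter
        (fun x => eval x P = 0)).card * S.card ≤ P.totalDegree * S.card ^ (m + 1) := by
      convert (by exact_mod_cast h : _ * S.card ≤ P.totalDegree * S.card ^ (m + 1)) using 3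
    rw [pow_succ, ← mul_assoc] at h2
    exact (Nat.le_of_mul_le_mul_right h2 h0).trans (Nat.mul_le_mul_right _ hD)

lemma box_zeros {K : Type*} [Field K] [CharZero K] {m : ℕ} (P : MvPolynomial (Fin (m + 1)) K)
    (hP : P ≠ 0) (D N : ℕ) (hD : P.totalDegree ≤ D) (S : Finset (Fin (m + 1) → ℤ))
    (hS : ∀ y ∈ S, (∀ i, |y i| ≤ N) ∧ eval (fun i => (y i : K)) P = 0) :
    S.card ≤ D * (2 * N + 1) ^ m := by
  classical
  let T : Finset K := (Finset.Icc (-(N : ℤ)) N).image (fun z : ℤ => (z : K))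
  have hT : T.card ≤ 2 * N + 1 := by
    refine Finset.card_image_le.trans ?_
    simp; omega
  have h1 := sz_card P hP T D hD
  refine le_trans ?_ (h1.trans (Nat.mul_le_mul_left _ (Nat.pow_le_pow_left hT m)))
  refine Finset.card_le_card_of_injOn (fun y i => (y i : K)) ?_ ?_
  · intro y hy
    obtain ⟨hb, h0⟩ := hS y hy
    simp only [Finset.coe_filter, Fintype.mem_piFinset, Set.mem_ofPred_eq]
    exact ⟨fun i => Finset.mem_image.2 ⟨y i, by simpa [abs_le] using hb i, rfl⟩, h0⟩
  · intro y _ y' _ h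
    funext i
    have := congrFun h i
    simpa using this

/-- picking a small point where a nonzero polynomial does not vanish -/
lemma pick {K : Type*} [Field K] [CharZero K] {m : ℕ} (P : MvPolynomial (Fin m) K)
    (hP : P ≠ 0) (D : ℕ) (hD : P.totalDegree ≤ D) :
    ∃ γ : Fin m → ℤ, (∀ i, |γ i| ≤ D) ∧ eval (fun i => (γ i : K)) P ≠ 0 := by
  by_contra! hcon
  rcases m with _ | m
  · have := hcon (fun _ => 0) (fun i => i.elim0)
    rw [P.eq_C_of_isEmpty, eval_C] at this
    apply hP; rw [P.eq_C_of_isEmpty, this, map_zero]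
  · have h := box_zeros P hP D D hD (box (m + 1) D) (fun y hy => ⟨mem_box.1 hy, hcon y (mem_box.1 hy)⟩)
    have h2 : (box (m + 1) D).card = (2 * D + 1) ^ (m + 1) := by
      simp only [box, Fintype.card_piFinset, Int.card_Icc, Finset.prod_const, Finset.card_univ, Fintype.card_fin]; congr 1; omega
    rw [h2, pow_succ, mul_comm] at h
    have := Nat.le_of_mul_le_mul_right h (by positivity)
    omega

lemma fibre_card {K : Type*} [Field K] {m : ℕ} (a : Fin (m + 1))
    (f : MvPolynomial (Fin (m + 1)) K) (D : ℕ) (hfD : f.totalDegree ≤ D) (k : ℕ) (c : K)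
    (hc0 : c ≠ 0) (hc : (uni a f).coeff k = C c) (S : Finset (Fin (m + 1) → K)) (u : Fin m → K)
    (hS : ∀ y ∈ S, eval y f = 0 ∧ (fun j => y (a.succAbove j)) = u) : S.card ≤ D := by
  classical
  let q : Polynomial K := (uni a f).map (aeval u : MvPolynomial (Fin m) K →ₐ[K] K).toRingHom
  have hq0 : q ≠ 0 := by
    intro h
    have := congrArg (fun q => q.coeff k) h
    simp [q, Polynomial.coeff_map, hc, hc0] at this
  have hqd : q.natDegree ≤ D := Polynomial.natDegree_map_le.trans ((uni_natDegree_le a f).trans hfD)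
  refine le_trans ?_ ((Multiset.toFinset_card_le _).trans ((Polynomial.card_roots' q).trans hqd))
  refine Finset.card_le_card_of_injOn (fun y => y a) ?_ ?_
  · intro y hy
    obtain ⟨h0, rfl⟩ := hS y hy
    simp only [Finset.mem_coe, Multiset.mem_toFinset]
    rw [Polynomial.mem_roots hq0, Polynomial.IsRoot, Polynomial.eval_map, eval_uni]
    have : (a.insertNth (y a) (fun j => y (a.succAbove j)) : Fin (m + 1) → K) = y :=
      Fin.insertNth_self_removeNth a y
    rw [this]
    exact h0
  · intro y hy y' hy' h
    funext i
    refine Fin.succAboveCases a h (fun j => ?_) i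
    exact congrFun ((hS y hy).2.trans (hS y' hy').2.symm) j

lemma codim2 {K : Type*} [Field K] [CharZero K] {m : ℕ} (f g : MvPolynomial (Fin (m + 2)) K)
    (hf : Irreducible f) (hg : ¬ f ∣ g) (D : ℕ) (hfD : f.totalDegree ≤ D)
    (hgD : g.totalDegree ≤ D) (hc : ∃ (k : ℕ) (c : K), c ≠ 0 ∧ (uni 0 f).coeff k = C c) (N : ℕ)
    (S : Finset (Fin (m + 2) → ℤ))
    (hS : ∀ y ∈ S, (∀ i, |y i| ≤ N) ∧ eval (fun i => (y i : K)) f = 0 ∧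
      eval (fun i => (y i : K)) g = 0) :
    S.card ≤ D * ((2 * D * D + D) * (2 * N + 1) ^ m) := by
  classical
  obtain ⟨P, hP, hPD, hPe⟩ := elim 0 f g hf hg D hfD hgD
  obtain ⟨k, c, hc0, hc⟩ := hc
  have h1 := box_zeros P hP _ N hPD (S.image (fun (y : Fin (m + 2) → ℤ) (j : Fin (m + 1)) => y ((0 : Fin (m + 2)).succAbove j))) (by
    intro u hu
    obtain ⟨y, hy, rfl⟩ := Finset.mem_image.1 hu
    obtain ⟨hb, h0, h1⟩ := hS y hy
    have h3 := hPe (fun i => (y i : K)) h0 h1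
    exact ⟨fun i => hb _, h3⟩)
  have h2 := Finset.card_le_mul_card_image (f := fun (y : Fin (m + 2) → ℤ) (j : Fin (m + 1)) => y ((0 : Fin (m + 2)).succAbove j)) S D ?_
  · exact h2.trans (Nat.mul_le_mul_left _ h1)
  intro u _
  refine le_trans ?_ (fibre_card 0 f D hfD k c hc0 hc ((S.filter
    (fun (y : Fin (m + 2) → ℤ) => (fun j : Fin (m + 1) => y ((0 : Fin (m + 2)).succAbove j)) = u)).image (fun y i => (y i : K)))
    (fun i => (u i : K)) ?_)
  · rw [Finset.card_image_of_injective]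
    intro y y' h
    funext i
    have := congrFun h i
    simpa using this
  · intro x hx
    obtain ⟨y, hy, rfl⟩ := Finset.mem_image.1 hx
    obtain ⟨hy, hu⟩ := Finset.mem_filter.1 hy
    exact ⟨(hS y hy).2.1, by subst hu; rfl⟩

lemma bezout {K : Type*} [Field K] (f g : MvPolynomial (Fin 2) K)
    (hf : Irreducible f) (hg : ¬ f ∣ g) (D : ℕ) (hfD : f.totalDegree ≤ D)
    (hgD : g.totalDegree ≤ D) (S : Finset (Fin 2 → K))
    (hS : ∀ y ∈ S, eval y f = 0 ∧ eval y g = 0) :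
    S.card ≤ (2 * D * D + D) * (2 * D * D + D) := by
  classical
  have key : ∀ a : Fin 2, (S.image (fun y => y (a.succAbove 0))).card ≤ 2 * D * D + D := by
    intro a
    obtain ⟨P, hP, hPD, hPe⟩ := elim a f g hf hg D hfD hgD
    have h := sz_card P hP (S.image (fun y => y (a.succAbove 0))) _ hPD
    rw [pow_zero, mul_one] at h
    refine le_trans ?_ h
    refine Finset.card_le_card_of_injOn (fun t _ => t) ?_ (fun t _ t' _ h => congrFun h 0)
    intro t ht
    obtain ⟨y, hy, rfl⟩ := Finset.mem_image.1 ht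
    simp only [Finset.coe_filter, Fintype.mem_piFinset, Set.mem_ofPred_eq]
    refine ⟨fun _ => ht, ?_⟩
    rw [← hPe y (hS y hy).1 (hS y hy).2]
    congr 2
    funext i
    rw [Fin.fin_one_eq_zero i]
  refine le_trans ?_ (Nat.mul_le_mul (key 1) (key 0))
  rw [← Finset.card_product]
  refine Finset.card_le_card_of_injOn (fun y => (y 0, y 1)) ?_ ?_
  · intro y hy
    simp only [Finset.coe_product, Set.mem_prod, Finset.mem_coe]
    exact ⟨Finset.mem_image_of_mem (fun y : Fin 2 → K => y ((1 : Fin 2).succAbove 0)) hy,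
      Finset.mem_image_of_mem (fun y : Fin 2 → K => y ((0 : Fin 2).succAbove 0)) hy⟩
  · intro y _ y' _ h
    funext i
    fin_cases i
    · exact (Prod.ext_iff.1 h).1
    · exact (Prod.ext_iff.1 h).2

/-- null vector from vanishing of all determinants -/
lemma null_vec {R : Type*} [CommRing R] [Nontrivial R] {S : Type*} (Q : R → Prop) (h0 : Q 0) :
    ∀ (s : ℕ) (v : S → Fin s → R),
    (∀ r < s, ∀ (k : ℕ) (x : Fin r → S) (e : Fin r → Fin s),
      Q ((-1) ^ k * (Matrix.of fun i j => v (x i) (e j)).det)) →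
    (∀ x : Fin s → S, (Matrix.of fun i j => v (x i) j).det = 0) →
    ∃ c : Fin s → R, c ≠ 0 ∧ (∀ x, ∑ k, c k * v x k = 0) ∧ ∀ k, Q (c k) := by
  intro s
  induction s with
  | zero => intro v _ h; exact absurd (h Fin.elim0) (by simp)
  | succ s ih =>
    intro v hQ h
    by_cases hd : ∀ x : Fin s → S, (Matrix.of fun i j => v (x i) (Fin.castSucc j)).det = 0
    · obtain ⟨c, hc, hv, hq⟩ := ih (fun x j => v x (Fin.castSucc j))
        (fun r hr k x e => hQ r (by omega) k x (fun j => Fin.castSucc (e j))) hd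
      refine ⟨Fin.snoc c 0, ?_, ?_, ?_⟩
      · intro h; apply hc; funext i
        have := congrFun h (Fin.castSucc i)
        simpa using this
      · intro x; rw [Fin.sum_univ_castSucc]; simpa using hv x
      · intro k; refine Fin.lastCases ?_ (fun i => ?_) k
        · simpa using h0
        · simpa using hq i
    · push Not at hd
      obtain ⟨x, hx⟩ := hd
      refine ⟨fun j => (-1) ^ (s + (j : ℕ)) *
        (Matrix.of fun i k => v (x i) (j.succAbove k)).det, ?_, ?_, ?_⟩
      · intro h
        apply hx
        have := congrFun h (Fin.last s)
        simpa [Fin.succAbove_last] using this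
      · intro y
        have := h (Fin.snoc x y)
        rw [Matrix.det_succ_row _ (Fin.last s)] at this
        rw [← this]
        refine Finset.sum_congr rfl fun j _ => ?_
        have : (Matrix.of fun i j => v ((Fin.snoc x y : Fin (s + 1) → S) i) j).submatrix
          (Fin.last s).succAbove j.succAbove = Matrix.of fun i k => v (x i) (j.succAbove k) := by
          ext i k; simp [Fin.succAbove_last]
        rw [this]; simp; ring
      · intro k; exact hQ s (by omega) _ _ _

lemma det_bound {s : ℕ} (A : Matrix (Fin s) (Fin s) ℤ) (b : Fin s → ℝ)
    (h : ∀ i j, |(A i j : ℝ)| ≤ b j) : |(A.det : ℝ)| ≤ s.factorial * ∏ j, b j := by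
  rw [Matrix.det_apply]
  push_cast
  refine (Finset.abs_sum_le_sum_abs _ _).trans ?_
  have : ∀ σ ∈ (Finset.univ : Finset (Equiv.Perm (Fin s))),
      |(((Equiv.Perm.sign σ) • ∏ i, A (σ i) i : ℤ) : ℝ)| ≤ ∏ j, b j := by
    intro σ _
    have : |(((Equiv.Perm.sign σ) • ∏ i, A (σ i) i : ℤ) : ℝ)| = ∏ i, |(A (σ i) i : ℝ)| := by
      rw [← Finset.abs_prod]
      rcases Int.units_eq_one_or (Equiv.Perm.sign σ) with e | e <;> rw [e] <;> simp
    rw [this]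
    exact Finset.prod_le_prod (fun _ _ => abs_nonneg _) (fun i _ => h _ _)
  refine (Finset.sum_le_card_nsmul _ _ _ this).trans ?_
  simp [Fintype.card_perm]

/-- integral null vector with a height bound -/
lemma null_vec_int {S : Type*} (s : ℕ) (v : S → Fin s → ℤ) (A : ℝ) (hA : 1 ≤ A)
    (hv : ∀ x k, |(v x k : ℝ)| ≤ A)
    (h : ∀ x : Fin s → S, (Matrix.of fun i j => v (x i) j).det = 0) :
    ∃ c : Fin s → ℤ, c ≠ 0 ∧ (∀ x, ∑ k, c k * v x k = 0) ∧
      ∀ k, |(c k : ℝ)| ≤ s.factorial * A ^ s := by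
  refine null_vec (fun c : ℤ => |(c : ℝ)| ≤ s.factorial * A ^ s) (by simp; positivity) s v ?_ h
  intro r hr k x e
  have h1 := det_bound (Matrix.of fun i j => v (x i) (e j)) (fun _ => A) (fun i j => hv _ _)
  simp only [Int.cast_mul, Int.cast_pow, Int.cast_neg, Int.cast_one, abs_mul, abs_pow, abs_neg,
    abs_one, one_pow, one_mul]
  refine h1.trans ?_
  simp only [Finset.prod_const, Finset.card_univ, Fintype.card_fin]
  have : (r.factorial : ℝ) ≤ s.factorial := by exact_mod_cast Nat.factorial_le hr.le
  have h3 : A ^ r ≤ A ^ s := pow_le_pow_right₀ hA hr.le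
  exact mul_le_mul this h3 (by positivity) (by positivity)

end Sal


namespace Sal

lemma eval_congr_dvd {n : ℕ} (p : ℤ) (G : MvPolynomial (Fin n) ℤ) (x y : Fin n → ℤ)
    (h : ∀ i, p ∣ x i - y i) : p ∣ eval x G - eval y G := by
  induction G using MvPolynomial.induction_on with
  | C a => simp
  | add a b ha hb =>
    rw [map_add, map_add, add_sub_add_comm]; exact dvd_add ha hb
  | mul_X a i ha =>
    have : eval x (a * X i) - eval y (a * X i) =
      (eval x a - eval y a) * x i + eval y a * (x i - y i) := by simp; ring
    rw [this]
    exact dvd_add (ha.mul_right _) ((h i).mul_left _)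

lemma eval_uni_eval {r : ℕ} (l : Fin (r + 1)) (f : MvPolynomial (Fin (r + 1)) ℤ)
    (φ : MvPolynomial (Fin r) ℤ) (u : Fin r → ℤ) :
    eval u (Polynomial.eval φ (uni l f)) = ((uni l f).map (eval u)).eval (eval u φ) := by
  rw [Polynomial.eval_map, Polynomial.eval₂_at_apply]

lemma eval_eq_uni {r : ℕ} (l : Fin (r + 1)) (f : MvPolynomial (Fin (r + 1)) ℤ)
    (x : Fin (r + 1) → ℤ) :
    eval x f = ((uni l f).map (eval (fun j => x (l.succAbove j)))).eval (x l) := by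
  have h := eval_uni l f (fun j => x (l.succAbove j)) (x l)
  have h2 : (l.insertNth (x l) (fun j => x (l.succAbove j)) : Fin (r + 1) → ℤ) = x :=
      Fin.insertNth_self_removeNth l x
  rw [h2] at h
  rw [Polynomial.eval_map]
  exact h.symm

lemma hensel {r : ℕ} (f : MvPolynomial (Fin (r + 1)) ℤ) (p : ℕ) (hp : p.Prime) (l : Fin (r + 1))
    (x0 : Fin (r + 1) → ℤ) (h : ¬ (p : ℤ) ∣ eval x0 (pderiv l f)) (N : ℕ) :
    ∃ φ : MvPolynomial (Fin r) ℤ, ∀ x : Fin (r + 1) → ℤ, (∀ i, (p : ℤ) ∣ x i - x0 i) →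
      (p : ℤ) ^ (N + 1) ∣ eval x f →
      (p : ℤ) ^ (N + 1) ∣ x l - eval (fun j => x (l.succAbove j)) φ := by
  have hpi : Prime (p : ℤ) := Nat.prime_iff_prime_int.1 hp
  have hco : IsCoprime (eval x0 (pderiv l f)) (p : ℤ) :=
    (hpi.irreducible.coprime_iff_not_dvd.2 h).symm
  obtain ⟨t, b, htb⟩ := hco
  induction N with
  | zero => exact ⟨C (x0 l), fun x hx _ => by simpa using hx l⟩
  | succ N ih =>
    obtain ⟨φ, hφ⟩ := ih
    refine ⟨φ - C t * Polynomial.eval φ (uni l f), fun x hx hf => ?_⟩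
    have h1 := hφ x hx ((pow_dvd_pow _ (by omega)).trans hf)
    set u := fun j => x (l.succAbove j) with hu
    rw [map_sub, map_mul, eval_C, eval_uni_eval]
    set q := (uni l f).map (eval u) with hq
    obtain ⟨e, he⟩ := h1
    have e1 : eval u φ = x l + -(p ^ (N + 1) * e) := by linarith
    rw [e1]
    obtain ⟨k, hk⟩ := Polynomial.binomExpansion q (x l) (-(p ^ (N + 1) * e))
    rw [hk]
    have e2 : q.eval (x l) = eval x f := (eval_eq_uni l f x).symm
    have e3 : q.derivative.eval (x l) = eval x (pderiv l f) := by
      rw [eval_eq_uni l, uni_pderiv, hq, Polynomial.derivative_map]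
    rw [e2, e3]
    obtain ⟨c, hc⟩ := hf
    obtain ⟨w, hw⟩ := eval_congr_dvd p (pderiv l f) x x0 hx
    have hw' : eval x (pderiv l f) = eval x0 (pderiv l f) + p * w := by linarith
    rw [hc, hw']
    refine ⟨t * c + e * b - t * w * e + t * k * p ^ N * e ^ 2, ?_⟩
    have : t * eval x0 (pderiv l f) = 1 - b * p := by linarith
    linear_combination (-(p : ℤ) ^ (N + 1) * e) * this

/-- reduction of a polynomial along the hypersurface -/
lemma hensel' {r : ℕ} (f : MvPolynomial (Fin (r + 1)) ℤ) (p : ℕ) (hp : p.Prime)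
    (l : Fin (r + 1)) (x0 : Fin (r + 1) → ℤ) (h : ¬ (p : ℤ) ∣ eval x0 (pderiv l f)) (N : ℕ)
    (F : MvPolynomial (Fin (r + 1)) ℤ) :
    ∃ G : MvPolynomial (Fin r) ℤ, ∀ x : Fin (r + 1) → ℤ, (∀ i, (p : ℤ) ∣ x i - x0 i) →
      (p : ℤ) ^ N ∣ eval x f →
      (p : ℤ) ^ N ∣ eval x F - eval (fun j => x (l.succAbove j)) G := by
  rcases N with _ | N
  · exact ⟨0, fun x _ _ => by simp⟩
  obtain ⟨φ, hφ⟩ := hensel f p hp l x0 h N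
  refine ⟨Polynomial.eval φ (uni l F), fun x hx hf => ?_⟩
  rw [eval_uni_eval, eval_eq_uni l F]
  exact (hφ x hx hf).trans (Polynomial.sub_dvd_eval_sub _ _ _)

lemma det_dvd {r s : ℕ} (p : ℤ) (E : ℕ) (A : Matrix (Fin s) (Fin s) ℤ)
    (G : Fin s → MvPolynomial (Fin r) ℤ) (c : Fin r → ℤ) (u : Fin s → Fin r → ℤ)
    (h : ∀ j k, p ^ E ∣ A j k - eval (fun i => c i + p * u j i) (G k))
    (hE : ∀ α : Fin s → (Fin r →₀ ℕ), Function.Injective α → E ≤ ∑ k, (α k).sum fun _ e => e) :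
    p ^ E ∣ A.det := by
  classical
  let G' : Fin s → MvPolynomial (Fin r) ℤ := fun k => aeval (fun i => C (c i) + X i) (G k)
  let T : Finset (Fin r →₀ ℕ) := Finset.univ.biUnion fun k => (G' k).support
  let w : (Fin r →₀ ℕ) → Fin s → ℤ := fun α j => ∏ i, u j i ^ α i
  let A' : Matrix (Fin s) (Fin s) ℤ := fun k => ∑ α ∈ T, (coeff α (G' k) * p ^ (α.sum fun _ e => e)) • w α
  have hA' : ∀ j k, A' k j = eval (fun i => c i + p * u j i) (G k) := by
    intro j k
    have : eval (fun i => c i + p * u j i) (G k) = eval (fun i => p * u j i) (G' k) := by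
      simp only [G']
      generalize G k = g
      induction g using MvPolynomial.induction_on with
      | C a => simp
      | add a b ha hb => simp only [map_add, ha, hb]
      | mul_X a i ha => simp only [map_mul, ha, aeval_X, map_add, eval_X, eval_C]
    rw [this, eval_eq']
    simp only [A', Finset.sum_apply, Pi.smul_apply, smul_eq_mul]
    rw [← Finset.sum_subset (Finset.subset_biUnion_of_mem (fun k => (G' k).support) (Finset.mem_univ k))]
    · refine Finset.sum_congr rfl fun α _ => ?_
      simp only [w, mul_pow, Finset.prod_mul_distrib, Finset.prod_pow_eq_pow_sum]
      rw [Finsupp.sum_fintype _ _ (fun _ => rfl)]; ring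
    · intro α _ hα
      rw [notMem_support_iff.1 hα]; ring
  have h1 : p ^ E ∣ A.det - A'.transpose.det := by
    rw [← Ideal.mem_span_singleton, ← Ideal.Quotient.eq, RingHom.map_det, RingHom.map_det]
    congr 1
    ext j k
    simp only [RingHom.mapMatrix_apply, Matrix.map_apply, Matrix.transpose_apply]
    rw [Ideal.Quotient.eq, Ideal.mem_span_singleton, hA']
    exact h j k
  have h2 : p ^ E ∣ A'.det := by
    have e : A'.det = (Matrix.detRowAlternating (R := ℤ)).toMultilinearMap A' := rfl
    rw [e]
    simp only [A']
    rw [MultilinearMap.map_sum_finset]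
    refine Finset.dvd_sum fun α _ => ?_
    rw [MultilinearMap.map_smul_univ]
    by_cases hα : Function.Injective α
    · rw [smul_eq_mul, Finset.prod_mul_distrib, Finset.prod_pow_eq_pow_sum]
      exact Dvd.dvd.mul_right (Dvd.dvd.mul_left (pow_dvd_pow _ (hE α hα)) _) _
    · have : (Matrix.detRowAlternating (R := ℤ)).toMultilinearMap (fun i => w (α i)) = 0 := by
        apply AlternatingMap.map_eq_zero_of_not_injective
        intro hi; exact hα (fun a b hab => hi (by simp [hab]))
      rw [this, smul_zero]; exact dvd_zero _
  rw [Matrix.det_transpose] at h1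
  exact (dvd_sub_left h2).1 h1

lemma comb {β : Type*} [DecidableEq β] (deg : β → ℕ) (K s : ℕ) (T : Finset β) (hT : ∀ b, deg b < K → b ∈ T)
    (α : Fin s → β) (hα : Function.Injective α) :
    K * s ≤ (∑ k, deg (α k)) + ∑ b ∈ T, (K - deg b) := by
  have h1 : K * s = ∑ k : Fin s, K := by simp [mul_comm]
  have h2 : ∑ k, (K - deg (α k)) ≤ ∑ b ∈ T, (K - deg b) := by
    rw [← Finset.sum_image (f := fun b => K - deg b) (s := Finset.univ) (g := α) (fun a _ b _ h => hα h)]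
    have : ∑ b ∈ Finset.univ.image α, (K - deg b) =
        ∑ b ∈ (Finset.univ.image α).filter (· ∈ T), (K - deg b) := by
      rw [Finset.sum_filter_of_ne]
      intro b _ hb; exact hT b (by omega)
    rw [this]
    exact Finset.sum_le_sum_of_subset (fun b hb => (Finset.mem_filter.1 hb).2)
  calc K * s = ∑ k : Fin s, K := h1
    _ ≤ ∑ k, (deg (α k) + (K - deg (α k))) := Finset.sum_le_sum fun k _ => by omega
    _ ≤ _ := by rw [Finset.sum_add_distrib]; omega

lemma comb1 (s : ℕ) (α : Fin s → (Fin 1 →₀ ℕ)) (hα : Function.Injective α) :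
    s * (s - 1) / 2 ≤ ∑ k, (α k).sum fun _ e => e := by
  have h := comb (fun n : ℕ => n) s s (Finset.range s) (fun b hb => Finset.mem_range.2 hb)
    (fun k => α k 0) (fun a b hab => hα (by ext; exact hab))
  have h3 : ∑ k, (α k).sum (fun _ e => e) = ∑ k, α k 0 :=
    Finset.sum_congr rfl fun k _ => by rw [Finsupp.sum_fintype _ _ (fun _ => rfl)]; simp
  have h4 : ∑ b ∈ Finset.range s, (s - b) + ∑ b ∈ Finset.range s, b = s * s := by
    rw [← Finset.sum_add_distrib, Finset.sum_congr rfl (g := fun _ => s)]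
    · simp
    · intro b hb; have := Finset.mem_range.1 hb; omega
  rw [h3, ← Finset.sum_range_id]
  omega

lemma comb2 (K s : ℕ) (α : Fin s → (Fin 2 →₀ ℕ)) (hα : Function.Injective α) :
    K * s ≤ (∑ k, (α k).sum fun _ e => e) + K * (K + 1) * (K + 2) / 6 := by
  have h := comb (fun n : ℕ × ℕ => n.1 + n.2) K s
    ((Finset.range K).biUnion fun j => Finset.HasAntidiagonal.antidiagonal j) (fun b hb => by simpa using hb)
    (fun k => (α k 0, α k 1)) (fun a b hab => hα (by
      ext i
      fin_cases i
      · exact (Prod.ext_iff.1 hab).1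
      · exact (Prod.ext_iff.1 hab).2))
  have h3 : ∑ k, (α k).sum (fun _ e => e) = ∑ k, (α k 0 + α k 1) :=
    Finset.sum_congr rfl fun k _ => by rw [Finsupp.sum_fintype _ _ (fun _ => rfl)]; simp
  rw [h3]
  refine h.trans (Nat.add_le_add_left ?_ _)
  have h5 : ∀ M ≤ K, 6 * ∑ j ∈ Finset.range M, (j + 1) * (K - j) + M * (M + 1) * (2 * M + 1) = 3 * M * (M + 1) * (K + 1) := by
    intro M
    induction M with
    | zero => simp
    | succ M ih =>
      intro hM
      rw [Finset.sum_range_succ, mul_add]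
      have := ih (by omega)
      obtain ⟨c, rfl⟩ : ∃ c, K = M + c := ⟨K - M, by omega⟩
      rw [Nat.add_sub_cancel_left]
      nlinarith
  have h6 := h5 K le_rfl
  rw [Nat.le_div_iff_mul_le (by norm_num)]
  rw [Finset.sum_biUnion]
  · have : ∑ x ∈ Finset.range K, ∑ i ∈ Finset.HasAntidiagonal.antidiagonal x, (K - (i.1 + i.2)) = ∑ j ∈ Finset.range K, (j + 1) * (K - j) := by
      refine Finset.sum_congr rfl fun j _ => ?_
      rw [Finset.sum_congr rfl (g := fun _ => K - j)]
      · simp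
      · intro i hi; rw [Finset.HasAntidiagonal.mem_antidiagonal.1 hi]
    rw [this]
    nlinarith
  · intro i _ j _ hij
    simp only [Function.onFun, Finset.disjoint_left, Finset.HasAntidiagonal.mem_antidiagonal]
    rintro a rfl h; exact hij h

end Sal


namespace Sal

lemma det_hensel {r s : ℕ} (f : MvPolynomial (Fin (r + 1)) ℤ) (p : ℕ) (hp : p.Prime)
    (x0 : Fin (r + 1) → ℤ) (h : ∃ l, ¬ (p : ℤ) ∣ eval x0 (pderiv l f)) (E : ℕ)
    (hE : ∀ α : Fin s → (Fin r →₀ ℕ), Function.Injective α → E ≤ ∑ k, (α k).sum fun _ e => e)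
    (F : Fin s → MvPolynomial (Fin (r + 1)) ℤ) (x : Fin s → Fin (r + 1) → ℤ)
    (hx : ∀ j i, (p : ℤ) ∣ x j i - x0 i) (hf : ∀ j, (p : ℤ) ^ E ∣ eval (x j) f)
    (A : Matrix (Fin s) (Fin s) ℤ) (hA : ∀ j k, (p : ℤ) ^ E ∣ A j k - eval (x j) (F k)) :
    (p : ℤ) ^ E ∣ A.det := by
  obtain ⟨l, hl⟩ := h
  choose G hG using fun k => hensel' f p hp l x0 hl E (F k)
  choose u hu using hx
  refine det_dvd p E A G (fun j => x0 (l.succAbove j)) (fun j i => u j (l.succAbove i)) ?_ hE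
  intro j k
  have h1 := hG k (x j) (fun i => ⟨_, hu j i⟩) (hf j)
  have h2 : (fun i => x j (l.succAbove i)) =
      fun i => x0 (l.succAbove i) + p * u j (l.succAbove i) := by
    funext i; rw [← hu]; ring
  rw [h2] at h1
  have := dvd_add (hA j k) h1
  simpa using this

lemma class_poly {r : ℕ} (I : Finset (Fin (r + 1) →₀ ℕ)) (E : ℕ)
    (hE : ∀ α : Fin I.card → (Fin r →₀ ℕ), Function.Injective α →
      E ≤ ∑ k, (α k).sum fun _ e => e)
    (N : ℕ) (hN : 1 ≤ N) (T : Finset ℕ) (hT : ∀ p ∈ T, p.Prime)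
    (f : MvPolynomial (Fin (r + 1)) ℤ) (x0 : Fin (r + 1) → ℤ)
    (hx0 : ∀ p ∈ T, ∃ l, ¬ (p : ℤ) ∣ eval x0 (pderiv l f))
    (hq : (I.card.factorial : ℝ) * (N : ℝ) ^ (∑ α ∈ I, α.degree) < ((∏ p ∈ T, p : ℕ) : ℝ) ^ E)
    (S : Set (Fin (r + 1) → ℤ))
    (hS : ∀ x ∈ S, (∀ i, |x i| ≤ N) ∧ eval x f = 0 ∧ ∀ p ∈ T, ∀ i, (p : ℤ) ∣ x i - x0 i) :
    ∃ g : MvPolynomial (Fin (r + 1)) ℤ, g ≠ 0 ∧ g.support ⊆ I ∧ ∀ x ∈ S, eval x g = 0 := by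
  classical
  let e := I.equivFin.symm
  let v : S → Fin I.card → ℤ := fun x k => eval x.1 (monomial (e k).1 1)
  have hv : ∀ (x : S) k, |(v x k : ℝ)| ≤ (N : ℝ) ^ (e k).1.degree := by
    intro x k
    simp only [v]
    rw [eval_monomial, one_mul, Finsupp.prod_fintype _ _ (by simp), Int.cast_prod,
      Finset.abs_prod, Finsupp.degree_eq_sum, ← Finset.prod_pow_eq_pow_sum]
    refine Finset.prod_le_prod (fun i _ => abs_nonneg _) fun i _ => ?_
    rw [Int.cast_pow, abs_pow]
    refine pow_le_pow_left₀ (abs_nonneg _) ?_ _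
    exact_mod_cast (hS x.1 x.2).1 i
  have hdet : ∀ x : Fin I.card → S, (Matrix.of fun i j => v (x i) j).det = 0 := by
    intro x
    by_contra hne
    have hd : ((∏ p ∈ T, p : ℕ) : ℤ) ^ E ∣ (Matrix.of fun i j => v (x i) j).det := by
      rw [Nat.cast_prod, ← Finset.prod_pow]
      refine Finset.prod_dvd_of_coprime ?_ ?_
      · intro p hp q hq hpq
        refine IsCoprime.pow ?_
        exact Nat.isCoprime_iff_coprime.2 ((Nat.coprime_primes (hT p hp) (hT q hq)).2 hpq)
      · intro p hp
        exact det_hensel f p (hT p hp) x0 (hx0 p hp) E hE (fun k => monomial (e k).1 1)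
          (fun j => (x j).1) (fun j i => (hS _ (x j).2).2.2 p hp i)
          (fun j => by rw [(hS _ (x j).2).2.1]; exact dvd_zero _) _ (fun j k => by simp [v])
    have h1 := Int.le_of_dvd (abs_pos.2 hne) ((dvd_abs _ _).2 hd)
    have h2 := det_bound (Matrix.of fun i j => v (x i) j) (fun k => (N : ℝ) ^ (e k).1.degree)
      (fun i j => hv _ _)
    have h3 : ∏ k, (N : ℝ) ^ (e k).1.degree = (N : ℝ) ^ (∑ α ∈ I, α.degree) := by
      rw [Finset.prod_pow_eq_pow_sum]
      congr 1
      rw [← Finset.sum_coe_sort I (fun α => α.degree)]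
      exact Equiv.sum_comp e (fun α : I => α.1.degree)
    rw [h3] at h2
    have h4 : (((∏ p ∈ T, p : ℕ) : ℝ)) ^ E ≤ |((Matrix.of fun i j => v (x i) j).det : ℝ)| := by
      exact_mod_cast h1
    linarith
  obtain ⟨c, hc, hc0, -⟩ := null_vec (fun _ => True) trivial I.card v (fun _ _ _ _ _ => trivial) hdet
  have hco : ∀ k, coeff (e k).1 (∑ k, monomial (e k).1 (c k)) = c k := by
    intro k
    rw [coeff_sum, Finset.sum_eq_single k]
    · simp
    · intro b _ hb
      rw [coeff_monomial, if_neg]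
      intro h; exact hb (e.injective (Subtype.ext h))
    · simp
  refine ⟨∑ k, monomial (e k).1 (c k), ?_, ?_, ?_⟩
  · intro h
    apply hc; funext k
    rw [← hco k, h]; simp
  · refine (support_sum).trans ?_
    refine Finset.biUnion_subset.2 fun k _ => ?_
    refine support_monomial_subset.trans ?_
    simpa using (e k).2
  · intro x hx
    rw [map_sum, ← hc0 ⟨x, hx⟩]
    refine Finset.sum_congr rfl fun k _ => ?_
    simp [v, eval_monomial]

end Sal


namespace Sal

lemma real_close (N s σ E : ℕ) (q δ : ℝ) (hN : s < N) (h : (σ : ℝ) + 1 ≤ (1 / 2 + δ) * E)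
    (hq : (N : ℝ) ^ (1 / 2 + δ) ≤ q) : (s : ℝ) * (N : ℝ) ^ σ < q ^ E := by
  have hN0 : (0 : ℝ) < N := by exact_mod_cast (by omega : 0 < N)
  have hN1 : (1 : ℝ) ≤ N := by exact_mod_cast (by omega : 1 ≤ N)
  have hs : (s : ℝ) < N := by exact_mod_cast hN
  calc (s : ℝ) * (N : ℝ) ^ σ < N * (N : ℝ) ^ σ := by
        exact mul_lt_mul_of_pos_right hs (by positivity)
    _ = (N : ℝ) ^ ((σ : ℝ) + 1) := by
        rw [Real.rpow_add hN0, Real.rpow_natCast, Real.rpow_one, mul_comm]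
    _ ≤ (N : ℝ) ^ ((1 / 2 + δ) * E) := Real.rpow_le_rpow_of_exponent_le hN1 h
    _ = ((N : ℝ) ^ (1 / 2 + δ)) ^ E := by rw [Real.rpow_mul hN0.le, Real.rpow_natCast]
    _ ≤ q ^ E := pow_le_pow_left₀ (by positivity) hq _

noncomputable def crvI (D : ℕ) : Finset (Fin 2 →₀ ℕ) :=
  (Finset.range 2 ×ˢ Finset.range (D + 1)).image
    (fun t => Finsupp.equivFunOnFinite.symm ![t.1, t.2])

lemma crvI_inj (D : ℕ) : Set.InjOn (fun t : ℕ × ℕ => (Finsupp.equivFunOnFinite.symm ![t.1, t.2] : Fin 2 →₀ ℕ))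
    (Finset.range 2 ×ˢ Finset.range (D + 1) : Finset (ℕ × ℕ)) := by
  intro a _ b _ h
  have h' := Finsupp.equivFunOnFinite.symm.injective h
  exact Prod.ext (congrFun h' 0) (congrFun h' 1)

lemma crvI_card (D : ℕ) : (crvI D).card = 2 * (D + 1) := by
  rw [crvI, Finset.card_image_of_injOn (crvI_inj D)]; simp

lemma crvI_sum (D : ℕ) : ∑ α ∈ crvI D, α.degree = (D + 1) ^ 2 := by
  rw [crvI, Finset.sum_image (crvI_inj D)]
  simp only [Finsupp.degree_eq_sum, Finsupp.coe_equivFunOnFinite_symm, Fin.sum_univ_two,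
    Matrix.cons_val_zero, Matrix.cons_val_one, Finset.sum_product, Finset.sum_range_succ _ 1,
    Finset.sum_range_one, Finset.sum_add_distrib, Finset.sum_const, Finset.card_range]
  have := Finset.sum_range_id_mul_two (D + 1)
  simp at this ⊢
  nlinarith

lemma crvI_mem (D : ℕ) (α) (h : α ∈ crvI D) : α 0 < 2 ∧ α.degree ≤ D + 1 := by
  simp only [crvI, Finset.mem_image, Finset.mem_product, Finset.mem_range] at h
  obtain ⟨t, ⟨h1, h2⟩, rfl⟩ := h
  simp only [Finsupp.degree_eq_sum, Finsupp.coe_equivFunOnFinite_symm, Fin.sum_univ_two,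
    Matrix.cons_val_zero, Matrix.cons_val_one]
  omega

noncomputable def srfI (D : ℕ) : Finset (Fin 3 →₀ ℕ) :=
  (Finset.range 4 ×ˢ ((Finset.range (D + 1)).sigma fun a => Finset.range (a + 1))).image
    (fun t => Finsupp.equivFunOnFinite.symm ![t.1, t.2.2, t.2.1 - t.2.2])

lemma srfI_inj (D : ℕ) : Set.InjOn (fun t : ℕ × (Σ _ : ℕ, ℕ) => (Finsupp.equivFunOnFinite.symm ![t.1, t.2.2, t.2.1 - t.2.2] : Fin 3 →₀ ℕ))
    (Finset.range 4 ×ˢ ((Finset.range (D + 1)).sigma fun a => Finset.range (a + 1)) : Finset (ℕ × (Σ _ : ℕ, ℕ))) := by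
  rintro ⟨a, b, c⟩ ha ⟨a', b', c'⟩ hb h
  have h' := Finsupp.equivFunOnFinite.symm.injective h
  have h0 : a = a' := congrFun h' 0
  have h1 : c = c' := congrFun h' 1
  have h2 : b - c = b' - c' := congrFun h' 2
  simp only [Finset.coe_product, Set.mem_prod, Finset.mem_coe, Finset.mem_sigma, Finset.mem_range] at ha hb
  obtain rfl : b = b' := by omega
  subst h0 h1; rfl

lemma srfI_card (D : ℕ) : (srfI D).card = 2 * (D + 1) * (D + 2) := by
  rw [srfI, Finset.card_image_of_injOn (srfI_inj D)]
  simp only [Finset.card_product, Finset.card_range, Finset.card_sigma]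
  have : (∑ x ∈ Finset.range (D + 1), (x + 1)) * 2 = (D + 1) * (D + 2) := by
    induction D with
    | zero => simp
    | succ D ih => rw [Finset.sum_range_succ, add_mul, ih]; ring
  linarith

lemma srfI_sum (D : ℕ) : 3 * ∑ α ∈ srfI D, α.degree = (D + 1) * (D + 2) * (4 * D + 9) := by
  rw [srfI, Finset.sum_image (srfI_inj D)]
  simp only [Finsupp.degree_eq_sum, Finsupp.coe_equivFunOnFinite_symm, Fin.sum_univ_three,
    Finset.sum_product, Finset.sum_sigma, Matrix.cons_val]
  have h1 : ∀ c, ∑ a ∈ Finset.range (D + 1), ∑ b ∈ Finset.range (a + 1), (c + b + (a - b)) =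
      ∑ a ∈ Finset.range (D + 1), (a + 1) * (c + a) := by
    intro c
    refine Finset.sum_congr rfl fun a _ => ?_
    rw [Finset.sum_congr rfl (g := fun _ => c + a)]
    · simp
    · intro b hb; have := Finset.mem_range.1 hb; omega
  simp only [h1]
  have h2 : ∀ c, 6 * ∑ a ∈ Finset.range (D + 1), (a + 1) * (c + a) = (D + 1) * (D + 2) * (3 * c + 2 * D) := by
    intro c
    induction D with
    | zero => simp; ring
    | succ D ih =>
      rw [Finset.sum_range_succ, mul_add, ih]
      · ring
      · intro c
        refine Finset.sum_congr rfl fun a _ => ?_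
        rw [Finset.sum_congr rfl (g := fun _ => c + a)]
        · simp
        · intro b hb; have := Finset.mem_range.1 hb; omega
  have h3 : 6 * ∑ x ∈ Finset.range 4, ∑ a ∈ Finset.range (D + 1), (a + 1) * (x + a) = 2 * ((D + 1) * (D + 2) * (4 * D + 9)) := by
    rw [Finset.mul_sum]
    simp only [h2]
    simp only [Finset.sum_range_succ, Finset.sum_range_zero]
    ring
  linarith

lemma srfI_mem (D : ℕ) (α) (h : α ∈ srfI D) : α 0 < 4 ∧ α.degree ≤ D + 3 := by
  simp only [srfI, Finset.mem_image, Finset.mem_product, Finset.mem_range, Finset.mem_sigma] at h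
  obtain ⟨t, ⟨h1, h2⟩, rfl⟩ := h
  simp only [Finsupp.degree_eq_sum, Finsupp.coe_equivFunOnFinite_symm, Fin.sum_univ_three,
    Matrix.cons_val_zero, Matrix.cons_val_one, Matrix.cons_val]
  omega

lemma deg_of_supp {n : ℕ} (g : MvPolynomial (Fin n) ℤ) (I : Finset (Fin n →₀ ℕ)) (h : g.support ⊆ I)
    (i : Fin n) (k D : ℕ) (hk : 0 < k) (hI : ∀ α ∈ I, α i < k ∧ α.degree ≤ D) :
    g.degreeOf i < k ∧ g.totalDegree ≤ D := by
  refine ⟨(degreeOf_lt_iff hk).2 fun α hα => (hI α (h hα)).1, ?_⟩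
  exact Finset.sup_le fun α hα => (hI α (h hα)).2

lemma curve_det (δ : ℝ) (hδ : 0 < δ) : ∃ D N0 : ℕ, ∀ N ≥ N0, ∀ (T : Finset ℕ) 
    (f : MvPolynomial (Fin 2) ℤ) (x0 : Fin 2 → ℤ) (S : Set (Fin 2 → ℤ)), (∀ p ∈ T, p.Prime) →
    (∀ p ∈ T, ∃ l, ¬ (p : ℤ) ∣ eval x0 (pderiv l f)) →
    (N : ℝ) ^ (1 / 2 + δ) ≤ ((∏ p ∈ T, p : ℕ) : ℝ) → 
    (∀ x ∈ S, (∀ i, |x i| ≤ N) ∧ eval x f = 0 ∧ ∀ p ∈ T, ∀ i, (p : ℤ) ∣ x i - x0 i) →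
    ∃ g : MvPolynomial (Fin 2) ℤ, g ≠ 0 ∧ g.degreeOf 0 < 2 ∧ g.totalDegree ≤ D ∧ ∀ x ∈ S, eval x g = 0 := by
  obtain ⟨D, hD⟩ := exists_nat_gt (2 / δ)
  have hD' : 2 < δ * D := by rw [div_lt_iff₀ hδ] at hD; linarith
  refine ⟨D + 1, (2 * (D + 1)).factorial + 1, fun N hN T f x0 S hT hx0 hq hS => ?_⟩
  obtain ⟨g, hg, hgI, hgS⟩ := class_poly (crvI D) ((D + 1) * (2 * D + 1)) (fun α hα => by
    have := comb1 _ α hα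
    generalize (∑ k, (α k).sum fun _ e => e) = σ at this ⊢
    rw [crvI_card] at this
    convert this using 1
    rw [show 2 * (D + 1) - 1 = 2 * D + 1 by omega]
    rw [mul_assoc 2, Nat.mul_div_cancel_left _ (by norm_num)]) N (by omega) T hT f x0 hx0 (by
      refine real_close N _ _ _ _ δ (by rw [crvI_card]; omega) ?_ hq
      rw [crvI_sum]
      push_cast
      have : (0 : ℝ) ≤ D := by positivity
      nlinarith) S hS
  have := deg_of_supp g _ hgI 0 2 (D + 1) (by norm_num) (crvI_mem D)
  exact ⟨g, hg, this.1, this.2, hgS⟩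

lemma surf_det (δ : ℝ) (hδ : 0 < δ) : ∃ D N0 : ℕ, ∀ N ≥ N0, ∀ (T : Finset ℕ) 
    (f : MvPolynomial (Fin 3) ℤ) (x0 : Fin 3 → ℤ) (S : Set (Fin 3 → ℤ)), (∀ p ∈ T, p.Prime) →
    (∀ p ∈ T, ∃ l, ¬ (p : ℤ) ∣ eval x0 (pderiv l f)) →
    (N : ℝ) ^ (1 / 2 + δ) ≤ ((∏ p ∈ T, p : ℕ) : ℝ) → 
    (∀ x ∈ S, (∀ i, |x i| ≤ N) ∧ eval x f = 0 ∧ ∀ p ∈ T, ∀ i, (p : ℤ) ∣ x i - x0 i) →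
    ∃ g : MvPolynomial (Fin 3) ℤ, g ≠ 0 ∧ g.degreeOf 0 < 4 ∧ g.totalDegree ≤ D ∧ ∀ x ∈ S, eval x g = 0 := by
  obtain ⟨D, hD⟩ := exists_nat_gt (6 / δ)
  have hD' : 6 < δ * D := by rw [div_lt_iff₀ hδ] at hD; linarith
  have hD1 : 1 ≤ D := by
    rcases Nat.eq_zero_or_pos D with h | h
    · subst h; simp at hD'; linarith
    · exact h
  refine ⟨D + 3, (2 * (D + 1) * (D + 2)).factorial + 1, fun N hN T f x0 S hT hx0 hq hS => ?_⟩
  obtain ⟨g, hg, hgI, hgS⟩ := class_poly (srfI D) (D * (D + 1) * (8 * D + 22) / 3) (fun α hα => by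
    have := comb2 (2 * D) _ α hα
    generalize (∑ k, (α k).sum fun _ e => e) = σ at this ⊢
    rw [srfI_card] at this
    have h1 := Nat.div_mul_le_self (2 * D * (2 * D + 1) * (2 * D + 2)) 6
    have h2 := Nat.div_mul_le_self (D * (D + 1) * (8 * D + 22)) 3
    nlinarith) N (by omega) T hT f x0 hx0 (by
      refine real_close N _ _ _ _ δ (by rw [srfI_card]; omega) ?_ hq
      have h1 : 3 * ((∑ α ∈ srfI D, α.degree : ℕ) : ℝ) = (D + 1) * (D + 2) * (4 * D + 9) := by
        exact_mod_cast srfI_sum D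
      have h2 : (D : ℝ) * (D + 1) * (8 * D + 22) - 2 ≤ 3 * ((D * (D + 1) * (8 * D + 22) / 3 : ℕ) : ℝ) := by
        have : D * (D + 1) * (8 * D + 22) ≤ 3 * (D * (D + 1) * (8 * D + 22) / 3) + 2 := by omega
        have : (D : ℝ) * (D + 1) * (8 * D + 22) ≤ 3 * ((D * (D + 1) * (8 * D + 22) / 3 : ℕ) : ℝ) + 2 := by
          exact_mod_cast this
        linarith
      have hD2 : (1 : ℝ) ≤ D := by exact_mod_cast hD1
      generalize ((D * (D + 1) * (8 * D + 22) / 3 : ℕ) : ℝ) = E at *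
      generalize ((∑ α ∈ srfI D, α.degree : ℕ) : ℝ) = s at *
      have h3 : (1 / 2 + δ) * (D * (D + 1) * (8 * D + 22) - 2) ≤ (1 / 2 + δ) * (3 * E) :=
        mul_le_mul_of_nonneg_left h2 (by linarith)
      have h4 : 6 * ((D + 1) * (8 * D + 22) - 2) ≤ (δ * D) * ((D + 1 : ℝ) * (8 * D + 22) - 2) :=
        mul_le_mul_of_nonneg_right hD'.le (by nlinarith)
      have h5 : δ * 2 ≤ δ * D * 2 := by nlinarith
      nlinarith) S hS
  have := deg_of_supp g _ hgI 0 4 (D + 3) (by norm_num) (srfI_mem D)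
  exact ⟨g, hg, this.1, this.2, hgS⟩

end Sal


namespace Sal

lemma eval_cast {K : Type*} [Field K] {n : ℕ} (F : MvPolynomial (Fin n) ℤ) (y : Fin n → ℤ) :
    eval (fun i => (y i : K)) (map (Int.castRingHom K) F) = ((eval y F : ℤ) : K) := by
  rw [eval_map]
  induction F using MvPolynomial.induction_on with
  | C a => rw [eval₂_C, eval_C]; rfl
  | add a b ha hb => simp only [eval₂_add, ha, hb, map_add, Int.cast_add]
  | mul_X a i ha => simp only [eval₂_mul, ha, eval₂_X, map_mul, eval_X, Int.cast_mul]

lemma eval_cast_zero {K : Type*} [Field K] [CharZero K] {n : ℕ} (F : MvPolynomial (Fin n) ℤ)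
    (y : Fin n → ℤ) :
    eval (fun i => (y i : K)) (map (Int.castRingHom K) F) = 0 ↔ eval y F = 0 := by
  rw [eval_cast, Int.cast_eq_zero]

lemma totalDegree_map_le' {R S : Type*} [CommRing R] [CommRing S] (φ : R →+* S)
    {n : ℕ} (f : MvPolynomial (Fin n) R) : (map φ f).totalDegree ≤ f.totalDegree :=
  Finset.sup_mono (support_map_subset _ _)

lemma aeval_deg {R A : Type*} [CommRing R] [CommRing A] [Algebra R A] {σ τ : Type*} (f : MvPolynomial σ R)
    (g : σ → MvPolynomial τ A) (k : ℕ) (hg : ∀ i, (g i).totalDegree ≤ k) :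
    (aeval g f).totalDegree ≤ f.totalDegree * k := by
  rw [aeval_def, eval₂_eq]
  refine totalDegree_finsetSum_le fun α hα => ?_
  refine (totalDegree_mul _ _).trans ?_
  rw [IsScalarTower.algebraMap_apply R A, algebraMap_eq, totalDegree_C, zero_add]
  refine (totalDegree_finsetProd _ _).trans ?_
  refine (Finset.sum_le_sum (g := fun i => α i * k) fun i _ =>
    (totalDegree_pow _ _).trans (Nat.mul_le_mul_left _ (hg i))).trans ?_
  rw [← Finset.sum_mul]
  exact Nat.mul_le_mul_right _ (le_totalDegree hα)

/-- restriction to a line -/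
noncomputable def onLine {R : Type*} [CommRing R] {n : ℕ} (x v : Fin n → R) (f : MvPolynomial (Fin n) R) :
    Polynomial R := aeval (fun i => Polynomial.C (x i) + Polynomial.X * Polynomial.C (v i)) f

lemma onLine_eval {R : Type*} [CommRing R] {n : ℕ} (x v : Fin n → R) (f : MvPolynomial (Fin n) R) (t : R) :
    (onLine x v f).eval t = eval (fun i => x i + t * v i) f := by
  unfold onLine
  induction f using MvPolynomial.induction_on with
  | C a => simp
  | add a b ha hb => simp only [map_add, Polynomial.eval_add, ha, hb]
  | mul_X a i ha =>
    simp only [map_mul, aeval_X, Polynomial.eval_mul, ha, Polynomial.eval_add, Polynomial.eval_C,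
      Polynomial.eval_X, eval_X]

lemma onLine_deg {R : Type*} [CommRing R] {n : ℕ} (x v : Fin n → R) (f : MvPolynomial (Fin n) R) :
    (onLine x v f).natDegree ≤ f.totalDegree := by
  unfold onLine
  have := aeval_natDegree_le (m := f.totalDegree) (n := 1) f le_rfl
    (fun i => Polynomial.C (x i) + Polynomial.X * Polynomial.C (v i)) (fun i => by
      refine (Polynomial.natDegree_add_le _ _).trans (max_le (by simp) ?_)
      refine Polynomial.natDegree_mul_le.trans ?_
      have := Polynomial.natDegree_X_le (R := R)
      simpa using this)
  simpa using this

lemma line_zero {n : ℕ} (F : MvPolynomial (Fin n) ℤ) (d : ℕ) (hd : F.totalDegree ≤ d)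
    (x v : Fin n → ℤ) (S : Finset (Fin n → ℤ))
    (hS : ∀ y ∈ S, eval y F = 0 ∧ ∃ τ : ℚ, ∀ i, (y i : ℚ) = x i + τ * v i) (hc : d < S.card)
    (t : ℤ) : eval (fun i => x i + t * v i) F = 0 := by
  classical
  let q := onLine (fun i => (x i : ℚ)) (fun i => (v i : ℚ)) (map (Int.castRingHom ℚ) F)
  choose! τ hτ using fun y hy => (hS y hy).2
  have hq : q = 0 := by
    by_contra hne
    have h1 : S.image τ ⊆ q.roots.toFinset := by
      intro z hz
      obtain ⟨y, hy, rfl⟩ := Finset.mem_image.1 hz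
      rw [Multiset.mem_toFinset, Polynomial.mem_roots hne, Polynomial.IsRoot, onLine_eval]
      have : (fun i => (x i : ℚ) + τ y * v i) = fun i => (y i : ℚ) := by
        funext i; exact (hτ y hy i).symm
      rw [this, eval_cast_zero]
      exact (hS y hy).1
    have h2 : (S.image τ).card = S.card := Finset.card_image_of_injOn (by
      intro a ha b hb hab
      funext i
      have h1 := hτ a ha i
      have h2 := hτ b hb i
      rw [hab, ← h2] at h1
      exact_mod_cast h1)
    have h3 := (Finset.card_le_card h1).trans ((Multiset.toFinset_card_le _).trans q.card_roots')
    have h4 : q.natDegree ≤ d := (onLine_deg _ _ _).trans ((totalDegree_map_le' _ _).trans hd)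
    omega
  have := onLine_eval (fun i => (x i : ℚ)) (fun i => (v i : ℚ)) (map (Int.castRingHom ℚ) F) (t : ℚ)
  change q.eval _ = _ at this
  rw [hq, Polynomial.eval_zero] at this
  have e : (fun i => (x i : ℚ) + (t : ℚ) * v i) = fun i => ((x i + t * v i : ℤ) : ℚ) := by
    funext i; push_cast; ring
  rw [e] at this
  exact (eval_cast_zero F _).1 this.symm

/-- shear -/
noncomputable def shear {R : Type*} [CommRing R] {m : ℕ} (γ : Fin m → R) :
    MvPolynomial (Fin (m + 1)) R →ₐ[R] MvPolynomial (Fin (m + 1)) R :=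
  aeval (Fin.cons (X 0) (fun j => X j.succ + C (γ j) * X 0))

lemma shear_eval {R : Type*} [CommRing R] {m : ℕ} (γ : Fin m → R) (f : MvPolynomial (Fin (m + 1)) R)
    (x : Fin (m + 1) → R) :
    eval x (shear γ f) = eval (Fin.cons (x 0) (fun j => x j.succ + γ j * x 0)) f := by
  unfold shear
  induction f using MvPolynomial.induction_on with
  | C a => simp
  | add a b ha hb => simp only [map_add, ha, hb]
  | mul_X a i ha =>
    rw [map_mul, map_mul, ha, aeval_X, map_mul, eval_X]
    congr 1
    refine Fin.cases ?_ (fun j => ?_) i <;> simp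

lemma shear_shear {R : Type*} [CommRing R] {m : ℕ} (γ : Fin m → R) (f : MvPolynomial (Fin (m + 1)) R) :
    shear (fun j => - γ j) (shear γ f) = f := by
  unfold shear
  induction f using MvPolynomial.induction_on with
  | C a => simp
  | add a b ha hb => simp only [map_add, ha, hb]
  | mul_X a i ha =>
    rw [map_mul, map_mul, ha, aeval_X]
    congr 1
    refine Fin.cases ?_ (fun j => ?_) i <;> simp

noncomputable def shearE {R : Type*} [CommRing R] {m : ℕ} (γ : Fin m → R) :
    MvPolynomial (Fin (m + 1)) R ≃ₐ[R] MvPolynomial (Fin (m + 1)) R :=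
  AlgEquiv.ofAlgHom (shear γ) (shear (fun j => - γ j))
    (AlgHom.ext fun f => by
      have := shear_shear (fun j => - γ j) f
      simpa using this) (AlgHom.ext fun f => by simpa using shear_shear γ f)

lemma shearE_apply {R : Type*} [CommRing R] {m : ℕ} (γ : Fin m → R) (f : MvPolynomial (Fin (m + 1)) R) :
    shearE γ f = shear γ f := rfl

lemma shear_deg_le {R : Type*} [CommRing R] {m : ℕ} (γ : Fin m → R) (f : MvPolynomial (Fin (m + 1)) R) :
    (shear γ f).totalDegree ≤ f.totalDegree := by
  unfold shear
  have h := aeval_deg f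
    (Fin.cons (X 0) (fun j => X j.succ + C (γ j) * X 0) : Fin (m + 1) → MvPolynomial (Fin (m + 1)) R) 1 (fun i => by
      have hX : ∀ i : Fin (m + 1), (X i : MvPolynomial (Fin (m + 1)) R).totalDegree ≤ 1 := by
        intro i
        refine (totalDegree_monomial_le _ _).trans ?_
        simp
      refine Fin.cases ?_ (fun j => ?_) i
      · simpa using hX 0
      · simp only [Fin.cons_succ]
        refine (totalDegree_add _ _).trans (max_le (hX _) ?_)
        refine (totalDegree_mul _ _).trans ?_
        simpa using hX 0)
  simpa using h

lemma shear_deg {R : Type*} [CommRing R] {m : ℕ} (γ : Fin m → R) (f : MvPolynomial (Fin (m + 1)) R) :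
    (shear γ f).totalDegree = f.totalDegree := by
  refine le_antisymm (shear_deg_le γ f) ?_
  conv_lhs => rw [← shear_shear γ f]
  exact shear_deg_le _ _

lemma shear_map {R S : Type*} [CommRing R] [CommRing S] (φ : R →+* S) {m : ℕ} (γ : Fin m → R)
    (f : MvPolynomial (Fin (m + 1)) R) : map φ (shear γ f) = shear (fun j => φ (γ j)) (map φ f) := by
  unfold shear
  induction f using MvPolynomial.induction_on with
  | C a => simp
  | add a b ha hb => simp only [map_add, ha, hb]
  | mul_X a i ha =>
    rw [map_mul, map_mul, ha, aeval_X, map_mul, map_X, map_mul, aeval_X]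
    congr 1
    refine Fin.cases ?_ (fun j => ?_) i <;> simp

lemma totalDegree_map_inj {R S : Type*} [CommRing R] [CommRing S] (φ : R →+* S) (hφ : Function.Injective φ)
    {n : ℕ} (f : MvPolynomial (Fin n) R) : (map φ f).totalDegree = f.totalDegree := by
  unfold totalDegree
  rw [support_map_of_injective f hφ]

lemma onLine_natDeg_lin {R : Type*} [CommRing R] (a b : R) :
    (Polynomial.C a + Polynomial.X * Polynomial.C b).natDegree ≤ 1 := by
  refine (Polynomial.natDegree_add_le _ _).trans (max_le (by simp) ?_)
  refine Polynomial.natDegree_mul_le.trans ?_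
  have := Polynomial.natDegree_X_le (R := R)
  simpa using this

lemma onLine_mono {R : Type*} [CommRing R] {n : ℕ} (x v : Fin n → R) (α : Fin n →₀ ℕ) :
    (onLine x v (monomial α 1)).coeff α.degree = eval v (monomial α 1) := by
  induction α using Finsupp.induction_linear with
  | zero => simp [onLine]
  | add α β ha hb =>
    have h1 : (monomial (α + β) (1 : R)) = monomial α 1 * monomial β 1 := by
      rw [monomial_mul, one_mul]
    have h2 : onLine x v (monomial (α + β) 1) = onLine x v (monomial α 1) * onLine x v (monomial β 1) := by
      rw [h1]; unfold onLine; rw [map_mul]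
    have hd : ∀ α : Fin n →₀ ℕ, (onLine x v (monomial α 1)).natDegree ≤ α.degree := fun α =>
      (onLine_deg x v _).trans (totalDegree_monomial_le _ _)
    rw [h2, h1, map_add, Polynomial.coeff_mul_add_eq_of_natDegree_le (hd α) (hd β), ha, hb, map_mul]
  | single i k =>
    have h1 : (monomial (Finsupp.single i k) (1 : R)) = X i ^ k := by rw [X_pow_eq_monomial]
    rw [h1, Finsupp.degree_single]
    unfold onLine
    rw [map_pow, aeval_X]
    have := Polynomial.coeff_pow_of_natDegree_le (m := k) (onLine_natDeg_lin (x i) (v i))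
    rw [mul_one] at this
    rw [this]
    simp

lemma onLine_coeff {R : Type*} [CommRing R] {n : ℕ} (x v : Fin n → R) (f : MvPolynomial (Fin n) R)
    (d : ℕ) (hd : f.totalDegree ≤ d) :
    (onLine x v f).coeff d = eval v (homogeneousComponent d f) := by
  classical
  have h1 : onLine x v f = ∑ α ∈ f.support, Polynomial.C (coeff α f) * onLine x v (monomial α 1) := by
    conv_lhs => rw [← support_sum_monomial_coeff f]
    unfold onLine
    rw [map_sum]
    refine Finset.sum_congr rfl fun α _ => ?_
    have : monomial α (coeff α f) = C (coeff α f) * monomial α 1 := by rw [C_mul_monomial, mul_one]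
    rw [this, map_mul, ← algebraMap_eq, AlgHom.commutes]
    rfl
  rw [h1, Polynomial.finsetSum_coeff, homogeneousComponent_apply, map_sum, Finset.sum_filter]
  refine Finset.sum_congr rfl fun α hα => ?_
  rw [Polynomial.coeff_C_mul]
  split_ifs with h
  · rw [← h, onLine_mono, ← mul_one (coeff α f), ← C_mul_monomial, map_mul, eval_C, mul_one]
  · have h2 : α.degree ≤ d := (le_totalDegree hα).trans hd
    rw [Polynomial.coeff_eq_zero_of_natDegree_lt, mul_zero]
    exact ((onLine_deg x v _).trans (totalDegree_monomial_le _ _)).trans_lt (lt_of_le_of_ne h2 h)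

lemma hom_eval_smul {R : Type*} [CommRing R] {n k : ℕ} (φ : MvPolynomial (Fin n) R)
    (h : φ.IsHomogeneous k) (t : R) (u : Fin n → R) :
    eval (fun i => t * u i) φ = t ^ k * eval u φ := by
  rw [eval_eq', eval_eq', Finset.mul_sum]
  refine Finset.sum_congr rfl fun α hα => ?_
  have : α.degree = k := (h.degree_eq_sum_deg_support hα).symm
  simp only [mul_pow, Finset.prod_mul_distrib, Finset.prod_pow_eq_pow_sum]
  rw [← this, Finsupp.degree_eq_sum]
  ring

lemma homComp_ne_zero {R : Type*} [CommRing R] {n : ℕ} (f : MvPolynomial (Fin n) R) (hf : f ≠ 0) :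
    homogeneousComponent f.totalDegree f ≠ 0 := by
  obtain ⟨α, hα, h⟩ := Finset.exists_mem_eq_sup f.support (support_nonempty.2 hf)
    (fun s => s.sum fun _ e => e)
  intro h0
  have := congrArg (coeff α) h0
  rw [coeff_homogeneousComponent, if_pos, coeff_zero] at this
  · exact (mem_support_iff.1 hα) this
  · exact h.symm

lemma top_const {R : Type*} [CommRing R] {m : ℕ} (g : MvPolynomial (Fin (m + 1)) R) (d : ℕ)
    (hd : g.totalDegree ≤ d) : ∃ c, (uni 0 g).coeff d = C c := by
  rcases hd.lt_or_eq with h | h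
  · refine ⟨0, ?_⟩
    rw [Polynomial.coeff_eq_zero_of_natDegree_lt, map_zero]
    exact (uni_natDegree_le 0 g).trans_lt h
  · have h1 := totalDegree_coeff_optionEquivLeft_add_le R _ (rename (finSuccEquiv' (0 : Fin (m + 1))) g) d
      (by rw [totalDegree_renameEquiv', h])
    rw [totalDegree_renameEquiv', h] at h1
    have h2 : ((uni 0 g).coeff d).totalDegree = 0 := by
      have : ((uni 0 g).coeff d).totalDegree + d ≤ d := h1
      omega
    exact ⟨_, totalDegree_eq_zero_iff_eq_C.1 h2⟩

lemma uni_top {K : Type*} [Field K] [CharZero K] {m : ℕ} (g : MvPolynomial (Fin (m + 1)) K) (d : ℕ)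
    (hd : g.totalDegree ≤ d) :
    (uni 0 g).coeff d = C (eval (Fin.cons 1 (fun _ => 0)) (homogeneousComponent d g)) := by
  obtain ⟨c, hc⟩ := top_const g d hd
  rw [hc, ← onLine_coeff (fun _ => 0) _ g d hd]
  have : onLine (fun _ => 0) (Fin.cons 1 (fun _ => 0)) g =
      (uni 0 g).map (aeval (fun _ => (0 : K)) : MvPolynomial (Fin m) K →ₐ[K] K).toRingHom := by
    refine Polynomial.funext fun t => ?_
    rw [onLine_eval, Polynomial.eval_map, eval_uni]
    congr 2
    funext i
    refine Fin.cases ?_ (fun j => ?_) i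
    · simp
    · simp
  rw [this, Polynomial.coeff_map, hc]
  simp

lemma onLine_shear {K : Type*} [Field K] [CharZero K] {m : ℕ} (f : MvPolynomial (Fin (m + 1)) K)
    (γ : Fin m → K) : onLine (fun _ => 0) (Fin.cons 1 (fun _ => 0) : Fin (m + 1) → K) (shear γ f) =
      onLine (fun _ => 0) (Fin.cons 1 γ : Fin (m + 1) → K) f := by
  refine Polynomial.funext fun t => ?_
  rw [onLine_eval, onLine_eval, shear_eval]
  have : (Fin.cons (0 + t * (Fin.cons 1 (fun _ => 0) : Fin (m + 1) → K) 0)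
      (fun j => 0 + t * (Fin.cons 1 (fun _ => 0) : Fin (m + 1) → K) j.succ + γ j * (0 + t *
        (Fin.cons 1 (fun _ => 0) : Fin (m + 1) → K) 0)) : Fin (m + 1) → K) =
      fun i => 0 + t * (Fin.cons 1 γ : Fin (m + 1) → K) i := by
    funext i
    refine Fin.cases ?_ (fun j => ?_) i
    · simp
    · simp [mul_comm]
  rw [this]

lemma shear_monic {K : Type*} [Field K] [CharZero K] {m : ℕ} (f : MvPolynomial (Fin (m + 1)) K)
    (hf : f ≠ 0) : ∃ γ : Fin m → ℤ, (∀ j, |γ j| ≤ f.totalDegree) ∧ ∃ c : K, c ≠ 0 ∧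
      (uni 0 (shear (fun j => (γ j : K)) f)).coeff f.totalDegree = C c := by
  obtain ⟨d, hd⟩ : ∃ d, d = f.totalDegree := ⟨_, rfl⟩
  rw [← hd]
  obtain ⟨F, hF⟩ : ∃ F, F = homogeneousComponent d f := ⟨_, rfl⟩
  have hF0 : F ≠ 0 := by rw [hF, hd]; exact homComp_ne_zero f hf
  have hFh : F.IsHomogeneous d := by rw [hF]; exact homogeneousComponent_isHomogeneous _ _
  obtain ⟨P, hPdef⟩ : ∃ P : MvPolynomial (Fin m) K, P =
    aeval (Fin.cons 1 X : Fin (m + 1) → MvPolynomial (Fin m) K) F := ⟨_, rfl⟩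
  have hPe : ∀ γ, eval γ P = eval (Fin.cons 1 γ : Fin (m + 1) → K) F := by
    intro γ
    rw [hPdef]
    clear hPdef hFh hF0 hF
    induction F using MvPolynomial.induction_on with
    | C a => simp
    | add a b ha hb => simp only [map_add, ha, hb]
    | mul_X a i ha =>
      rw [map_mul, map_mul, ha, aeval_X, map_mul, eval_X]
      congr 1
      refine Fin.cases ?_ (fun j => ?_) i <;> simp
  have hP : P ≠ 0 := by
    intro h0
    have : X 0 * F = 0 := by
      refine MvPolynomial.funext fun w => ?_
      rw [map_mul, eval_X, map_zero]
      by_cases hw : w 0 = 0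
      · rw [hw, zero_mul]
      · have h1 := hom_eval_smul F hFh (w 0) (Fin.cons 1 (fun j => w j.succ / w 0) : Fin (m + 1) → K)
        rw [← hPe, h0, map_zero, mul_zero] at h1
        have : (fun i => w 0 * (Fin.cons 1 (fun j => w j.succ / w 0) : Fin (m + 1) → K) i) = w := by
          funext i
          refine Fin.cases ?_ (fun j => ?_) i
          · simp
          · simp; field_simp
        rw [this] at h1
        rw [h1, mul_zero]
    rcases mul_eq_zero.1 this with h | h
    · exact X_ne_zero _ h
    · exact hF0 h
  have hPd : P.totalDegree ≤ d := by
    have := aeval_deg F (Fin.cons 1 X : Fin (m + 1) → MvPolynomial (Fin m) K) 1 (fun i => by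
      refine Fin.cases ?_ (fun j => ?_) i
      · simp
      · simp)
    rw [mul_one] at this
    rw [hPdef]
    exact this.trans hFh.totalDegree_le
  obtain ⟨γ, hγ, hγ0⟩ := pick P hP d hPd
  refine ⟨γ, hγ, eval (fun i => (γ i : K)) P, hγ0, ?_⟩
  have hsd : (shear (fun j => (γ j : K)) f).totalDegree ≤ d := by rw [shear_deg, hd]
  rw [uni_top _ d hsd, ← onLine_coeff (fun _ => 0) _ _ d hsd, hPe, hF,
    ← onLine_coeff (fun _ => 0) _ f d hd.ge]
  rw [onLine_shear]

end Sal


namespace Sal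

/-- all exponents of degree at most d -/
noncomputable def expo (n d : ℕ) : Finset (Fin n →₀ ℕ) :=
  (Finset.Iic (Finsupp.equivFunOnFinite.symm fun _ => d)).filter fun α => α.degree ≤ d

lemma mem_expo {n d : ℕ} {α : Fin n →₀ ℕ} : α ∈ expo n d ↔ α.degree ≤ d := by
  simp only [expo, Finset.mem_filter, Finset.mem_Iic, and_iff_right_iff_imp]
  intro h i
  rw [Finsupp.coe_equivFunOnFinite_symm]
  exact (Finsupp.le_degree i α).trans h

lemma height_red (n d : ℕ) : ∃ A K : ℕ, ∀ (F : MvPolynomial (Fin n) ℤ) (N : ℕ) (_ : 1 ≤ N)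
    (S : Set (Fin n → ℤ)), F ≠ 0 → F.totalDegree ≤ d →
    (∀ x ∈ S, (∀ i, |x i| ≤ N) ∧ eval x F = 0) →
    ∃ t : MvPolynomial (Fin n) ℤ, t ≠ 0 ∧ t.totalDegree ≤ d ∧ (∀ x ∈ S, eval x t = 0) ∧
      ∀ α, |coeff α t| ≤ A * N ^ K := by
  classical
  set I := expo n d with hI
  refine ⟨I.card.factorial, d * I.card, fun F N hN S hF hd hS => ?_⟩
  let e := I.equivFin.symm
  let v : S → Fin I.card → ℤ := fun x k => eval x.1 (monomial (e k).1 1)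
  have hN' : (1 : ℝ) ≤ N := by exact_mod_cast hN
  have hv : ∀ (x : S) k, |(v x k : ℝ)| ≤ (N : ℝ) ^ d := by
    intro x k
    have : |(v x k : ℝ)| ≤ (N : ℝ) ^ (e k).1.degree := by
      simp only [v]
      rw [eval_monomial, one_mul, Finsupp.prod_fintype _ _ (by simp), Int.cast_prod,
        Finset.abs_prod, Finsupp.degree_eq_sum, ← Finset.prod_pow_eq_pow_sum]
      refine Finset.prod_le_prod (fun i _ => abs_nonneg _) fun i _ => ?_
      rw [Int.cast_pow, abs_pow]
      refine pow_le_pow_left₀ (abs_nonneg _) ?_ _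
      exact_mod_cast (hS x.1 x.2).1 i
    exact this.trans (pow_le_pow_right₀ hN' (mem_expo.1 (e k).2))
  have hdet : ∀ x : Fin I.card → S, (Matrix.of fun i j => v (x i) j).det = 0 := by
    intro x
    refine Matrix.exists_mulVec_eq_zero_iff.1 ⟨fun k => coeff (e k).1 F, ?_, ?_⟩
    · intro h
      obtain ⟨α, hα⟩ := MvPolynomial.ne_zero_iff.1 hF
      have hαI : α ∈ I := mem_expo.2 ((le_totalDegree (mem_support_iff.2 hα)).trans hd)
      have := congrFun h (I.equivFin ⟨α, hαI⟩)
      simp only [e, Equiv.symm_apply_apply, Pi.zero_apply] at this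
      exact hα this
    · funext j
      have h1 := (hS _ (x j).2).2
      rw [F.as_sum, map_sum] at h1
      simp only [Matrix.mulVec, dotProduct, Matrix.of_apply, Pi.zero_apply, v]
      rw [← h1, Equiv.sum_comp e (fun α : I => eval (x j).1 (monomial α.1 1) * coeff α.1 F),
        Finset.sum_coe_sort I (fun α => eval (x j).1 (monomial α 1) * coeff α F)]
      symm
      rw [Finset.sum_subset (s₂ := I)]
      · refine Finset.sum_congr rfl fun α _ => ?_
        rw [eval_monomial, eval_monomial]; ring
      · intro α hα; exact mem_expo.2 ((le_totalDegree hα).trans hd)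
      · intro α _ hα
        rw [notMem_support_iff.1 hα]; simp
  obtain ⟨c, hc, hc0, hcb⟩ := null_vec_int I.card v ((N : ℝ) ^ d) (one_le_pow₀ hN') hv hdet
  have hco : ∀ α, coeff α (∑ k, monomial (e k).1 (c k)) =
      if h : α ∈ I then c (I.equivFin ⟨α, h⟩) else 0 := by
    intro α
    rw [coeff_sum]
    split_ifs with h
    · rw [Finset.sum_eq_single (I.equivFin ⟨α, h⟩)]
      · simp [e]
      · intro b _ hb
        rw [coeff_monomial, if_neg]
        rintro rfl; exact hb (by simp [e])
      · simp
    · refine Finset.sum_eq_zero fun k _ => ?_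
      rw [coeff_monomial, if_neg]
      rintro rfl; exact h (e k).2
  refine ⟨∑ k, monomial (e k).1 (c k), ?_, ?_, ?_, ?_⟩
  · intro h
    apply hc; funext k
    have := hco (e k).1
    rw [h, coeff_zero, dif_pos (e k).2] at this
    simp [e] at this
    simp [← this]
  · refine totalDegree_finsetSum_le fun k _ => ?_
    exact (totalDegree_monomial_le _ _).trans (mem_expo.1 (e k).2)
  · intro x hx
    rw [map_sum, ← hc0 ⟨x, hx⟩]
    refine Finset.sum_congr rfl fun k _ => ?_
    simp [v, eval_monomial]
  · intro α
    rw [hco α]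
    split_ifs with h
    · have := hcb (I.equivFin ⟨α, h⟩)
      rw [← pow_mul] at this
      exact_mod_cast this
    · simp; positivity

lemma eval_bound (n d : ℕ) : ∃ A : ℕ, ∀ (F : MvPolynomial (Fin n) ℤ) (N H : ℕ) (_ : 1 ≤ N)
    (x : Fin n → ℤ), F.totalDegree ≤ d → (∀ α, |coeff α F| ≤ H) → (∀ i, |x i| ≤ N) →
    |eval x F| ≤ A * H * N ^ d := by
  classical
  refine ⟨(expo n d).card, fun F N H hN x hd hH hx => ?_⟩
  rw [eval_eq']
  have hsub : F.support ⊆ expo n d := fun α hα => mem_expo.2 ((le_totalDegree hα).trans hd)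
  refine (Finset.abs_sum_le_sum_abs _ _).trans ?_
  refine (Finset.sum_le_card_nsmul _ _ ((H : ℤ) * N ^ d) ?_).trans ?_
  · intro α hα
    rw [abs_mul, Finset.abs_prod]
    refine mul_le_mul (hH α) ?_ (Finset.prod_nonneg fun _ _ => abs_nonneg _) (by positivity)
    calc ∏ i, |x i ^ α i| ≤ ∏ i, (N : ℤ) ^ α i := by
          refine Finset.prod_le_prod (fun i _ => abs_nonneg _) fun i _ => ?_
          rw [abs_pow]; exact pow_le_pow_left₀ (abs_nonneg _) (hx i) _
      _ = (N : ℤ) ^ α.degree := by rw [Finset.prod_pow_eq_pow_sum, Finsupp.degree_eq_sum]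
      _ ≤ (N : ℤ) ^ d := pow_le_pow_right₀ (by exact_mod_cast hN) (mem_expo.1 (hsub hα))
  · rw [nsmul_eq_mul, mul_assoc]
    refine mul_le_mul_of_nonneg_right ?_ (by positivity)
    exact_mod_cast Finset.card_le_card hsub

lemma pderiv_coeff_bound {n : ℕ} (F : MvPolynomial (Fin n) ℤ) (d H : ℕ) (hd : F.totalDegree ≤ d)
    (hH : ∀ α, |coeff α F| ≤ H) (l : Fin n) (α) : |coeff α (pderiv l F)| ≤ (H * d : ℕ) := by
  rw [coeff_pderiv]
  by_cases h : coeff (α + Finsupp.single l 1) F = 0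
  · rw [h]; simp; positivity
  · rw [abs_mul]
    push_cast
    refine mul_le_mul (hH _) ?_ (abs_nonneg _) (by positivity)
    have h1 := (le_totalDegree (mem_support_iff.2 h)).trans hd
    have h2 := Finsupp.le_degree l (α + Finsupp.single l 1)
    rw [Finsupp.add_apply, Finsupp.single_eq_same] at h2
    have h3 : α l + 1 ≤ d := h2.trans h1
    rw [abs_of_nonneg (by positivity)]
    exact_mod_cast h3

lemma pderiv_totalDegree {R : Type*} [CommRing R] {σ : Type*} (F : MvPolynomial σ R) (d : ℕ)
    (hd : F.totalDegree ≤ d) (l : σ) : (pderiv l F).totalDegree ≤ d := by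
  refine Finset.sup_le fun α hα => ?_
  rw [mem_support_iff, coeff_pderiv] at hα
  have h1 := (le_totalDegree (mem_support_iff.2 (left_ne_zero_of_mul hα))).trans hd
  have h2 : (α + Finsupp.single l 1).degree = α.degree + 1 := by simp
  have h3 : (α + Finsupp.single l 1).degree ≤ d := h1
  have : α.degree ≤ d := by omega
  exact this

lemma pool (r X : ℕ) (hX : 1 ≤ X) : ∃ P : Finset ℕ, P.card = r ∧
    ∀ p ∈ P, p.Prime ∧ X < p ∧ p ≤ 2 ^ r * X := by
  induction r with
  | zero => exact ⟨∅, rfl, by simp⟩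
  | succ r ih =>
    obtain ⟨P, hc, hP⟩ := ih
    obtain ⟨p, hp, h1, h2⟩ := Nat.exists_prime_lt_and_le_two_mul (2 ^ r * X) (by positivity)
    have hn : p ∉ P := fun h => by have := (hP p h).2.2; omega
    have h3 : X ≤ 2 ^ r * X := Nat.le_mul_of_pos_left X (by positivity)
    refine ⟨insert p P, by rw [Finset.card_insert_of_notMem hn, hc], fun q hq => ?_⟩
    rw [pow_succ]
    rcases Finset.mem_insert.1 hq with rfl | hq
    · exact ⟨hp, by omega, by linarith⟩
    · obtain ⟨a, b, c⟩ := hP q hq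
      exact ⟨a, b, by linarith⟩

lemma few_primes (P : Finset ℕ) (X k : ℕ) (hP : ∀ p ∈ P, p.Prime ∧ X < p) (m : ℤ) (hm : m ≠ 0)
    (hb : |m| < X ^ (k + 1)) : (P.filter fun p : ℕ => (p : ℤ) ∣ m).card ≤ k := by
  by_contra! h
  set Q := P.filter fun p : ℕ => (p : ℤ) ∣ m
  have hd : ((∏ p ∈ Q, p : ℕ) : ℤ) ∣ m := by
    rw [Nat.cast_prod]
    refine Finset.prod_dvd_of_coprime ?_ fun p hp => (Finset.mem_filter.1 hp).2
    intro p hp q hq hpq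
    exact Nat.isCoprime_iff_coprime.2 ((Nat.coprime_primes (hP p (Finset.mem_filter.1 hp).1).1
      (hP q (Finset.mem_filter.1 hq).1).1).2 hpq)
  have h1 := Int.le_of_dvd (abs_pos.2 hm) ((dvd_abs _ _).2 hd)
  have h2 : X ^ Q.card ≤ ∏ p ∈ Q, p := by
    rw [← Finset.prod_const]
    exact Finset.prod_le_prod' fun p hp => (hP p (Finset.mem_filter.1 hp).1).2.le
  have h3 : X ^ (k + 1) ≤ X ^ Q.card := by
    rcases Nat.eq_zero_or_pos X with h0 | h0
    · subst h0
      rw [zero_pow (by omega)]; omega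
    · exact Nat.pow_le_pow_right h0 h
  have h4 : ((X ^ (k + 1) : ℕ) : ℤ) ≤ ((∏ p ∈ Q, p : ℕ) : ℤ) := by exact_mod_cast h3.trans h2
  push_cast at h4 h1
  linarith

/-- number of residues of a set of zeros mod p -/
lemma residues {m : ℕ} (F : MvPolynomial (Fin (m + 1)) ℤ) (p : ℕ) (hp : p.Prime) (D : ℕ)
    (hD : F.totalDegree ≤ D) (hF : map (Int.castRingHom (ZMod p)) F ≠ 0)
    (S : Finset (Fin (m + 1) → ℤ)) (hS : ∀ x ∈ S, eval x F = 0) :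
    (S.image fun x i => x i % (p : ℤ)).card ≤ D * p ^ m := by
  classical
  have : Fact p.Prime := ⟨hp⟩
  have h := sz_card (map (Int.castRingHom (ZMod p)) F) hF Finset.univ D
    ((totalDegree_map_le' _ _).trans hD)
  rw [Finset.card_univ, ZMod.card] at h
  refine le_trans ?_ h
  refine Finset.card_le_card_of_injOn (fun x i => (x i : ZMod p)) ?_ ?_
  · intro z hz
    obtain ⟨x, hx, rfl⟩ := Finset.mem_image.1 hz
    refine Finset.mem_coe.2 ((@Finset.mem_filter _ _ (_) _ _).2 ⟨by simp, ?_⟩)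
    have : (fun i => ((x i % (p : ℤ) : ℤ) : ZMod p)) = fun i => (x i : ZMod p) := by
      funext i; simp
    show eval (fun i => ((x i % (p : ℤ) : ℤ) : ZMod p)) _ = 0
    rw [this, eval_cast, hS x hx, Int.cast_zero]
  · intro a ha b hb hab
    obtain ⟨x, -, rfl⟩ := Finset.mem_image.1 ha
    obtain ⟨y, -, rfl⟩ := Finset.mem_image.1 hb
    funext i
    have := congrFun hab i
    simp only at this
    rw [ZMod.intCast_eq_intCast_iff] at this
    have h' : x i % (p : ℤ) % p = y i % (p : ℤ) % p := this
    simpa using h'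

end Sal


namespace Sal

lemma bezoutZ {K : Type*} [Field K] [CharZero K] (f g : MvPolynomial (Fin 2) K)
    (hf : Irreducible f) (hg : ¬ f ∣ g) (D : ℕ) (hfD : f.totalDegree ≤ D)
    (hgD : g.totalDegree ≤ D) (S : Finset (Fin 2 → ℤ))
    (hS : ∀ y ∈ S, eval (fun i => (y i : K)) f = 0 ∧ eval (fun i => (y i : K)) g = 0) :
    S.card ≤ (2 * D * D + D) * (2 * D * D + D) := by
  classical
  have := bezout f g hf hg D hfD hgD (S.image fun y i => (y i : K)) (by
    intro y hy
    obtain ⟨z, hz, rfl⟩ := Finset.mem_image.1 hy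
    exact hS z hz)
  rwa [Finset.card_image_of_injective] at this
  intro a b hab
  funext i
  have h := congrFun hab i
  simpa using h

lemma clear_den {n : ℕ} (h : MvPolynomial (Fin n) ℚ) :
    ∃ (H : MvPolynomial (Fin n) ℤ) (c : ℤ), c ≠ 0 ∧
      map (Int.castRingHom ℚ) H = C (c : ℚ) * h := by
  induction h using MvPolynomial.induction_on with
  | C a =>
    refine ⟨C a.num, a.den, by exact_mod_cast a.den_nz, ?_⟩
    rw [map_C, ← C_mul]
    congr 1
    rw [mul_comm]; simp
  | add p q hp hq =>
    obtain ⟨H1, c1, h1, e1⟩ := hp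
    obtain ⟨H2, c2, h2, e2⟩ := hq
    refine ⟨C c2 * H1 + C c1 * H2, c1 * c2, mul_ne_zero h1 h2, ?_⟩
    rw [map_add, map_mul, map_mul, e1, e2, map_C, map_C]
    simp only [eq_intCast, Int.cast_mul, C_mul]
    ring
  | mul_X p i hp =>
    obtain ⟨H1, c1, h1, e1⟩ := hp
    exact ⟨H1 * X i, c1, h1, by rw [map_mul, e1, map_X, mul_assoc]⟩

lemma const_quot {K : Type*} [Field K] {n : ℕ} (h t : MvPolynomial (Fin n) K) (ht : t ≠ 0)
    (hd : t.totalDegree ≤ h.totalDegree) (hdvd : h ∣ t) : ∃ c : K, c ≠ 0 ∧ t = C c * h := by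
  obtain ⟨q, rfl⟩ := hdvd
  have hh : h ≠ 0 := left_ne_zero_of_mul ht
  have hq : q ≠ 0 := right_ne_zero_of_mul ht
  rw [totalDegree_mul_of_isDomain hh hq] at hd
  have : q = C (coeff 0 q) := totalDegree_eq_zero_iff_eq_C.1 (by omega)
  rw [this] at hq ⊢
  exact ⟨_, fun h0 => hq (by rw [h0, C_0]), mul_comm _ _⟩

lemma grad_primes (n d w A K : ℕ) : ∃ A0 k : ℕ, ∀ N X : ℕ, 1 ≤ N → A0 ≤ X → N ≤ X ^ w →
    ∀ (P : Finset ℕ) (_ : ∀ p ∈ P, p.Prime ∧ X < p) (F : MvPolynomial (Fin n) ℤ),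
    F.totalDegree ≤ d → (∀ α, |coeff α F| ≤ A * N ^ K) → ∀ (x : Fin n → ℤ) (l : Fin n),
    (∀ i, |x i| ≤ N) → eval x (pderiv l F) ≠ 0 →
    (P.filter fun p : ℕ => (p : ℤ) ∣ eval x (pderiv l F)).card ≤ k := by
  obtain ⟨A', hA'⟩ := eval_bound n d
  refine ⟨A' * A * d + 1, w * (K + d), fun N X hN hX hw P hP F hF hc x l hx h0 => ?_⟩
  refine few_primes P X _ hP _ h0 ?_
  have h1 := hA' (pderiv l F) N (A * N ^ K * d) hN x (pderiv_totalDegree F d hF l)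
    (pderiv_coeff_bound F d (A * N ^ K) hF (by exact_mod_cast hc) l) hx
  refine lt_of_le_of_lt h1 ?_
  have h2 : N ^ (K + d) ≤ X ^ (w * (K + d)) := by
    rw [pow_mul]; exact Nat.pow_le_pow_left hw _
  have h3 : 0 < X ^ (w * (K + d)) := Nat.pow_pos (by omega)
  have : A' * (A * N ^ K * d) * N ^ d < X ^ (w * (K + d) + 1) := by
    calc A' * (A * N ^ K * d) * N ^ d = A' * A * d * N ^ (K + d) := by ring
      _ ≤ A' * A * d * X ^ (w * (K + d)) := Nat.mul_le_mul_left _ h2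
      _ < X * X ^ (w * (K + d)) := Nat.mul_lt_mul_of_pos_right (by omega) h3
      _ = _ := by ring
  exact_mod_cast this

lemma not_dvd_of_natDegree {K : Type*} [Field K] {m : ℕ} (h g : MvPolynomial (Fin (m + 1)) K)
    (hg : g ≠ 0) (hd : (uni 0 g).natDegree < (uni 0 h).natDegree) : ¬ h ∣ g := by
  intro hdvd
  have h1 : uni 0 h ∣ uni 0 g := map_dvd (uni 0) hdvd
  have := Polynomial.natDegree_le_of_dvd h1 (by simpa using hg)
  omega

lemma natDegree_of_monic {K : Type*} [Field K] {m : ℕ} (h : MvPolynomial (Fin (m + 1)) K)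
    (k : ℕ) (c : K) (hc : c ≠ 0) (hk : (uni 0 h).coeff k = C c) :
    k ≤ (uni 0 h).natDegree := by
  refine Polynomial.le_natDegree_of_ne_zero ?_
  rw [hk]; simpa using hc

lemma pderiv0_not_dvd {K : Type*} [Field K] [CharZero K] {m : ℕ} (h : MvPolynomial (Fin (m + 1)) K)
    (k : ℕ) (c : K) (hc : c ≠ 0) (hk : (uni 0 h).coeff k = C c) (h1 : 1 ≤ k) :
    ¬ h ∣ pderiv 0 h := by
  have h2 := natDegree_of_monic h k c hc hk
  have h3 : (uni 0 (pderiv 0 h)).natDegree < (uni 0 h).natDegree := by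
    rw [uni_pderiv]; exact Polynomial.natDegree_derivative_lt (by omega)
  refine not_dvd_of_natDegree h _ ?_ h3
  intro h0
  have : Polynomial.derivative (uni 0 h) = 0 := by rw [← uni_pderiv, h0, map_zero]
  have := Polynomial.derivative_eq_zero.1 this
  omega

lemma irr_deg {K : Type*} [Field K] {n : ℕ} (h : MvPolynomial (Fin n) K) (hh : Irreducible h) :
    1 ≤ h.totalDegree := by
  by_contra! h0
  have : h = C (coeff 0 h) := totalDegree_eq_zero_iff_eq_C.1 (by omega)
  refine hh.not_isUnit ?_
  rw [this]
  refine (IsUnit.mk0 _ fun h1 => hh.ne_zero ?_).map C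
  rw [this, h1, C_0]

lemma degreeOf_map_le' {R S : Type*} [CommRing R] [CommRing S] {n : ℕ} (φ : R →+* S)
    (i : Fin n) (f : MvPolynomial (Fin n) R) : (map φ f).degreeOf i ≤ f.degreeOf i := by
  rw [degreeOf_eq_sup, degreeOf_eq_sup]
  exact Finset.sup_mono (support_map_subset _ _)

lemma shear_irr {K : Type*} [Field K] {m : ℕ} (γ : Fin m → K) (h : MvPolynomial (Fin (m + 1)) K)
    (hh : Irreducible h) : Irreducible (shear γ h) := by
  rw [← shearE_apply]
  exact (MulEquiv.irreducible_iff (shearE γ)).2 hh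


/-- the sheared point -/
def sp (γ : ℤ) (u : Fin 2 → ℤ) : Fin 2 → ℤ := Fin.cons (u 0) fun _ => u 1 - γ * u 0

lemma sp_inj (γ : ℤ) : Function.Injective (sp γ) := by
  intro u v h
  have h0 : u 0 = v 0 := congrFun h 0
  have h1 : u 1 - γ * u 0 = v 1 - γ * v 0 := congrFun h 1
  funext i
  fin_cases i
  · exact h0
  · simp only [h0] at h1
    simpa using h1

lemma sp_eval (γ : ℤ) (u : Fin 2 → ℤ) (h : MvPolynomial (Fin 2) ℚ) :
    eval (fun i => (sp γ u i : ℚ)) (shear (fun _ => (γ : ℚ)) h) = eval (fun i => (u i : ℚ)) h := by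
  rw [shear_eval]
  have : (Fin.cons ((sp γ u 0 : ℤ) : ℚ) (fun j => ((sp γ u (Fin.succ j) : ℤ) : ℚ) + γ * (sp γ u 0 : ℤ))
      : Fin 2 → ℚ) = fun i => (u i : ℚ) := by
    funext i
    fin_cases i <;> simp [sp]
  rw [this]

lemma sp_box (γ : ℤ) (u : Fin 2 → ℤ) (N D : ℕ) (hγ : |γ| ≤ D) (hu : ∀ i, |u i| ≤ N) (i : Fin 2) :
    |sp γ u i| ≤ ((D + 1) * N : ℕ) := by
  have h0 := hu 0
  have h1 := hu 1
  push_cast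
  fin_cases i
  · show |u 0| ≤ _
    nlinarith [abs_nonneg (u 0), abs_nonneg γ]
  · show |u 1 - γ * u 0| ≤ _
    have := abs_sub (u 1) (γ * u 0)
    rw [abs_mul] at this
    nlinarith [abs_nonneg (u 0), abs_nonneg γ, mul_le_mul hγ h0 (abs_nonneg _) (by positivity)]

end Sal


namespace Sal

lemma exists_shear : ∃ γ : MvPolynomial (Fin 2) ℚ → ℤ, ∀ h, h ≠ 0 → |γ h| ≤ h.totalDegree ∧
    ∃ c : ℚ, c ≠ 0 ∧ (uni 0 (shear (fun _ => (γ h : ℚ)) h)).coeff h.totalDegree = C c := by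
  have : ∀ h : MvPolynomial (Fin 2) ℚ, ∃ γ : ℤ, h ≠ 0 → |γ| ≤ h.totalDegree ∧
    ∃ c : ℚ, c ≠ 0 ∧ (uni 0 (shear (fun _ => (γ : ℚ)) h)).coeff h.totalDegree = C c := by
    intro h
    by_cases hh : h = 0
    · exact ⟨0, fun h0 => absurd hh h0⟩
    · obtain ⟨γ, h1, h2⟩ := shear_monic h hh
      refine ⟨γ 0, fun _ => ⟨h1 0, ?_⟩⟩
      have : (fun j => (γ j : ℚ)) = fun _ => (γ 0 : ℚ) := by
        funext j; rw [Subsingleton.elim j 0]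
      rwa [this] at h2
  choose γ hγ using this
  exact ⟨γ, hγ⟩

lemma curve_final (D w : ℕ) (δ : ℝ) (hδ : 0 < δ) : ∃ (M0 k A0 : ℕ)
    (e : MvPolynomial (Fin 2) ℚ → MvPolynomial (Fin 2) ℚ),
    (∀ h, Irreducible h → (e h).totalDegree ≤ h.totalDegree ∧ ¬ h ∣ e h) ∧
    ∀ M ≥ M0, ∀ N X : ℕ, 1 ≤ N → A0 ≤ N → A0 ≤ X → N ≤ X ^ w →
    ∀ (P : Finset ℕ) (_ : ∀ p ∈ P, p.Prime ∧ X < p) (h : MvPolynomial (Fin 2) ℚ), Irreducible h →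
    2 ≤ h.totalDegree → h.totalDegree ≤ D → ∀ Z : Finset (Fin 2 → ℤ),
    (∀ u ∈ Z, (∀ i, |u i| ≤ N) ∧ eval (fun i => (u i : ℚ)) h = 0) → M < Z.card →
    ∀ u ∈ Z, eval (fun i => (u i : ℚ)) (e h) ≠ 0 →
    ∃ bad ⊆ P, bad.card ≤ k ∧ ∀ T ⊆ P \ bad, ((A0 * N : ℕ) : ℝ) ^ (1 / 2 + δ) ≤ ((∏ p ∈ T, p : ℕ) : ℝ) →
    ∀ Z' : Finset (Fin 2 → ℤ), (∀ u' ∈ Z', (∀ i, |u' i| ≤ N) ∧ eval (fun i => (u' i : ℚ)) h = 0 ∧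
      ∀ p ∈ T, ∀ i, (p : ℤ) ∣ u' i - u i) → Z'.card ≤ M := by
  classical
  obtain ⟨γ, hγ⟩ := exists_shear
  have hh := height_red 2
  choose A K hAK using hh
  obtain ⟨Dc, N0, hcd⟩ := curve_det δ hδ
  obtain ⟨A', hA'⟩ : ∃ A', A' = ∑ k ∈ Finset.range (D + 1), A k := ⟨_, rfl⟩
  obtain ⟨K', hK'⟩ : ∃ K', K' = ∑ k ∈ Finset.range (D + 1), K k := ⟨_, rfl⟩
  obtain ⟨A1, k, hk⟩ := grad_primes 2 D (w + 1) A' K'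
  obtain ⟨E, hE⟩ : ∃ E, E = D + Dc := ⟨_, rfl⟩
  refine ⟨(2 * E * E + E) * (2 * E * E + E), k, A1 + N0 + D + 1,
    fun h => shear (fun _ => -(γ h : ℚ)) (pderiv 0 (shear (fun _ => (γ h : ℚ)) h)), ?_, ?_⟩
  · intro h hh
    obtain ⟨h1, c, hc, h2⟩ := hγ h hh.ne_zero
    refine ⟨?_, ?_⟩
    · rw [shear_deg]
      exact pderiv_totalDegree _ _ (shear_deg _ _).le _
    · intro hd
      refine pderiv0_not_dvd _ _ c hc h2 (irr_deg h hh) ?_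
      have h3 := map_dvd (shearE (fun _ => (γ h : ℚ))) hd
      rw [shearE_apply, shearE_apply] at h3
      have h4 := shear_shear (fun _ => -(γ h : ℚ)) (pderiv 0 (shear (fun _ : Fin 1 => (γ h : ℚ)) h))
      simp only [neg_neg] at h4
      rwa [h4] at h3
  · intro M hM N X hN hAN hAX hNX P hP h hirr h2 hD Z hZ hMZ u hu heu
    obtain ⟨h1, c, hc, hmon⟩ := hγ h hirr.ne_zero
    beta_reduce at heu
    generalize γ h = g at *
    have hgD : |g| ≤ (D : ℤ) := h1.trans (by exact_mod_cast hD)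
    obtain ⟨h', hh'⟩ : ∃ h', h' = shear (fun _ : Fin 1 => (g : ℚ)) h := ⟨_, rfl⟩
    have hirr' : Irreducible h' := hh' ▸ shear_irr _ _ hirr
    have hdeg' : h'.totalDegree = h.totalDegree := hh' ▸ shear_deg _ _
    have hev : ∀ v, eval (fun i => (sp g v i : ℚ)) h' = eval (fun i => (v i : ℚ)) h :=
      fun v => hh' ▸ sp_eval g v h
    obtain ⟨H, c1, hc1, hH⟩ := clear_den h'
    have hc1' : (c1 : ℚ) ≠ 0 := by exact_mod_cast hc1
    have hH0 : H ≠ 0 := by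
      rintro rfl
      rw [map_zero] at hH
      exact mul_ne_zero (by simpa using hc1) hirr'.ne_zero hH.symm
    have hinj : Function.Injective (Int.castRingHom ℚ) := Int.cast_injective
    have hHd : H.totalDegree ≤ h.totalDegree := by
      rw [← totalDegree_map_inj _ hinj, hH, ← hdeg']
      refine (totalDegree_mul _ _).trans ?_
      rw [totalDegree_C, zero_add]
    have hN' : 1 ≤ (D + 1) * N := Nat.mul_pos (by omega) hN
    obtain ⟨t, ht0, htd, htZ, htc⟩ := hAK h.totalDegree H ((D + 1) * N) hN' (sp g '' (Z : Set (Fin 2 → ℤ)))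
      hH0 hHd (by
        rintro _ ⟨v, hv, rfl⟩
        refine ⟨sp_box g v N D hgD (hZ v hv).1, ?_⟩
        rw [← eval_cast_zero (K := ℚ), hH, map_mul, hev, (hZ v hv).2, mul_zero])
    have htm : map (Int.castRingHom ℚ) t ≠ 0 := by
      intro h0; exact ht0 ((map_eq_zero_iff _ (map_injective _ hinj)).1 h0)
    have htm' : (map (Int.castRingHom ℚ) t).totalDegree ≤ h'.totalDegree := by
      rw [totalDegree_map_inj _ hinj, hdeg']; exact htd
    have hdvd : h' ∣ map (Int.castRingHom ℚ) t := by
      by_contra hnd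
      have := bezoutZ h' _ hirr' hnd D (by omega) (by omega) (Z.image (sp g)) (by
        intro y hy
        obtain ⟨v, hv, rfl⟩ := Finset.mem_image.1 hy
        exact ⟨by rw [hev]; exact (hZ v hv).2, (eval_cast_zero _ _).2 (htZ _ ⟨v, hv, rfl⟩)⟩)
      rw [Finset.card_image_of_injective _ (sp_inj g)] at this
      have h3 : (2 * D * D + D) * (2 * D * D + D) ≤ (2 * E * E + E) * (2 * E * E + E) := by
        have : D ≤ E := by omega
        gcongr
      omega
    obtain ⟨c2, hc2, hteq⟩ := const_quot h' _ htm htm' hdvd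
    have hne : eval (sp g u) (pderiv 0 t) ≠ 0 := by
      rw [Ne, ← eval_cast_zero (K := ℚ), ← pderiv_map, hteq, pderiv_C_mul, map_mul, eval_C]
      refine mul_ne_zero hc2 ?_
      intro h0
      refine heu ?_
      have h5 := sp_eval g u (shear (fun _ => -(g : ℚ)) (pderiv 0 h'))
      have h4 := shear_shear (fun _ => -(g : ℚ)) (pderiv 0 h')
      simp only [neg_neg] at h4
      rw [h4, h0] at h5
      rw [← hh']
      exact h5.symm
    have hbig : ∀ k ≤ D, A k * ((D + 1) * N) ^ K k ≤ A' * ((D + 1) * N) ^ K' := by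
      intro k hk
      have hk' : k ∈ Finset.range (D + 1) := Finset.mem_range.2 (by omega)
      refine Nat.mul_le_mul ?_ (Nat.pow_le_pow_right hN' ?_)
      · rw [hA']; exact Finset.single_le_sum (f := A) (fun _ _ => Nat.zero_le _) hk'
      · rw [hK']; exact Finset.single_le_sum (f := K) (fun _ _ => Nat.zero_le _) hk'
    refine ⟨P.filter fun p : ℕ => (p : ℤ) ∣ eval (sp g u) (pderiv 0 t), Finset.filter_subset _ _,
      hk ((D + 1) * N) X hN' (by omega) ?_ P hP t (htd.trans hD) ?_ _ 0
        (sp_box g u N D hgD (hZ u hu).1) hne, ?_⟩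
    · rw [pow_succ, mul_comm]; exact Nat.mul_le_mul hNX (by omega)
    · intro α
      refine (htc α).trans ?_
      exact_mod_cast hbig _ hD
    · intro T hT hprod Z' hZ'
      obtain ⟨G, hG0, hG1, hG2, hG3⟩ := hcd ((D + 1) * N) (by nlinarith) T t (sp g u)
        (sp g '' (Z' : Set (Fin 2 → ℤ)))
        (fun p hp => (hP p (Finset.mem_sdiff.1 (hT hp)).1).1)
        (fun p hp => ⟨0, fun hd => (Finset.mem_sdiff.1 (hT hp)).2
          (Finset.mem_filter.2 ⟨(Finset.mem_sdiff.1 (hT hp)).1, hd⟩)⟩)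
        (by
          refine le_trans ?_ hprod
          refine Real.rpow_le_rpow (by positivity) ?_ (by positivity)
          exact_mod_cast Nat.mul_le_mul_right N (by omega))
        (by
          rintro _ ⟨v, hv, rfl⟩
          obtain ⟨a, b, c'⟩ := hZ' v hv
          refine ⟨sp_box g v N D hgD a, ?_, ?_⟩
          · rw [← eval_cast_zero (K := ℚ), hteq, map_mul, hev, b, mul_zero]
          · intro p hp i
            have h0 := c' p hp 0
            have h1 := c' p hp 1
            fin_cases i
            · exact h0
            · show (p : ℤ) ∣ (v 1 - g * v 0) - (u 1 - g * u 0)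
              have : (v 1 - g * v 0) - (u 1 - g * u 0) = (v 1 - u 1) - g * (v 0 - u 0) := by ring
              rw [this]
              exact dvd_sub h1 (Dvd.dvd.mul_left h0 _))
      have hGm : map (Int.castRingHom ℚ) G ≠ 0 := by
        intro h0; exact hG0 ((map_eq_zero_iff _ (map_injective _ hinj)).1 h0)
      have hnd : ¬ h' ∣ map (Int.castRingHom ℚ) G := by
        refine not_dvd_of_natDegree _ _ hGm ?_
        have h3 := natDegree_of_monic h' _ c hc (hh' ▸ hmon)
        have h4 : (uni 0 (map (Int.castRingHom ℚ) G)).natDegree ≤ G.degreeOf 0 := by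
          rw [uni_natDegree]; exact degreeOf_map_le' _ _ _
        omega
      have := bezoutZ h' _ hirr' hnd E (by omega)
        (by rw [totalDegree_map_inj _ hinj]; omega) (Z'.image (sp g)) (by
        intro y hy
        obtain ⟨v, hv, rfl⟩ := Finset.mem_image.1 hy
        exact ⟨by rw [hev]; exact (hZ' v hv).2.1, (eval_cast_zero _ _).2 (hG3 _ ⟨v, hv, rfl⟩)⟩)
      rw [Finset.card_image_of_injective _ (sp_inj g)] at this
      omega

end Sal


namespace Sal

lemma facs {K : Type*} [Field K] {n : ℕ} (P : MvPolynomial (Fin n) K) (hP : P ≠ 0) :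
    ∃ I : Finset (MvPolynomial (Fin n) K), I.card ≤ P.totalDegree ∧
      (∀ h ∈ I, Irreducible h ∧ h ∣ P ∧ h.totalDegree ≤ P.totalDegree) ∧
      (∀ h, Irreducible h → h ∣ P → ∃ h' ∈ I, Associated h h') ∧
      ∀ u, eval u P = 0 → ∃ h ∈ I, eval u h = 0 := by
  classical
  have hm : ∀ s : Multiset (MvPolynomial (Fin n) K), (∀ h ∈ s, Irreducible h) →
      s.prod ≠ 0 ∧ s.card ≤ s.prod.totalDegree := by
    intro s
    induction s using Multiset.induction with
    | empty => simp
    | cons a s ih =>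
      intro h
      obtain ⟨h1, h2⟩ := ih fun b hb => h b (Multiset.mem_cons_of_mem hb)
      have ha := h a (Multiset.mem_cons_self a s)
      rw [Multiset.prod_cons, Multiset.card_cons, totalDegree_mul_of_isDomain ha.ne_zero h1]
      have := irr_deg a ha
      exact ⟨mul_ne_zero ha.ne_zero h1, by omega⟩
  have hirr : ∀ h ∈ UniqueFactorizationMonoid.factors P, Irreducible h :=
    fun h hh => UniqueFactorizationMonoid.irreducible_of_factor h hh
  have hpr := UniqueFactorizationMonoid.factors_prod hP
  have hle : ∀ h, h ∣ P → h.totalDegree ≤ P.totalDegree := by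
    rintro h ⟨q, rfl⟩
    rw [totalDegree_mul_of_isDomain (left_ne_zero_of_mul hP) (right_ne_zero_of_mul hP)]
    omega
  refine ⟨(UniqueFactorizationMonoid.factors P).toFinset, ?_, ?_, ?_, ?_⟩
  · refine (Multiset.toFinset_card_le _).trans ((hm _ hirr).2.trans (hle _ hpr.dvd))
  · intro h hh
    rw [Multiset.mem_toFinset] at hh
    have := UniqueFactorizationMonoid.dvd_of_mem_factors hh
    exact ⟨hirr h hh, this, hle _ this⟩
  · intro h hh hd
    obtain ⟨q, hq, ha⟩ := UniqueFactorizationMonoid.exists_mem_factors_of_dvd hP hh hd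
    exact ⟨q, Multiset.mem_toFinset.2 hq, ha⟩
  · intro u hu
    obtain ⟨c, hc⟩ := hpr
    have h1 : eval u (UniqueFactorizationMonoid.factors P).prod = 0 := by
      have h2 : eval u (UniqueFactorizationMonoid.factors P).prod * eval u (c : MvPolynomial (Fin n) K) = 0 := by
        rw [← map_mul, hc, hu]
      refine (mul_eq_zero.1 h2).resolve_right ?_
      exact (c.isUnit.map (eval u)).ne_zero
    rw [map_multiset_prod, Multiset.prod_eq_zero_iff, Multiset.mem_map] at h1
    obtain ⟨h, hh, h0⟩ := h1
    exact ⟨h, Multiset.mem_toFinset.2 hh, h0⟩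

lemma lin_poly {K : Type*} [Field K] {n : ℕ} (h : MvPolynomial (Fin n) K) (hd : h.totalDegree ≤ 1) :
    h = C (coeff 0 h) + ∑ i, C (coeff (Finsupp.single i 1) h) * X i := by
  classical
  ext α
  rw [coeff_add, coeff_C, coeff_sum]
  simp only [coeff_C_mul, coeff_X]
  by_cases h0 : (0 : Fin n →₀ ℕ) = α
  · subst h0; simp
  rw [if_neg h0, zero_add]
  by_cases h1 : ∃ i, Finsupp.single i 1 = α
  · obtain ⟨i, rfl⟩ := h1
    simp [Finsupp.single_left_inj]
  · have : coeff α h = 0 := by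
      refine coeff_eq_zero_of_totalDegree_lt (lt_of_le_of_lt hd ?_)
      by_contra! h2
      rcases Nat.lt_or_ge (∑ i ∈ α.support, α i) 1 with h3 | h3
      · refine h0 (Finsupp.ext fun i => ?_)
        by_contra! h4
        have h5 : i ∈ α.support := Finsupp.mem_support_iff.2 (by simpa using h4.symm)
        have := Finset.single_le_sum (f := fun i => α i) (fun _ _ => Nat.zero_le _) h5
        simp at h4; omega
      · have h4 : α.sum (fun _ => id) = 1 := le_antisymm h2 h3
        exact h1 (((Finsupp.sum_eq_one_iff α).1 h4).imp fun i hi => hi.symm)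
    rw [this]
    refine (Finset.sum_eq_zero fun i _ => ?_).symm
    rw [if_neg fun h3 => h1 ⟨i, h3⟩, mul_zero]

lemma lin_eval {K : Type*} [Field K] {n : ℕ} (h : MvPolynomial (Fin n) K) (hd : h.totalDegree ≤ 1)
    (x : Fin n → K) : eval x h = coeff 0 h + ∑ i, coeff (Finsupp.single i 1) h * x i := by
  conv_lhs => rw [lin_poly h hd]
  simp

/-- `h` contains many points of `Z` -/
def rich (D M : ℕ) (Z : Finset (Fin 2 → ℤ)) (h : MvPolynomial (Fin 2) ℚ) : Prop :=
  Irreducible h ∧ h.totalDegree ≤ D ∧ M < (Z.filter fun u => eval (fun i => (u i : ℚ)) h = 0).card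

/-- `u` lies on a unique rich curve -/
def NE (D M : ℕ) (e : MvPolynomial (Fin 2) ℚ → MvPolynomial (Fin 2) ℚ) (Z : Finset (Fin 2 → ℤ))
    (u : Fin 2 → ℤ) : Prop :=
  ∃ h, rich D M Z h ∧ eval (fun i => (u i : ℚ)) h = 0 ∧ eval (fun i => (u i : ℚ)) (e h) ≠ 0 ∧
    ∀ h', rich D M Z h' → eval (fun i => (u i : ℚ)) h' = 0 → Associated h h'

lemma rich_dvd (D M : ℕ) (hM : (2 * D * D + D) * (2 * D * D + D) ≤ M) (Z : Finset (Fin 2 → ℤ))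
    (P : MvPolynomial (Fin 2) ℚ) (hPD : P.totalDegree ≤ D)
    (hPZ : ∀ u ∈ Z, eval (fun i => (u i : ℚ)) P = 0) (h) (hr : rich D M Z h) : h ∣ P := by
  obtain ⟨h1, h2, h3⟩ := hr
  by_contra hn
  have := bezoutZ h P h1 hn D h2 hPD (Z.filter fun u => eval (fun i => (u i : ℚ)) h = 0)
    (fun y hy => ⟨(Finset.mem_filter.1 hy).2, hPZ y (Finset.mem_filter.1 hy).1⟩)
  omega

open Classical in
lemma exc (D M : ℕ) (e : MvPolynomial (Fin 2) ℚ → MvPolynomial (Fin 2) ℚ)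
    (hM : (2 * D * D + D) * (2 * D * D + D) ≤ M)
    (he : ∀ h, Irreducible h → (e h).totalDegree ≤ h.totalDegree ∧ ¬ h ∣ e h)
    (Z : Finset (Fin 2 → ℤ)) (P : MvPolynomial (Fin 2) ℚ) (hP : P ≠ 0) (hPD : P.totalDegree ≤ D)
    (hPZ : ∀ u ∈ Z, eval (fun i => (u i : ℚ)) P = 0) :
    (Z.filter fun u => ¬ NE D M e Z u).card ≤ D * M + D * M + D * D * M := by
  obtain ⟨I, hI1, hI2, hI3, hI4⟩ := facs P hP
  have hID : I.card ≤ D := hI1.trans hPD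
  have hsub : (Z.filter fun u => ¬ NE D M e Z u) ⊆
      (I.biUnion fun h => if rich D M Z h then ∅ else
        Z.filter fun u => eval (fun i => (u i : ℚ)) h = 0) ∪
      (I.biUnion fun h => Z.filter fun u => eval (fun i => (u i : ℚ)) h = 0 ∧
        eval (fun i => (u i : ℚ)) (e h) = 0) ∪
      ((I ×ˢ I).biUnion fun h => if Associated h.1 h.2 then ∅ else
        Z.filter fun u => eval (fun i => (u i : ℚ)) h.1 = 0 ∧ eval (fun i => (u i : ℚ)) h.2 = 0) := by
    intro u hu
    rw [Finset.mem_filter] at hu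
    obtain ⟨huZ, hu⟩ := hu
    by_contra hc
    simp only [Finset.mem_union, not_or, Finset.mem_biUnion, not_exists, not_and] at hc
    obtain ⟨⟨c1, c2⟩, c3⟩ := hc
    obtain ⟨h, hh, h0⟩ := hI4 _ (hPZ u huZ)
    have hr : rich D M Z h := by
      by_contra hr
      refine c1 h hh ?_
      rw [if_neg hr]
      exact Finset.mem_filter.2 ⟨huZ, h0⟩
    refine hu ⟨h, hr, h0, fun h1 => c2 h hh (Finset.mem_filter.2 ⟨huZ, h0, h1⟩), ?_⟩
    intro h' hr' h0'
    obtain ⟨h'', hh'', ha⟩ := hI3 h' hr'.1 (rich_dvd D M hM Z P hPD hPZ h' hr')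
    refine Associated.trans ?_ ha.symm
    by_contra hna
    refine c3 (h, h'') (Finset.mem_product.2 ⟨hh, hh''⟩) ?_
    rw [if_neg hna]
    refine Finset.mem_filter.2 ⟨huZ, h0, ?_⟩
    obtain ⟨q, hq⟩ := ha.dvd
    show eval _ h'' = 0
    rw [hq, map_mul, h0', zero_mul]
  refine (Finset.card_le_card hsub).trans ((Finset.card_union_le _ _).trans
    (Nat.add_le_add ((Finset.card_union_le _ _).trans (Nat.add_le_add ?_ ?_)) ?_))
  · refine (Finset.card_biUnion_le_card_mul _ _ M ?_).trans (Nat.mul_le_mul_right _ hID)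
    intro h hh
    split_ifs with hr
    · simp
    · by_contra! hc
      exact hr ⟨(hI2 h hh).1, (hI2 h hh).2.2.trans hPD, hc⟩
  · refine (Finset.card_biUnion_le_card_mul _ _ M ?_).trans (Nat.mul_le_mul_right _ hID)
    intro h hh
    obtain ⟨a, b⟩ := he h (hI2 h hh).1
    refine (bezoutZ h (e h) (hI2 h hh).1 b D ((hI2 h hh).2.2.trans hPD)
      (a.trans ((hI2 h hh).2.2.trans hPD)) _ fun y hy => (Finset.mem_filter.1 hy).2).trans hM
  · refine (Finset.card_biUnion_le_card_mul _ _ M ?_).trans (Nat.mul_le_mul_right _ ?_)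
    · rintro ⟨h, h'⟩ hh
      rw [Finset.mem_product] at hh
      split_ifs with hr
      · simp
      · have hi := hI2 h hh.1
        have hi' := hI2 h' hh.2
        refine (bezoutZ h h' hi.1 (fun hd => hr (hi.1.associated_of_dvd hi'.1 hd)) D
          (hi.2.2.trans hPD) (hi'.2.2.trans hPD) _ fun y hy => (Finset.mem_filter.1 hy).2).trans hM
    · rw [Finset.card_product]; exact Nat.mul_le_mul hID hID

end Sal


namespace Sal

/-- projection -/
def pr (a : Fin 3) (x : Fin 3 → ℤ) : Fin 2 → ℤ := fun j => x (a.succAbove j)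

lemma lin_cross (h : MvPolynomial (Fin 2) ℚ) (hi : Irreducible h) (hd : h.totalDegree ≤ 1)
    (x y z : Fin 2 → ℤ) (hx : eval (fun i => (x i : ℚ)) h = 0) (hy : eval (fun i => (y i : ℚ)) h = 0)
    (hz : eval (fun i => (z i : ℚ)) h = 0) :
    (y 0 - x 0) * (z 1 - x 1) = (y 1 - x 1) * (z 0 - x 0) := by
  rw [lin_eval h hd, Fin.sum_univ_two] at hx hy hz
  have hne : coeff (Finsupp.single 0 1) h ≠ 0 ∨ coeff (Finsupp.single 1 1) h ≠ 0 := by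
    by_contra! hc
    have h1 := irr_deg h hi
    have h2 := lin_poly h hd
    rw [Fin.sum_univ_two, hc.1, hc.2] at h2
    rw [h2] at h1
    simp at h1
  generalize coeff 0 h = c at *
  generalize coeff (Finsupp.single 0 1) h = p at *
  generalize coeff (Finsupp.single 1 1) h = q at *
  have h1 : p * (y 0 - x 0) + q * (y 1 - x 1) = 0 := by linear_combination hy - hx
  have h2 : p * (z 0 - x 0) + q * (z 1 - x 1) = 0 := by linear_combination hz - hx
  have : ((y 0 - x 0) * (z 1 - x 1) : ℚ) = (y 1 - x 1) * (z 0 - x 0) := by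
    rcases hne with h0 | h0
    · apply mul_left_cancel₀ h0
      linear_combination (z 1 - x 1 : ℚ) * h1 - (y 1 - x 1 : ℚ) * h2
    · apply mul_left_cancel₀ h0
      linear_combination (y 0 - x 0 : ℚ) * h2 - (z 0 - x 0 : ℚ) * h1
  exact_mod_cast this

/-- integer points of `F = 0` in the box on no line inside of small direction -/
def star (N : ℕ) (F : MvPolynomial (Fin 3) ℤ) (x : Fin 3 → ℤ) : Prop :=
  eval x F = 0 ∧ (¬ ∃ v : Fin 3 → ℤ, v ≠ 0 ∧ (∀ i, |v i| ≤ 2 * N) ∧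
    ∀ t : ℤ, eval (fun i => x i + t * v i) F = 0) ∧ ∀ i, |x i| ≤ N

lemma collinear_card {N : ℕ} (F : MvPolynomial (Fin 3) ℤ) (d : ℕ) (hd : F.totalDegree ≤ d)
    (S : Finset (Fin 3 → ℤ)) (hd1 : 1 ≤ d) (hS : ∀ x ∈ S, star N F x)
    (h : ∀ x ∈ S, ∀ y ∈ S, ∀ z ∈ S, ∀ i j, (y i - x i) * (z j - x j) = (y j - x j) * (z i - x i)) :
    S.card ≤ d := by
  by_contra! hc
  obtain ⟨x, hx, y, hy, hxy⟩ := Finset.one_lt_card.1 (show 1 < S.card by omega)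
  obtain ⟨i, hi⟩ : ∃ i, y i ≠ x i := by
    by_contra! h0; exact hxy (funext fun i => (h0 i).symm)
  have hi' : (y i - x i : ℚ) ≠ 0 := by
    rw [sub_ne_zero]; exact_mod_cast hi
  refine (hS x hx).2.1 ⟨fun i => y i - x i, fun h0 => hi (by have := congrFun h0 i; simp at this; omega), ?_, ?_⟩
  · intro j
    have e1 := abs_le.1 ((hS x hx).2.2 j)
    have e2 := abs_le.1 ((hS y hy).2.2 j)
    exact abs_le.2 ⟨by linarith, by linarith⟩
  refine line_zero F d hd x (fun i => y i - x i) S (fun z hz => ⟨(hS z hz).1,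
    (z i - x i) / (y i - x i), fun j => ?_⟩) hc
  have h1 : ((y i - x i) * (z j - x j) : ℚ) = (y j - x j) * (z i - x i) := by
    exact_mod_cast h x hx y hy z hz i j
  push_cast
  field_simp
  linear_combination h1

lemma cross3 (x y z : Fin 3 → ℤ)
    (h : ∀ a, (pr a y 0 - pr a x 0) * (pr a z 1 - pr a x 1) = (pr a y 1 - pr a x 1) * (pr a z 0 - pr a x 0))
    (i j : Fin 3) : (y i - x i) * (z j - x j) = (y j - x j) * (z i - x i) := by
  have h0 : (y 1 - x 1) * (z 2 - x 2) = (y 2 - x 2) * (z 1 - x 1) := h 0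
  have h1 : (y 0 - x 0) * (z 2 - x 2) = (y 2 - x 2) * (z 0 - x 0) := h 1
  have h2 : (y 0 - x 0) * (z 1 - x 1) = (y 1 - x 1) * (z 0 - x 0) := h 2
  fin_cases i <;> fin_cases j <;> simp only [Fin.zero_eta, Fin.mk_one, Fin.reduceFinMk] <;> linarith

lemma fibre_d {N : ℕ} (F : MvPolynomial (Fin 3) ℤ) (d : ℕ) (hd : F.totalDegree ≤ d)
    (S : Finset (Fin 3 → ℤ)) (hd1 : 1 ≤ d) (hS : ∀ x ∈ S, star N F x) (a : Fin 3) (u : Fin 2 → ℤ)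
    (h : ∀ x ∈ S, pr a x = u) : S.card ≤ d := by
  refine collinear_card F d hd S hd1 hS fun x hx y hy z hz => ?_
  have h1 : ∀ i, i ≠ a → y i = x i ∧ z i = x i := by
    intro i hi
    obtain ⟨j, rfl⟩ := Fin.exists_succAbove_eq hi
    have e1 := congrFun (h x hx) j
    have e2 := congrFun (h y hy) j
    have e3 := congrFun (h z hz) j
    simp only [pr] at e1 e2 e3
    exact ⟨by rw [e1, e2], by rw [e1, e3]⟩
  intro i j
  by_cases hi : i = a
  · by_cases hj : j = a
    · rw [hi, hj]
    · rw [(h1 j hj).1, (h1 j hj).2]; ring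
  · rw [(h1 i hi).1, (h1 i hi).2]; ring

open Classical in
lemma lin3 {N : ℕ} (F : MvPolynomial (Fin 3) ℤ) (d D : ℕ) (hd : F.totalDegree ≤ d)
    (S : Finset (Fin 3 → ℤ)) (hd1 : 1 ≤ d) (I : Fin 3 → Finset (MvPolynomial (Fin 2) ℚ))
    (hI : ∀ a, (I a).card ≤ D) (hS : ∀ x ∈ S, star N F x ∧ ∀ a, ∃ h ∈ I a, Irreducible h ∧
      h.totalDegree ≤ 1 ∧ eval (fun i => (pr a x i : ℚ)) h = 0) : S.card ≤ d * D ^ 3 := by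
  have : ∀ x, ∃ h : Fin 3 → MvPolynomial (Fin 2) ℚ, x ∈ S → ∀ a, h a ∈ I a ∧ Irreducible (h a) ∧
      (h a).totalDegree ≤ 1 ∧ eval (fun i => (pr a x i : ℚ)) (h a) = 0 := by
    intro x
    by_cases hx : x ∈ S
    · choose h hh using (hS x hx).2
      exact ⟨h, fun _ => hh⟩
    · exact ⟨0, fun h => absurd h hx⟩
  choose H hH using this
  have h1 := Finset.card_le_mul_card_image_of_maps_to (s := S) (f := H) (t := Fintype.piFinset I)
    (fun x hx => Fintype.mem_piFinset.2 fun a => (hH x hx a).1) d (by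
      intro h _
      refine collinear_card F d hd _ hd1 (fun x hx => (hS x (Finset.mem_filter.1 hx).1).1) ?_
      intro x hx y hy z hz
      rw [Finset.mem_filter] at hx hy hz
      refine cross3 x y z fun a => ?_
      have e1 := hH x hx.1 a
      have e2 := hH y hy.1 a
      have e3 := hH z hz.1 a
      rw [hx.2] at e1
      rw [hy.2] at e2
      rw [hz.2] at e3
      exact lin_cross (h a) e1.2.1 e1.2.2.1 _ _ _ e1.2.2.2 e2.2.2.2 e3.2.2.2)
  refine h1.trans (Nat.mul_le_mul_left _ ?_)
  rw [Fintype.card_piFinset]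
  refine (Finset.prod_le_prod' fun a _ => hI a).trans ?_
  simp

open Classical in
/-- `x` is not exceptional in `S` -/
def NEx (D M : ℕ) (e : MvPolynomial (Fin 2) ℚ → MvPolynomial (Fin 2) ℚ) (S : Finset (Fin 3 → ℤ))
    (x : Fin 3 → ℤ) : Prop :=
  (∀ a, NE D M e (S.image (pr a)) (pr a x)) ∧ ∃ a h, rich D M (S.image (pr a)) h ∧
    eval (fun i => (pr a x i : ℚ)) h = 0 ∧ 2 ≤ h.totalDegree

open Classical in
lemma class_bad {N : ℕ} (F : MvPolynomial (Fin 3) ℤ) (d : ℕ) (hd : F.totalDegree ≤ d) (hd1 : 1 ≤ d)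
    (D M : ℕ) (e : MvPolynomial (Fin 2) ℚ → MvPolynomial (Fin 2) ℚ)
    (hM : (2 * D * D + D) * (2 * D * D + D) ≤ M)
    (he : ∀ h, Irreducible h → (e h).totalDegree ≤ h.totalDegree ∧ ¬ h ∣ e h)
    (S : Finset (Fin 3 → ℤ)) (hS : ∀ x ∈ S, star N F x) (P : Fin 3 → MvPolynomial (Fin 2) ℚ)
    (hP : ∀ a, P a ≠ 0) (hPD : ∀ a, (P a).totalDegree ≤ D)
    (hPZ : ∀ a, ∀ x ∈ S, eval (fun i => (pr a x i : ℚ)) (P a) = 0) :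
    (S.filter fun x => ¬ NEx D M e S x).card ≤ 3 * (d * (D * M + D * M + D * D * M)) + d * D ^ 3 := by
  have hPZ' : ∀ a, ∀ u ∈ S.image (pr a), eval (fun i => (u i : ℚ)) (P a) = 0 := by
    intro a u hu
    obtain ⟨x, hx, rfl⟩ := Finset.mem_image.1 hu
    exact hPZ a x hx
  choose I hI1 hI2 hI3 hI4 using fun a => facs (P a) (hP a)
  have hsub : (S.filter fun x => ¬ NEx D M e S x) ⊆
      (Finset.univ.biUnion fun a => S.filter fun x => ¬ NE D M e (S.image (pr a)) (pr a x)) ∪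
      S.filter fun x => ∀ a, ∃ h ∈ I a, Irreducible h ∧
      h.totalDegree ≤ 1 ∧ eval (fun i => (pr a x i : ℚ)) h = 0 := by
    intro x hx
    rw [Finset.mem_filter] at hx
    obtain ⟨hxS, hx⟩ := hx
    by_contra hc
    simp only [Finset.mem_union, not_or, Finset.mem_biUnion, not_exists, not_and, Finset.mem_filter,
      Finset.mem_univ, true_and, not_not] at hc
    obtain ⟨c1, c2⟩ := hc
    refine hx ⟨fun a => c1 a hxS, ?_⟩
    by_contra! h3
    refine c2 hxS fun a => ?_
    obtain ⟨h, hr, h0, -⟩ := c1 a hxS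
    obtain ⟨h', hh', ha⟩ := hI3 a h hr.1 (rich_dvd D M hM _ (P a) (hPD a) (hPZ' a) h hr)
    obtain ⟨q, hq⟩ := ha.dvd
    obtain ⟨q', hq'⟩ := ha.symm.dvd
    refine ⟨h', hh', (hI2 a h' hh').1, ?_, by rw [hq, map_mul, h0, zero_mul]⟩
    have h4 := h3 a h hr h0
    have h5 : h'.totalDegree ≤ h.totalDegree :=
      totalDegree_le_of_dvd_of_isDomain ⟨q', hq'⟩ hr.1.ne_zero
    omega
  refine (Finset.card_le_card hsub).trans ((Finset.card_union_le _ _).trans (Nat.add_le_add ?_ ?_))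
  · refine (Finset.card_biUnion_le_card_mul _ _ (d * (D * M + D * M + D * D * M)) ?_).trans (by simp)
    intro a _
    refine (Finset.card_le_mul_card_image_of_maps_to (f := pr a)
      (t := (S.image (pr a)).filter fun u => ¬ NE D M e (S.image (pr a)) u) ?_ d ?_).trans
      (Nat.mul_le_mul_left _ (exc D M e hM he _ (P a) (hP a) (hPD a) (hPZ' a)))
    · intro x hx
      rw [Finset.mem_filter] at hx
      exact Finset.mem_filter.2 ⟨Finset.mem_image_of_mem _ hx.1, hx.2⟩
    · intro u _
      refine fibre_d (N := N) F d hd _ hd1 (fun x hx => ?_) a u fun x hx => (Finset.mem_filter.1 hx).2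
      exact hS x (Finset.mem_filter.1 (Finset.mem_filter.1 hx).1).1
  · refine lin3 (N := N) F d D hd _ hd1 I (fun a => (hI1 a).trans (hPD a)) fun x hx => ?_
    rw [Finset.mem_filter] at hx
    exact ⟨hS x hx.1, hx.2⟩

end Sal


namespace Sal

lemma exchange {α : Type*} [Monoid α] (U : Finset ℕ) (t : ℕ) (R : Finset ℕ → α → Prop)
    (mono : ∀ W T h, W ⊆ T → R T h → R W h) (assoc : ∀ T h h', Associated h h' → R T h → R T h')
    (hR : ∀ T ⊆ U, T.card = t ∨ T.card + 1 = t → ∃ h, R T h ∧ ∀ h', R T h' → Associated h h')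
    (T0 : Finset ℕ) (h : α) (hT0 : T0 ⊆ U) (hc0 : T0.card = t) (h0 : R T0 h) :
    ∀ (k : ℕ) (T : Finset ℕ), (T \ T0).card = k → T ⊆ U → T.card = t → R T h := by
  classical
  intro k
  induction k with
  | zero =>
    intro T hk hT hc
    have h1 : T ⊆ T0 := Finset.sdiff_eq_empty_iff_subset.1 (Finset.card_eq_zero.1 hk)
    rwa [Finset.eq_of_subset_of_card_le h1 (by omega)]
  | succ k ih =>
    intro T hk hT hc
    obtain ⟨p, hp⟩ : (T \ T0).Nonempty := Finset.card_pos.1 (by omega)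
    obtain ⟨q, hq⟩ : (T0 \ T).Nonempty := by
      refine Finset.card_pos.1 ?_
      have := Finset.card_sdiff_add_card_inter T T0
      have h2 := Finset.card_sdiff_add_card_inter T0 T
      rw [Finset.inter_comm] at h2
      omega
    rw [Finset.mem_sdiff] at hp hq
    have hW : (T.erase p).card + 1 = t := by
      rw [Finset.card_erase_of_mem hp.1]
      have := Finset.card_pos.2 ⟨p, hp.1⟩
      omega
    have hWU : T.erase p ⊆ U := (Finset.erase_subset _ _).trans hT
    have h1 : R (insert q (T.erase p)) h := by
      refine ih _ ?_ ?_ ?_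
      · have : insert q (T.erase p) \ T0 = (T \ T0).erase p := by
          rw [Finset.insert_sdiff_of_mem _ hq.1, Finset.erase_sdiff_comm]
        rw [this, Finset.card_erase_of_mem (Finset.mem_sdiff.2 hp), hk]; rfl
      · exact Finset.insert_subset (hT0 hq.1) hWU
      · rw [Finset.card_insert_of_notMem fun hh => hq.2 (Finset.mem_of_mem_erase hh)]
        exact hW
    obtain ⟨h', hh', -⟩ := hR T hT (Or.inl hc)
    obtain ⟨h2, -, hu⟩ := hR _ hWU (Or.inr hW)
    have e1 := hu h (mono _ _ _ (Finset.subset_insert _ _) h1)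
    have e2 := hu h' (mono _ _ _ (Finset.erase_subset _ _) hh')
    exact assoc T h' h (e2.symm.trans e1) hh'

lemma rich_mono (D M : ℕ) (Z Z' : Finset (Fin 2 → ℤ)) (hZ : Z ⊆ Z') (h) (hr : rich D M Z h) :
    rich D M Z' h :=
  ⟨hr.1, hr.2.1, hr.2.2.trans_le (Finset.card_le_card (Finset.filter_subset_filter _ hZ))⟩

lemma eval_assoc {K : Type*} [Field K] {n : ℕ} (h h' : MvPolynomial (Fin n) K) (ha : Associated h h') (u)
    (h0 : eval u h = 0) : eval u h' = 0 := by
  obtain ⟨q, hq⟩ := ha.dvd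
  rw [hq, map_mul, h0, zero_mul]

lemma deg_assoc {K : Type*} [Field K] {n : ℕ} (h h' : MvPolynomial (Fin n) K) (ha : Associated h h')
    (h0 : h ≠ 0) : h'.totalDegree = h.totalDegree :=
  le_antisymm (totalDegree_le_of_dvd_of_isDomain ha.symm.dvd h0)
    (totalDegree_le_of_dvd_of_isDomain ha.dvd (by rintro rfl; exact h0 (associated_zero_iff_eq_zero h |>.1 ha)))

lemma rich_assoc (D M : ℕ) (Z : Finset (Fin 2 → ℤ)) (h h') (ha : Associated h h')
    (hr : rich D M Z h) : rich D M Z h' := by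
  refine ⟨ha.irreducible hr.1, (deg_assoc h h' ha hr.1.ne_zero).le.trans hr.2.1, hr.2.2.trans_le (Finset.card_le_card ?_)⟩
  intro u hu
  rw [Finset.mem_filter] at hu ⊢
  exact ⟨hu.1, eval_assoc h h' ha _ hu.2⟩

lemma int_map_ne {n : ℕ} (g : MvPolynomial (Fin n) ℤ) (hg : g ≠ 0) : map (Int.castRingHom ℚ) g ≠ 0 := by
  intro h0
  exact hg ((map_eq_zero_iff _ (map_injective _ (RingHom.injective_int _))).1 h0)

lemma class_polys (δ : ℝ) (hδ : 0 < δ) (d : ℕ) (hd : 4 ≤ d) : ∃ D N0 : ℕ, ∀ N ≥ N0, ∀ (T : Finset ℕ)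
    (F : MvPolynomial (Fin 3) ℤ) (x0 : Fin 3 → ℤ) (S : Finset (Fin 3 → ℤ)), F.totalDegree = d →
    Irreducible (map (Int.castRingHom ℚ) F) →
    (∃ c : ℚ, c ≠ 0 ∧ (uni 0 (map (Int.castRingHom ℚ) F)).coeff d = C c) →
    (∀ p ∈ T, p.Prime) →
    (∀ p ∈ T, ∃ l, ¬ (p : ℤ) ∣ eval x0 (pderiv l F)) →
    (N : ℝ) ^ (1 / 2 + δ) ≤ ((∏ p ∈ T, p : ℕ) : ℝ) → 
    (∀ x ∈ S, (∀ i, |x i| ≤ N) ∧ eval x F = 0 ∧ ∀ p ∈ T, ∀ i, (p : ℤ) ∣ x i - x0 i) →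
    ∃ P : Fin 3 → MvPolynomial (Fin 2) ℚ, (∀ a, P a ≠ 0) ∧ (∀ a, (P a).totalDegree ≤ D) ∧
      ∀ a, ∀ x ∈ S, eval (fun i => (pr a x i : ℚ)) (P a) = 0 := by
  obtain ⟨D0, N0, h⟩ := surf_det δ hδ
  refine ⟨2 * (d + D0) * (d + D0) + (d + D0), N0, fun N hN T F x0 S hFd hF hc hT hT' hp hS => ?_⟩
  obtain ⟨g, hg0, hg1, hg2, hg3⟩ := h N hN T F x0 S hT hT' hp hS
  obtain ⟨c, hc0, hc⟩ := hc
  have hnd : ¬ map (Int.castRingHom ℚ) F ∣ map (Int.castRingHom ℚ) g := by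
    refine not_dvd_of_natDegree _ _ (int_map_ne g hg0) ?_
    have h3 := natDegree_of_monic _ _ c hc0 hc
    have h4 : (uni 0 (map (Int.castRingHom ℚ) g)).natDegree ≤ g.degreeOf 0 := by
      rw [uni_natDegree]; exact degreeOf_map_le' _ _ _
    omega
  have hinj := RingHom.injective_int (Int.castRingHom ℚ)
  choose P h1 h2 h3 using fun a => elim a _ _ hF hnd (d + D0)
    (by rw [totalDegree_map_inj _ hinj]; omega) (by rw [totalDegree_map_inj _ hinj]; omega)
  refine ⟨P, h1, h2, fun a x hx => ?_⟩
  exact h3 a (fun i => (x i : ℚ)) ((eval_cast_zero _ _).2 (hS x hx).2.1)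
    ((eval_cast_zero _ _).2 (hg3 x hx))

lemma grad_mod {n : ℕ} (F : MvPolynomial (Fin n) ℤ) (p : ℕ) (hp : p.Prime) (x : Fin n → ℤ) (l : Fin n)
    (h : ¬ (p : ℤ) ∣ eval x (pderiv l F)) : map (Int.castRingHom (ZMod p)) F ≠ 0 := by
  intro h0
  apply h
  have h1 : map (Int.castRingHom (ZMod p)) (pderiv l F) = 0 := by
    rw [← pderiv_map, h0, map_zero]
  have h2 : ((eval x (pderiv l F) : ℤ) : ZMod p) = 0 := by
    have : Fact p.Prime := ⟨hp⟩
    rw [← eval_cast, h1, map_zero]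
  exact (ZMod.intCast_zmod_eq_zero_iff_dvd _ _).1 h2

/-- class mod `T` -/
def cls (S : Finset (Fin 3 → ℤ)) (T : Finset ℕ) (x : Fin 3 → ℤ) : Finset (Fin 3 → ℤ) :=
  S.filter fun y => ∀ p ∈ T, ∀ i, (p : ℤ) ∣ y i - x i

open Classical in
lemma perT (F : MvPolynomial (Fin 3) ℤ) (d t Q B : ℕ) (hd : F.totalDegree ≤ d) (hdQ : 1 ≤ d * Q ^ 2) 
    (T : Finset ℕ) (hT : ∀ p ∈ T, p.Prime ∧ p ≤ Q) (hTt : T.card ≤ t)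
    (S Y : Finset (Fin 3 → ℤ)) (hYS : Y ⊆ S) (hS : ∀ x ∈ S, eval x F = 0)
    (bad : Finset (Fin 3 → ℤ) → (Fin 3 → ℤ) → Prop)
    (hY : ∀ x ∈ Y, (∀ p ∈ T, ∃ l, ¬ (p : ℤ) ∣ eval x (pderiv l F)) ∧ bad (cls S T x) x ∧
      ((cls S T x).filter fun y => bad (cls S T x) y).card ≤ B) :
    Y.card ≤ B * (d * Q ^ 2) ^ t := by
  have h1 := Finset.card_le_mul_card_image_of_maps_to (s := Y)
    (f := fun x (p : T) i => x i % ((p : ℕ) : ℤ))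
    (t := Fintype.piFinset fun p : T => Y.image fun x i => x i % ((p : ℕ) : ℤ))
    (fun x hx => Fintype.mem_piFinset.2 fun p => Finset.mem_image_of_mem _ hx) B (by
      intro b _
      rcases Finset.eq_empty_or_nonempty {a ∈ Y | (fun (p : T) i => a i % ((p : ℕ) : ℤ)) = b} with h0 | ⟨x, hx⟩
      · rw [h0]; simp
      · rw [Finset.mem_filter] at hx
        refine le_trans (Finset.card_le_card ?_) (hY x hx.1).2.2
        intro y hy
        rw [Finset.mem_filter] at hy
        have hyx : ∀ p ∈ T, ∀ i, (p : ℤ) ∣ y i - x i := by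
          intro p hp i
          have := congrFun (congrFun (hy.2.trans hx.2.symm) ⟨p, hp⟩) i
          exact Int.ModEq.dvd (Int.ModEq.symm this)
        have hcl : cls S T y = cls S T x := by
          refine Finset.filter_congr fun z _ => ?_
          refine forall_congr' fun p => forall_congr' fun hp => forall_congr' fun i => ?_
          have e : z i - x i = (z i - y i) + (y i - x i) := by ring
          rw [e]
          exact (dvd_add_left (hyx p hp i)).symm
        refine Finset.mem_filter.2 ⟨Finset.mem_filter.2 ⟨hYS hy.1, hyx⟩, ?_⟩
        rw [← hcl]
        exact (hY y hy.1).2.1)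
  refine h1.trans (Nat.mul_le_mul_left _ ?_)
  rw [Fintype.card_piFinset]
  rcases Finset.eq_empty_or_nonempty Y with h0 | ⟨x, hx⟩
  · subst h0
    rcases Finset.eq_empty_or_nonempty T with h2 | ⟨p, hp⟩
    · subst h2
      simpa using Nat.one_le_pow _ _ hdQ
    · rw [Finset.prod_eq_zero (Finset.mem_univ (⟨p, hp⟩ : T)) (by simp)]; exact Nat.zero_le _
  · refine (Finset.prod_le_prod' (g := fun _ => d * Q ^ 2) fun p _ => ?_).trans ?_
    · obtain ⟨l, hl⟩ := (hY x hx).1 p p.2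
      refine (residues F p (hT p p.2).1 d hd (grad_mod F p (hT p p.2).1 x l hl) Y fun x hx => hS x (hYS hx)).trans ?_
      exact Nat.mul_le_mul_left _ (Nat.pow_le_pow_left (hT p p.2).2 2)
    · rw [Finset.prod_const, Finset.card_univ, Fintype.card_coe]
      exact Nat.pow_le_pow_right hdQ hTt

end Sal


namespace Sal

lemma prod_ge (T : Finset ℕ) (X t : ℕ) (hX : 1 ≤ X) (hT : ∀ p ∈ T, X < p) (ht : t ≤ T.card) (a : ℝ)
    (ha : a ≤ (X : ℝ) ^ t) : a ≤ ((∏ p ∈ T, p : ℕ) : ℝ) := by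
  refine ha.trans ?_
  have h2 : X ^ T.card ≤ ∏ p ∈ T, p := by
    rw [← Finset.prod_const]
    exact Finset.prod_le_prod' fun p hp => (hT p hp).le
  have h3 : X ^ t ≤ X ^ T.card := Nat.pow_le_pow_right hX ht
  exact_mod_cast h3.trans h2

lemma sing_card (F : MvPolynomial (Fin 3) ℤ) (d : ℕ) (hd : F.totalDegree = d) (hd1 : 1 ≤ d)
    (hF : Irreducible (map (Int.castRingHom ℚ) F))
    (hc : ∃ c : ℚ, c ≠ 0 ∧ (uni 0 (map (Int.castRingHom ℚ) F)).coeff d = C c) (N : ℕ) (hN : 1 ≤ N)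
    (S : Finset (Fin 3 → ℤ)) (hS : ∀ x ∈ S, (∀ i, |x i| ≤ N) ∧ eval x F = 0 ∧ eval x (pderiv 0 F) = 0) :
    S.card ≤ 3 * (d * (2 * d * d + d)) * N := by
  obtain ⟨c, hc0, hc⟩ := hc
  have hinj := RingHom.injective_int (Int.castRingHom ℚ)
  have h0 := totalDegree_map_inj _ hinj F
  have h1 := codim2 (m := 1) _ (pderiv 0 (map (Int.castRingHom ℚ) F)) hF
    (pderiv0_not_dvd _ d c hc0 hc hd1) d (by omega) (pderiv_totalDegree _ d (by omega) 0)
    ⟨d, c, hc0, hc⟩ N S (fun y hy => ⟨(hS y hy).1, (eval_cast_zero _ _).2 (hS y hy).2.1, by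
      rw [pderiv_map]; exact (eval_cast_zero _ _).2 (hS y hy).2.2⟩)
  refine h1.trans ?_
  have : 2 * N + 1 ≤ 3 * N := by omega
  calc d * ((2 * d * d + d) * (2 * N + 1) ^ 1) ≤ d * ((2 * d * d + d) * (3 * N)) := by
        rw [pow_one]; gcongr
    _ = _ := by ring

open Classical in
lemma propA_core (d w t A K : ℕ) (hd : 4 ≤ d) (ht : 1 ≤ t) (δ : ℝ) (hδ : 0 < δ) : ∃ C' A0 : ℕ,
    ∀ N X : ℕ, 1 ≤ N → A0 ≤ N → A0 ≤ X → N ≤ X ^ w →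
    ((A0 * N : ℕ) : ℝ) ^ (1 / 2 + δ) ≤ (X : ℝ) ^ (t - 1) → ∀ F : MvPolynomial (Fin 3) ℤ,
    F.totalDegree = d → Irreducible (map (Int.castRingHom ℚ) F) →
    (∃ c : ℚ, c ≠ 0 ∧ (uni 0 (map (Int.castRingHom ℚ) F)).coeff d = C c) →
    (∀ α, |coeff α F| ≤ A * N ^ K) → ∀ S : Finset (Fin 3 → ℤ),
    (∀ x ∈ S, (∀ i, |x i| ≤ N) ∧ star N F x) → S.card ≤ C' * (N + X ^ (2 * t)) := by
  obtain ⟨D, N0, hcp⟩ := class_polys δ hδ d hd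
  obtain ⟨M0, k2, A2, e, he, hcf⟩ := curve_final D w δ hδ
  obtain ⟨A1, k1, hgp⟩ := grad_primes 3 d w A K
  obtain ⟨M, hM⟩ : ∃ M, M = M0 + (2 * D * D + D) * (2 * D * D + D) := ⟨_, rfl⟩
  obtain ⟨r, hr⟩ : ∃ r, r = k1 + k2 + t := ⟨_, rfl⟩
  obtain ⟨B, hB⟩ : ∃ B, B = 3 * (d * (D * M + D * M + D * D * M)) + d * D ^ 3 := ⟨_, rfl⟩
  refine ⟨3 * (d * (2 * d * d + d)) + 2 ^ r * (B * (d * (2 ^ r) ^ 2) ^ t), A1 + A2 + N0 + 1,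
    fun N X hN hAN hAX hNX hXt F hFd hF hc hco S hS => ?_⟩
  obtain ⟨P, hPr, hP⟩ := pool r X (by omega)
  have hNr : (N : ℝ) ^ (1 / 2 + δ) ≤ (X : ℝ) ^ (t - 1) := by
    refine le_trans (Real.rpow_le_rpow (by positivity) ?_ (by positivity)) hXt
    exact_mod_cast Nat.le_mul_of_pos_left N (by omega)
  have hNr2 : ((A2 * N : ℕ) : ℝ) ^ (1 / 2 + δ) ≤ (X : ℝ) ^ (t - 1) := by
    refine le_trans (Real.rpow_le_rpow (by positivity) ?_ (by positivity)) hXt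
    exact_mod_cast Nat.mul_le_mul_right N (by omega)
  have hstar : ∀ x ∈ S, star N F x := fun x hx => (hS x hx).2
  have hE : ∀ x ∈ S, eval x F = 0 := fun x hx => (hS x hx).2.1
  -- the bad set for `T`
  have hper : ∀ T ∈ P.powerset, (S.filter fun x => (∀ p ∈ T, ∃ l, ¬ (p : ℤ) ∣ eval x (pderiv l F)) ∧
      (T.card = t ∨ T.card + 1 = t) ∧ ¬ NEx D M e (cls S T x) x).card ≤ B * (d * (2 ^ r * X) ^ 2) ^ t := by
    intro T hT
    rw [Finset.mem_powerset] at hT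
    have hdQ : 1 ≤ d * (2 ^ r * X) ^ 2 :=
      Nat.mul_pos (by omega) (Nat.pow_pos (Nat.mul_pos (Nat.pow_pos (by omega)) (by omega)))
    by_cases hTc : T.card = t ∨ T.card + 1 = t
    swap
    · rw [Finset.filter_eq_empty_iff.2 fun x _ h => hTc h.2.1]; simp
    refine perT F d t (2 ^ r * X) B hFd.le hdQ T (fun p hp => ⟨(hP p (hT hp)).1, (hP p (hT hp)).2.2⟩)
      (by omega) S _ (Finset.filter_subset _ _) hE (fun Z y => ¬ NEx D M e Z y) ?_
    intro x hx
    rw [Finset.mem_filter] at hx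
    refine ⟨hx.2.1, hx.2.2.2, ?_⟩
    obtain ⟨Pa, hP1, hP2, hP3⟩ := hcp N (by omega) T F x (cls S T x) hFd hF hc
      (fun p hp => (hP p (hT hp)).1) hx.2.1
      (prod_ge T X (t - 1) (by omega) (fun p hp => (hP p (hT hp)).2.1) (by omega) _ hNr)
      (fun y hy => by
        obtain ⟨h1, h2⟩ := Finset.mem_filter.1 hy
        exact ⟨(hS y h1).1, hE y h1, h2⟩)
    rw [hB]
    convert class_bad F d hFd.le (by omega) D M e (by omega) he (cls S T x)
      (fun y hy => hstar y (Finset.mem_filter.1 hy).1) Pa hP1 hP2 hP3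
  have hsub : S ⊆ (S.filter fun x => eval x (pderiv 0 F) = 0) ∪ P.powerset.biUnion fun T =>
      S.filter fun x => (∀ p ∈ T, ∃ l, ¬ (p : ℤ) ∣ eval x (pderiv l F)) ∧
      (T.card = t ∨ T.card + 1 = t) ∧ ¬ NEx D M e (cls S T x) x := by
    intro x hx
    by_contra hc'
    simp only [Finset.mem_union, not_or, Finset.mem_biUnion, not_exists, not_and, Finset.mem_filter,
      Finset.mem_powerset, not_not] at hc'
    obtain ⟨c1, c2⟩ := hc'
    have c1 := c1 hx
    obtain ⟨b1, hb1⟩ : ∃ b1, b1 = P.filter fun p : ℕ => (p : ℤ) ∣ eval x (pderiv 0 F) := ⟨_, rfl⟩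
    have hb1c : b1.card ≤ k1 := by
      rw [hb1]
      exact hgp N X hN (by omega) hNX P (fun p hp => ⟨(hP p hp).1, (hP p hp).2.1⟩) F hFd.le hco x 0
        (hS x hx).1 c1
    have hNE : ∀ T ⊆ P \ b1, T.card = t ∨ T.card + 1 = t → NEx D M e (cls S T x) x := by
      intro T hT hTc
      refine c2 T (hT.trans Finset.sdiff_subset) hx (fun p hp => ⟨0, fun hdv => ?_⟩) hTc
      have := Finset.mem_sdiff.1 (hT hp)
      refine this.2 ?_
      rw [hb1]
      exact Finset.mem_filter.2 ⟨this.1, hdv⟩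
    have hxc : ∀ T, x ∈ cls S T x := fun T => Finset.mem_filter.2 ⟨hx, fun p _ i => by simp⟩
    have hUc := Finset.le_card_sdiff b1 P
    obtain ⟨T0, hT0, hT0c⟩ := Finset.exists_subset_card_eq (show t ≤ (P \ b1).card by omega)
    obtain ⟨n1, a, h2, hr2, h20, h2d⟩ := hNE T0 hT0 (Or.inl hT0c)
    obtain ⟨h, hrh, h0, heh, huh⟩ := n1 a
    have ha := huh h2 hr2 h20
    have hdeg : 2 ≤ h.totalDegree := by rw [← deg_assoc h h2 ha hrh.1.ne_zero]; exact h2d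
    have hex := exchange (P \ b1) t
      (fun T h => rich D M ((cls S T x).image (pr a)) h ∧ eval (fun i => (pr a x i : ℚ)) h = 0)
      (fun W T h hWT hh => ⟨rich_mono _ _ _ _ (Finset.image_subset_image (Finset.monotone_filter_right S fun y _ hy p hp => hy p (hWT hp))) h hh.1, hh.2⟩)
      (fun T h h' ha hh => ⟨rich_assoc _ _ _ h h' ha hh.1, eval_assoc h h' ha _ hh.2⟩)
      (fun T hT hTc => by
        obtain ⟨h, e1, e2, -, e3⟩ := (hNE T hT hTc).1 a
        exact ⟨h, ⟨e1, e2⟩, fun h' hh' => e3 h' hh'.1 hh'.2⟩) T0 h hT0 hT0c ⟨hrh, h0⟩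
    have hbox : ∀ T, ∀ u ∈ (cls S T x).image (pr a), (∀ i, |u i| ≤ N) ∧ ∀ p ∈ T, ∀ i, (p : ℤ) ∣ u i - pr a x i := by
      intro T u hu
      obtain ⟨y, hy, rfl⟩ := Finset.mem_image.1 hu
      obtain ⟨hy1, hy2⟩ := Finset.mem_filter.1 hy
      exact ⟨fun i => (hS y hy1).1 _, fun p hp i => hy2 p hp _⟩
    obtain ⟨bad, -, hbc, hfin⟩ := hcf M (by omega) N X hN (by omega) (by omega) hNX P
      (fun p hp => ⟨(hP p hp).1, (hP p hp).2.1⟩) h hrh.1 hdeg hrh.2.1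
      (((cls S T0 x).image (pr a)).filter fun u => eval (fun i => (u i : ℚ)) h = 0)
      (fun u hu => by
        rw [Finset.mem_filter] at hu
        exact ⟨(hbox T0 u hu.1).1, hu.2⟩) hrh.2.2 (pr a x)
      (Finset.mem_filter.2 ⟨Finset.mem_image_of_mem _ (hxc T0), h0⟩) heh
    have hUc2 := Finset.le_card_sdiff bad (P \ b1)
    obtain ⟨T, hT, hTc⟩ := Finset.exists_subset_card_eq (show t ≤ ((P \ b1) \ bad).card by omega)
    have hTP : T ⊆ P \ b1 := hT.trans Finset.sdiff_subset
    obtain ⟨hrT, -⟩ := hex _ T rfl hTP hTc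
    have := hfin T (hT.trans (Finset.sdiff_subset_sdiff Finset.sdiff_subset le_rfl))
      (prod_ge T X (t - 1) (by omega) (fun p hp => (hP p (Finset.mem_sdiff.1 (hTP hp)).1).2.1) (by omega) _ hNr2)
      (((cls S T x).image (pr a)).filter fun u => eval (fun i => (u i : ℚ)) h = 0)
      (fun u hu => by
        rw [Finset.mem_filter] at hu
        exact ⟨(hbox T u hu.1).1, hu.2, (hbox T u hu.1).2⟩)
    exact absurd hrT.2.2 (by omega)
  refine (Finset.card_le_card hsub).trans ((Finset.card_union_le _ _).trans ?_)
  have e1 := sing_card F d hFd (by omega) hF hc N hN (S.filter fun x => eval x (pderiv 0 F) = 0)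
    (fun x hx => by
      rw [Finset.mem_filter] at hx
      exact ⟨(hS x hx.1).1, hE x hx.1, hx.2⟩)
  have e2 := Finset.card_biUnion_le_card_mul P.powerset _ _ hper
  rw [Finset.card_powerset, hPr] at e2
  have e3 : (d * (2 ^ r * X) ^ 2) ^ t = (d * (2 ^ r) ^ 2) ^ t * X ^ (2 * t) := by
    rw [mul_pow (2 ^ r) X 2, ← mul_assoc, mul_pow, ← pow_mul X]
  rw [e3] at e2
  refine (Nat.add_le_add e1 e2).trans ?_
  generalize 3 * (d * (2 * d * d + d)) = u1
  generalize (d * (2 ^ r) ^ 2) ^ t = u2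
  generalize X ^ (2 * t) = u3
  have : (u1 + 2 ^ r * (B * u2)) * (N + u3) = u1 * N + 2 ^ r * (B * (u2 * u3)) + (u1 * u3 + 2 ^ r * (B * u2) * N) := by
    ring
  omega

end Sal


namespace Sal

lemma star_congr {N : ℕ} (F G : MvPolynomial (Fin 3) ℤ) (h : ∀ x, eval x G = 0 ↔ eval x F = 0) (x) :
    star N F x ↔ star N G x := by
  unfold star; simp only [h]

lemma propA_bdd (d w t : ℕ) (hd : 4 ≤ d) (ht : 1 ≤ t) (δ : ℝ) (hδ : 0 < δ) : ∃ C' A0 : ℕ,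
    ∀ N X : ℕ, 1 ≤ N → A0 ≤ N → A0 ≤ X → N ≤ X ^ w →
    ((A0 * N : ℕ) : ℝ) ^ (1 / 2 + δ) ≤ (X : ℝ) ^ (t - 1) → ∀ F : MvPolynomial (Fin 3) ℤ,
    F.totalDegree = d → Irreducible (map (Int.castRingHom ℚ) F) →
    (∃ c : ℚ, c ≠ 0 ∧ (uni 0 (map (Int.castRingHom ℚ) F)).coeff d = C c) → ∀ S : Finset (Fin 3 → ℤ),
    (∀ x ∈ S, (∀ i, |x i| ≤ N) ∧ star N F x) → S.card ≤ C' * (N + X ^ (2 * t)) := by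
  obtain ⟨A, K, hAK⟩ := height_red 3 d
  obtain ⟨C', A0, hcore⟩ := propA_core d w t A K hd ht δ hδ
  refine ⟨C' + d * ((2 * d * d + d) * 3), A0, fun N X hN h1 h2 h3 h4 F hFd hF hc S hS => ?_⟩
  have hinj := RingHom.injective_int (Int.castRingHom ℚ)
  have hF0 : F ≠ 0 := by rintro rfl; simp at hFd; omega
  obtain ⟨T, hT0, hTd, hTS, hTc⟩ := hAK F N hN S hF0 hFd.le (fun x hx => ⟨(hS x hx).1, (hS x hx).2.1⟩)
  have hTd' : (map (Int.castRingHom ℚ) T).totalDegree ≤ (map (Int.castRingHom ℚ) F).totalDegree := by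
    rw [totalDegree_map_inj _ hinj, totalDegree_map_inj _ hinj]; omega
  by_cases hdvd : map (Int.castRingHom ℚ) F ∣ map (Int.castRingHom ℚ) T
  · obtain ⟨c, hc0, hTF⟩ := const_quot _ _ (int_map_ne T hT0) hTd' hdvd
    have hz : ∀ x, eval x T = 0 ↔ eval x F = 0 := by
      intro x
      rw [← eval_cast_zero (K := ℚ), ← eval_cast_zero (K := ℚ), hTF, map_mul, eval_C]
      simp [hc0]
    have hu : IsUnit (C c : MvPolynomial (Fin 3) ℚ) := (IsUnit.mk0 c hc0).map C
    have hTd2 : T.totalDegree = d := by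
      rw [← totalDegree_map_inj _ hinj, hTF, totalDegree_mul_of_isDomain hu.ne_zero hF.ne_zero,
        totalDegree_C, zero_add, totalDegree_map_inj _ hinj, hFd]
    obtain ⟨c', hc0', hc'⟩ := hc
    refine (hcore N X hN h1 h2 h3 h4 T hTd2 ?_ ⟨c * c', mul_ne_zero hc0 hc0', ?_⟩ hTc S
      fun x hx => ⟨(hS x hx).1, (star_congr F T hz x).1 (hS x hx).2⟩).trans
      (Nat.mul_le_mul_right _ (by omega))
    · rw [hTF, irreducible_isUnit_mul hu]; exact hF
    · rw [hTF, map_mul, uni_C, Polynomial.coeff_C_mul, hc', C_mul]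
  · obtain ⟨c', hc0', hc'⟩ := hc
    have := codim2 (m := 1) _ _ hF hdvd d (by rw [totalDegree_map_inj _ hinj]; omega)
      (by rw [totalDegree_map_inj _ hinj]; omega) ⟨d, c', hc0', hc'⟩ N S
      (fun y hy => ⟨(hS y hy).1, (eval_cast_zero _ _).2 (hS y hy).2.1, (eval_cast_zero _ _).2 (hTS y hy)⟩)
    rw [pow_one] at this
    refine this.trans ?_
    calc d * ((2 * d * d + d) * (2 * N + 1)) ≤ d * ((2 * d * d + d) * (3 * N)) := by gcongr; omega
      _ = d * ((2 * d * d + d) * 3) * N := by ring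
      _ ≤ _ := Nat.mul_le_mul (by omega) (by omega)

lemma propA (d : ℕ) (hd : 4 ≤ d) (ε : ℝ) (hε : 0 < ε) : ∃ C' : ℝ, 0 ≤ C' ∧
    ∀ N : ℕ, 1 ≤ N → ∀ F : MvPolynomial (Fin 3) ℤ,
    F.totalDegree = d → Irreducible (map (Int.castRingHom ℚ) F) →
    (∃ c : ℚ, c ≠ 0 ∧ (uni 0 (map (Int.castRingHom ℚ) F)).coeff d = C c) → ∀ S : Finset (Fin 3 → ℤ),
    (∀ x ∈ S, (∀ i, |x i| ≤ N) ∧ star N F x) → (S.card : ℝ) ≤ C' * (N : ℝ) ^ (1 + ε) := by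
  obtain ⟨t0, ht0⟩ := exists_nat_gt ((2 + 2 * ε) / ε)
  obtain ⟨t, ht⟩ : ∃ t, t = t0 + 1 := ⟨_, rfl⟩
  have ht1 : 1 ≤ t := by omega
  have htR : (2 + 2 * ε) ≤ ε * t := by
    rw [div_lt_iff₀ hε] at ht0
    rw [ht]; push_cast; nlinarith
  have htpos : (0 : ℝ) < t := by exact_mod_cast ht1
  obtain ⟨η, hη⟩ : ∃ η, η = (1 + ε) / (2 * t) := ⟨_, rfl⟩
  have hη0 : 0 < η := by rw [hη]; positivity
  have hηt : η * (2 * t) = 1 + ε := by rw [hη]; field_simp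
  have hη4 : η ≤ ε / 4 := by rw [hη, div_le_iff₀ (by positivity)]; nlinarith
  obtain ⟨w, hw⟩ := exists_nat_gt (1 / η)
  have hw' : 1 ≤ η * w := by rw [div_lt_iff₀ hη0] at hw; linarith
  obtain ⟨C', A0, hb⟩ := propA_bdd d w t hd ht1 (ε / 8) (by positivity)
  obtain ⟨N1, hN1⟩ := exists_nat_ge ((A0 : ℝ) ^ ((1 / 2 + ε / 8) / (ε / 8)))
  obtain ⟨N2, hN2⟩ := exists_nat_ge ((A0 : ℝ) ^ (1 / η))
  obtain ⟨N0, hN0⟩ : ∃ N0, N0 = A0 + N1 + N2 := ⟨_, rfl⟩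
  refine ⟨d * (2 * N0 + 1) ^ 2 + C' * (1 + 2 ^ (2 * t)), by positivity, fun N hN F hFd hF hc S hS => ?_⟩
  have hNR : (1 : ℝ) ≤ N := by exact_mod_cast hN
  have hNpos : (0 : ℝ) < N := by linarith
  have hNN : (N : ℝ) ≤ (N : ℝ) ^ (1 + ε) := by
    conv_lhs => rw [← Real.rpow_one (N : ℝ)]
    exact Real.rpow_le_rpow_of_exponent_le hNR (by linarith)
  rcases Nat.lt_or_ge N N0 with hlt | hge
  · have h1 := box_zeros (m := 2) _ hF.ne_zero d N
      (by rw [totalDegree_map_inj _ (RingHom.injective_int _)]; omega) S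
      (fun y hy => ⟨(hS y hy).1, (eval_cast_zero _ _).2 (hS y hy).2.1⟩)
    have h2 : S.card ≤ d * (2 * N0 + 1) ^ 2 := h1.trans (by gcongr)
    have h3 : (S.card : ℝ) ≤ d * (2 * N0 + 1) ^ 2 := by exact_mod_cast h2
    have h4 : (0 : ℝ) ≤ C' * (1 + 2 ^ (2 * t)) := by positivity
    have h5 : (0 : ℝ) ≤ d * (2 * N0 + 1) ^ 2 := by positivity
    nlinarith [hNR.trans hNN]
  · obtain ⟨X, hX⟩ : ∃ X : ℕ, X = ⌈(N : ℝ) ^ η⌉₊ := ⟨_, rfl⟩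
    have hX1 : (N : ℝ) ^ η ≤ X := by rw [hX]; exact Nat.le_ceil _
    have hX2 : (X : ℝ) ≤ 2 * (N : ℝ) ^ η := by
      have := Nat.ceil_lt_add_one (show 0 ≤ (N : ℝ) ^ η by positivity)
      rw [← hX] at this
      have := Real.one_le_rpow hNR hη0.le
      linarith
    have hAX : (A0 : ℝ) ≤ (N : ℝ) ^ η := by
      have h1 : (A0 : ℝ) ^ (1 / η) ≤ N := hN2.trans (by exact_mod_cast (by omega : N2 ≤ N))
      have h2 := Real.rpow_le_rpow (by positivity) h1 hη0.le
      rwa [← Real.rpow_mul (by positivity), one_div, inv_mul_cancel₀ hη0.ne', Real.rpow_one] at h2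
    have hk : ∀ k : ℕ, (N : ℝ) ^ (η * k) ≤ (X : ℝ) ^ k := by
      intro k
      rw [Real.rpow_mul (by positivity), Real.rpow_natCast]
      exact pow_le_pow_left₀ (by positivity) hX1 k
    have hNX : N ≤ X ^ w := by
      have : (N : ℝ) ≤ (X : ℝ) ^ w := by
        refine le_trans ?_ (hk w)
        conv_lhs => rw [← Real.rpow_one (N : ℝ)]
        exact Real.rpow_le_rpow_of_exponent_le hNR hw'
      exact_mod_cast this
    have hcond : ((A0 * N : ℕ) : ℝ) ^ (1 / 2 + ε / 8) ≤ (X : ℝ) ^ (t - 1) := by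
      refine le_trans ?_ (hk (t - 1))
      have h1 : (A0 : ℝ) ^ (1 / 2 + ε / 8) ≤ (N : ℝ) ^ (ε / 8) := by
        have h1 : (A0 : ℝ) ^ ((1 / 2 + ε / 8) / (ε / 8)) ≤ N :=
          hN1.trans (by exact_mod_cast (by omega : N1 ≤ N))
        have h2 := Real.rpow_le_rpow (by positivity) h1 (show 0 ≤ ε / 8 by positivity)
        rwa [← Real.rpow_mul (by positivity), div_mul_cancel₀ _ (by positivity)] at h2
      push_cast
      rw [Real.mul_rpow (by positivity) (by positivity)]
      refine (mul_le_mul_of_nonneg_right h1 (by positivity)).trans ?_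
      rw [← Real.rpow_add hNpos]
      refine Real.rpow_le_rpow_of_exponent_le hNR ?_
      rw [Nat.cast_sub ht1]
      push_cast
      nlinarith
    have h1 := hb N X hN (by omega) (by exact_mod_cast hAX.trans hX1) hNX hcond F hFd hF hc S hS
    have h2 : (S.card : ℝ) ≤ C' * (N + (X : ℝ) ^ (2 * t)) := by exact_mod_cast h1
    have h3 : (X : ℝ) ^ (2 * t) ≤ 2 ^ (2 * t) * (N : ℝ) ^ (1 + ε) := by
      refine (pow_le_pow_left₀ (by positivity) hX2 _).trans ?_
      rw [mul_pow, ← Real.rpow_natCast ((N : ℝ) ^ η), ← Real.rpow_mul (by positivity)]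
      push_cast
      rw [hηt]
    have h4 : (N : ℝ) + (X : ℝ) ^ (2 * t) ≤ (1 + 2 ^ (2 * t)) * (N : ℝ) ^ (1 + ε) := by linarith
    have h5 : (0 : ℝ) ≤ d * (2 * N0 + 1) ^ 2 * (N : ℝ) ^ (1 + ε) := by positivity
    have h6 := mul_le_mul_of_nonneg_left h4 (show (0 : ℝ) ≤ C' by positivity)
    nlinarith

end Sal


namespace Sal

def prim (v : Fin 3 → ℤ) : Prop := ∃ c : Fin 3 → ℤ, ∑ i, c i * v i = 1

lemma prim_prop (v w : Fin 3 → ℤ) (hv : prim v) (hw : prim w) (h : ∀ i j, v i * w j = v j * w i) :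
    v = w ∨ v = -w := by
  obtain ⟨c, hc⟩ := hv
  obtain ⟨e, he⟩ := hw
  have h1 : ∀ i, v i = (∑ j, e j * v j) * w i := by
    intro i
    calc v i = (∑ j, e j * w j) * v i := by rw [he, one_mul]
      _ = _ := by
        rw [Finset.sum_mul, Finset.sum_mul]
        exact Finset.sum_congr rfl fun j _ => by linear_combination e j * h i j
  have h2 : (∑ j, e j * v j) * (∑ j, c j * w j) = 1 := by
    rw [← hc, Finset.mul_sum]
    exact Finset.sum_congr rfl fun j _ => by rw [h1 j]; ring
  rcases Int.isUnit_iff.1 (IsUnit.of_mul_eq_one _ h2) with h3 | h3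
  · left; funext i; rw [h1 i, h3, one_mul]
  · right; funext i; rw [h1 i, h3]; simp

lemma exists_prim (v : Fin 3 → ℤ) (hv : v ≠ 0) : ∃ (g : ℤ) (w : Fin 3 → ℤ), g ≠ 0 ∧ prim w ∧
    ∀ i, v i = g * w i := by
  obtain ⟨g, hg⟩ : ∃ g, g = Submodule.IsPrincipal.generator (Ideal.span (Set.range v)) := ⟨_, rfl⟩
  have h1 : Ideal.span {g} = Ideal.span (Set.range v) := by
    rw [hg]; exact Ideal.span_singleton_generator _
  have h2 : ∀ i, g ∣ v i := fun i => by
    rw [← Ideal.mem_span_singleton, h1]; exact Ideal.subset_span ⟨i, rfl⟩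
  choose w hw using h2
  have h3 : g ∈ Ideal.span (Set.range v) := by rw [← h1]; exact Ideal.mem_span_singleton_self g
  obtain ⟨c, hc⟩ := (Ideal.mem_span_range_iff_exists_fun).1 h3
  have hg0 : g ≠ 0 := by
    rintro rfl; exact hv (funext fun i => by rw [hw i]; simp)
  refine ⟨g, w, hg0, ⟨c, mul_left_cancel₀ hg0 ?_⟩, hw⟩
  rw [mul_one, Finset.mul_sum]
  conv_rhs => rw [← hc]
  exact Finset.sum_congr rfl fun j _ => by rw [hw j]; ring

/-- cross product -/
def crs {R : Type*} [CommRing R] (a b : Fin 3 → R) (i : Fin 3) : R :=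
  a (i + 1) * b (i + 2) - a (i + 2) * b (i + 1)

lemma crs_id {R : Type*} [CommRing R] (a b v : Fin 3 → R) (h : ∑ j, crs a b j * v j = 0) (i j : Fin 3) :
    crs a b i * v j = crs v b i * a j + crs a v i * b j := by
  simp only [Fin.sum_univ_three, crs] at h ⊢
  fin_cases i <;> fin_cases j <;> simp only [Fin.zero_eta, Fin.mk_one, Fin.reduceFinMk, zero_add,
    Fin.reduceAdd] at h ⊢ <;>
    first | ring1 | linear_combination h

lemma plane_ne (φ : MvPolynomial (Fin 3) ℚ) (k : ℕ) (hφ : Irreducible φ) (hk : φ.IsHomogeneous k)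
    (hk2 : 2 ≤ k) (h0 : eval (Fin.cons 1 (fun _ => 0) : Fin 3 → ℚ) φ ≠ 0) (L : Fin 3 → ℚ) (hL : L ≠ 0) :
    ∃ x : Fin 3 → ℚ, ∑ j, L j * x j = 0 ∧ eval x φ ≠ 0 := by
  by_contra! hcon
  obtain ⟨Lp, hLp⟩ : ∃ Lp : MvPolynomial (Fin 3) ℚ, Lp = ∑ j, C (L j) * X j := ⟨_, rfl⟩
  have hLe : ∀ x, eval x Lp = ∑ j, L j * x j := fun x => by rw [hLp]; simp
  have hLd : Lp.totalDegree ≤ 1 := by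
    rw [hLp]
    refine totalDegree_finsetSum_le fun j _ => (totalDegree_mul _ _).trans ?_
    rw [totalDegree_C, totalDegree_X]
  obtain ⟨i, hi⟩ := Function.ne_iff.1 hL
  have hL0 : Lp ≠ 0 := by
    rintro h
    apply hi
    have := hLe (Pi.single i 1)
    rw [h] at this
    simpa [Pi.single_apply] using this.symm
  have hdvd : ¬ φ ∣ Lp := by
    intro h
    have := totalDegree_le_of_dvd_of_isDomain h hL0
    rw [hk.totalDegree hφ.ne_zero] at this
    omega
  obtain ⟨P, hP0, -, hP⟩ := elim 0 φ Lp hφ hdvd k (hk.totalDegree hφ.ne_zero).le (by omega)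
  by_cases h00 : L 0 = 0
  · refine h0 (hcon _ ?_)
    rw [Fin.sum_univ_three, h00]
    simp only [show (1 : Fin 3) = Fin.succ 0 from rfl, show (2 : Fin 3) = Fin.succ 1 from rfl, Fin.cons_succ]
    ring
  · apply hP0
    refine MvPolynomial.funext fun u => ?_
    have hs : ∑ j, L j * (Fin.cons (-(L 1 * u 0 + L 2 * u 1) / L 0) u : Fin 3 → ℚ) j = 0 := by
      rw [Fin.sum_univ_three]
      simp only [show (1 : Fin 3) = Fin.succ 0 from rfl, show (2 : Fin 3) = Fin.succ 1 from rfl,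
        Fin.cons_succ, Fin.cons_zero]
      field_simp
      ring
    have := hP _ (hcon _ hs) (by rw [hLe, hs])
    simpa using this

open Classical in
lemma plane_card (φ : MvPolynomial (Fin 3) ℚ) (k : ℕ) (hφ : Irreducible φ) (hk : φ.IsHomogeneous k)
    (hk2 : 2 ≤ k) (h0 : eval (Fin.cons 1 (fun _ => 0) : Fin 3 → ℚ) φ ≠ 0) (Z : Finset (Fin 3 → ℤ))
    (hZ : ∀ v ∈ Z, prim v ∧ eval (fun i => (v i : ℚ)) φ = 0)
    (hd : ∀ u ∈ Z, ∀ v ∈ Z, ∀ w ∈ Z, ∑ j, crs u v j * w j = 0) : Z.card ≤ 2 * (k + 1) := by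
  by_contra! hc
  obtain ⟨a, ha⟩ := Finset.card_pos.1 (show 0 < Z.card by omega)
  obtain ⟨b, hb, hab⟩ : ∃ b ∈ Z, b ∉ ({a, -a} : Finset (Fin 3 → ℤ)) := by
    by_contra! h
    have := Finset.card_le_card (show Z ⊆ {a, -a} from h)
    have := Finset.card_le_two (a := a) (b := -a)
    omega
  obtain ⟨i, hi⟩ : ∃ i, crs a b i ≠ 0 := by
    by_contra! h
    have e0 : a 1 * b 2 - a 2 * b 1 = 0 := h 0
    have e1 : a 2 * b 0 - a 0 * b 2 = 0 := h 1
    have e2 : a 0 * b 1 - a 1 * b 0 = 0 := h 2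
    apply hab
    rw [Finset.mem_insert, Finset.mem_singleton]
    refine prim_prop b a (hZ b hb).1 (hZ a ha).1 fun i j => ?_
    fin_cases i <;> fin_cases j <;> simp only [Fin.zero_eta, Fin.mk_one, Fin.reduceFinMk] <;> linarith
  have hiQ : ((crs a b i : ℤ) : ℚ) ≠ 0 := by exact_mod_cast hi
  obtain ⟨aq, haq⟩ : ∃ aq : Fin 3 → ℚ, aq = fun i => (a i : ℚ) := ⟨_, rfl⟩
  obtain ⟨bq, hbq⟩ : ∃ bq : Fin 3 → ℚ, bq = fun i => (b i : ℚ) := ⟨_, rfl⟩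
  have hLi : crs aq bq i ≠ 0 := by rw [haq, hbq]; unfold crs at hiQ ⊢; beta_reduce; exact_mod_cast hiQ
  have hst : ∀ s t : ℚ, s ≠ 0 → eval (fun j => s * aq j + t * bq j) φ = s ^ k * (onLine aq bq φ).eval (t / s) := by
    intro s t hs
    rw [onLine_eval, ← hom_eval_smul φ hk]
    have : (fun j => s * aq j + t * bq j) = fun j => s * (aq j + t / s * bq j) := by
      funext j; field_simp
    rw [this]
  have hg : onLine aq bq φ ≠ 0 := by
    intro hg
    obtain ⟨x, hx, hxφ⟩ := plane_ne φ k hφ hk hk2 h0 (crs aq bq) (fun h => hLi (congrFun h i))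
    have e := crs_id aq bq x hx i
    have hx' : x = fun j => crs x bq i / crs aq bq i * aq j + crs aq x i / crs aq bq i * bq j := by
      funext j
      have := e j
      field_simp
      linear_combination this
    apply hxφ
    rw [hx']
    by_cases hs : crs x bq i / crs aq bq i = 0
    · rw [hs]
      have : (fun j => 0 * aq j + crs aq x i / crs aq bq i * bq j) = fun j => crs aq x i / crs aq bq i * bq j := by
        funext j; ring
      rw [this, hom_eval_smul φ hk, hbq, (hZ b hb).2, mul_zero]
    · rw [hst _ _ hs, hg]; simp
  obtain ⟨cl, hcl⟩ : ∃ cl : (Fin 3 → ℤ) → Option ℚ, cl = fun v => if crs v b i = 0 then none else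
    some (((crs a v i : ℤ) : ℚ) / ((crs v b i : ℤ) : ℚ)) := ⟨_, rfl⟩
  have hv : ∀ v ∈ Z, ∀ j, crs a b i * v j = crs v b i * a j + crs a v i * b j := fun v hv j =>
    crs_id a b v (hd a ha b hb v hv) i j
  have h1 := Finset.card_le_mul_card_image_of_maps_to (s := Z) (f := cl)
    (t := insert none ((onLine aq bq φ).roots.toFinset.image some)) ?_ 2 ?_
  · have h2 : (insert none ((onLine aq bq φ).roots.toFinset.image some)).card ≤ k + 1 := by
      refine (Finset.card_insert_le _ _).trans (Nat.add_le_add_right ?_ 1)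
      refine Finset.card_image_le.trans ((Multiset.toFinset_card_le _).trans ((Polynomial.card_roots' _).trans ?_))
      exact (onLine_deg _ _ _).trans (hk.totalDegree hφ.ne_zero).le
    have := Nat.mul_le_mul_left 2 h2
    omega
  · intro v hvZ
    rw [hcl]
    beta_reduce
    split_ifs with h
    · exact Finset.mem_insert_self _ _
    · refine Finset.mem_insert_of_mem (Finset.mem_image_of_mem _ ?_)
      rw [Multiset.mem_toFinset, Polynomial.mem_roots hg, Polynomial.IsRoot.def]
      have hq : ((crs v b i : ℤ) : ℚ) ≠ 0 := by exact_mod_cast h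
      have h3 := hst ((crs v b i : ℤ) / (crs a b i : ℤ)) ((crs a v i : ℤ) / (crs a b i : ℤ)) (div_ne_zero hq hiQ)
      have h4 : (fun j => ((crs v b i : ℤ) / (crs a b i : ℤ) : ℚ) * aq j + ((crs a v i : ℤ) / (crs a b i : ℤ) : ℚ) * bq j) = fun j => (v j : ℚ) := by
        funext j
        have : ((crs a b i : ℤ) * v j : ℚ) = (crs v b i : ℤ) * a j + (crs a v i : ℤ) * b j := by exact_mod_cast hv v hvZ j
        rw [haq, hbq]
        field_simp
        linear_combination -this
      rw [h4, (hZ v hvZ).2, div_div_div_cancel_right₀ hiQ] at h3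
      exact (mul_eq_zero.1 h3.symm).resolve_left (pow_ne_zero _ (div_ne_zero hq hiQ))
  · intro c _
    rcases Finset.eq_empty_or_nonempty (Z.filter fun x => cl x = c) with he | ⟨v, hvm⟩
    · rw [he]; simp
    refine (Finset.card_le_card (t := {v, -v}) ?_).trans Finset.card_le_two
    intro w hw
    rw [Finset.mem_filter] at hw hvm
    rw [Finset.mem_insert, Finset.mem_singleton]
    refine prim_prop w v (hZ w hw.1).1 (hZ v hvm.1).1 fun i' j' => ?_
    have hcc : cl w = cl v := by rw [hw.2, hvm.2]
    have key : crs a w i * crs v b i = crs a v i * crs w b i := by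
      rw [hcl] at hcc
      beta_reduce at hcc
      split_ifs at hcc with h1 h2 h2
      · rw [h1, h2]; ring
      · have hq1 : ((crs w b i : ℤ) : ℚ) ≠ 0 := by exact_mod_cast h1
        have hq2 : ((crs v b i : ℤ) : ℚ) ≠ 0 := by exact_mod_cast h2
        rw [Option.some.injEq, div_eq_div_iff hq1 hq2] at hcc
        exact_mod_cast hcc
    have e1 := hv w hw.1 i'
    have e2 := hv w hw.1 j'
    have e3 := hv v hvm.1 i'
    have e4 := hv v hvm.1 j'
    apply mul_left_cancel₀ hi
    apply mul_left_cancel₀ hi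
    calc _ = (crs a b i * w i') * (crs a b i * v j') := by ring
      _ = (crs a b i * w j') * (crs a b i * v i') := by
        rw [e1, e2, e3, e4]; linear_combination (b i' * a j' - b j' * a i') * key
      _ = _ := by ring

end Sal


namespace Sal

noncomputable def dehom (i : Fin 3) (φ : MvPolynomial (Fin 3) ℤ) : MvPolynomial (Fin 2) ℤ :=
  aeval (i.insertNth (α := fun _ => MvPolynomial (Fin 2) ℤ) 1 X) φ

lemma dehom_eval (i : Fin 3) (φ : MvPolynomial (Fin 3) ℤ) {R : Type*} [CommRing R] (u : Fin 2 → R) :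
    aeval u (dehom i φ) = aeval (i.insertNth (α := fun _ => R) 1 u) φ := by
  unfold dehom
  rw [← AlgHom.comp_apply, comp_aeval]
  congr 2
  funext j
  refine Fin.succAboveCases i ?_ (fun l => ?_) j <;> simp

lemma dehom_pderiv (i : Fin 3) (l : Fin 2) (φ : MvPolynomial (Fin 3) ℤ) :
    pderiv l (dehom i φ) = dehom i (pderiv (i.succAbove l) φ) := by
  have hX : ∀ j, pderiv l (dehom i (X j)) = dehom i (pderiv (i.succAbove l) (X j)) := by
    intro j
    unfold dehom
    refine Fin.succAboveCases i ?_ (fun m => ?_) j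
    · rw [aeval_X, Fin.insertNth_apply_same, pderiv_X_of_ne (Fin.succAbove_ne i l).symm]; simp
    · rw [aeval_X, Fin.insertNth_apply_succAbove]
      by_cases h : m = l
      · rw [h]; simp
      · rw [pderiv_X_of_ne h, pderiv_X_of_ne (fun h' => h (Fin.succAbove_right_injective h'))]; simp
  induction φ using MvPolynomial.induction_on with
  | C a => simp [dehom]
  | add a b ha hb => unfold dehom at *; simp only [map_add, ha, hb]
  | mul_X a j ha =>
    have e := hX j
    unfold dehom at *
    rw [map_mul, pderiv_mul, pderiv_mul, ha, e]
    simp only [map_add, map_mul]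

lemma dehom_deg (i : Fin 3) (φ : MvPolynomial (Fin 3) ℤ) : (dehom i φ).totalDegree ≤ φ.totalDegree := by
  refine (aeval_deg φ _ 1 fun j => ?_).trans (by rw [mul_one])
  refine Fin.succAboveCases i ?_ (fun m => ?_) j
  · rw [Fin.insertNth_apply_same]; simp
  · rw [Fin.insertNth_apply_succAbove, totalDegree_X]

open Classical in
lemma propC_cls (φ : MvPolynomial (Fin 3) ℤ) (k H p : ℕ) (hp : p.Prime) (hpH : 2 * H < p)
    (hφ : Irreducible (map (Int.castRingHom ℚ) φ)) (hk : φ.IsHomogeneous k) (hk2 : 2 ≤ k)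
    (h0 : eval (Fin.cons 1 (fun _ => 0) : Fin 3 → ℚ) (map (Int.castRingHom ℚ) φ) ≠ 0)
    (i : Fin 3) (hi : i ≠ 0) (S : Finset (Fin 3 → ℤ))
    (hS : ∀ v ∈ S, (∀ j, |v j| ≤ H) ∧ prim v ∧ eval v φ = 0 ∧ ¬ (p : ℤ) ∣ v i ∧
      ¬ (p : ℤ) ∣ eval v (pderiv 0 φ)) : S.card ≤ 2 * (k + 1) * (k * p) := by
  have : Fact p.Prime := ⟨hp⟩
  have hs0 : i.succAbove 0 = 0 := Fin.succAbove_ne_zero_zero hi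
  have hφd : φ.totalDegree ≤ k := hk.totalDegree_le
  have hl : ∀ v ∈ S, ∃ l : ℤ, (p : ℤ) ^ 3 ∣ l * v i - 1 ∧ ¬ (p : ℤ) ∣ l := by
    intro v hv
    have h1 : IsCoprime (v i) ((p : ℤ) ^ 3) := by
      refine IsCoprime.pow_right ?_
      exact ((Nat.prime_iff_prime_int.1 hp).irreducible.coprime_iff_not_dvd.2 (hS v hv).2.2.2.1).symm
    obtain ⟨a, b, hab⟩ := h1
    refine ⟨a, ⟨-b, by linear_combination hab⟩, fun hd => ?_⟩
    have h2 : (p : ℤ) ∣ 1 := by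
      rw [← hab]
      exact dvd_add (hd.mul_right _) ((dvd_pow_self _ (by omega)).mul_left _)
    exact (Nat.prime_iff_prime_int.1 hp).not_isUnit (isUnit_of_dvd_one h2)
  choose! l hl1 hl2 using hl
  obtain ⟨u, hu⟩ : ∃ u : (Fin 3 → ℤ) → Fin 2 → ℤ, u = fun v j => l v * v (i.succAbove j) := ⟨_, rfl⟩
  have hcong : ∀ v ∈ S, ∀ j, (p : ℤ) ^ 3 ∣ (i.insertNth (α := fun _ => ℤ) 1 (u v)) j - l v * v j := by
    intro v hv j
    refine Fin.succAboveCases i ?_ (fun m => ?_) j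
    · rw [Fin.insertNth_apply_same, dvd_sub_comm]; exact hl1 v hv
    · rw [Fin.insertNth_apply_succAbove, hu]; simp
  have hE : ∀ (G : MvPolynomial (Fin 3) ℤ), ∀ v ∈ S, (p : ℤ) ^ 3 ∣ eval (u v) (dehom i G) - eval (fun j => l v * v j) G := by
    intro G v hv
    have := dehom_eval i G (u v)
    rw [aeval_eq_eval] at this
    change eval (u v) (dehom i G) = eval _ G at this
    rw [this]
    exact eval_congr_dvd _ _ _ _ (hcong v hv)
  have hf : ∀ v ∈ S, (p : ℤ) ^ 3 ∣ eval (u v) (dehom i φ) := by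
    intro v hv
    have := hE φ v hv
    rwa [hom_eval_smul φ hk, (hS v hv).2.2.1, mul_zero, sub_zero] at this
  have hpp : (p : ℤ) ∣ (p : ℤ) ^ 3 := dvd_pow_self _ (by omega)
  have hgr : ∀ v ∈ S, ¬ (p : ℤ) ∣ eval (u v) (pderiv 0 (dehom i φ)) := by
    intro v hv hd
    rw [dehom_pderiv, hs0] at hd
    have h1 := (dvd_sub_right hd).1 (hpp.trans (hE (pderiv 0 φ) v hv))
    rw [hom_eval_smul _ hk.pderiv] at h1
    rcases (Nat.prime_iff_prime_int.1 hp).dvd_or_dvd h1 with h | h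
    · exact hl2 v hv ((Nat.prime_iff_prime_int.1 hp).dvd_of_dvd_pow h)
    · exact (hS v hv).2.2.2.2 h
  rcases Finset.eq_empty_or_nonempty S with he | ⟨v0, hv0⟩
  · rw [he]; simp
  have hne := grad_mod (dehom i φ) p hp (u v0) 0 (hgr v0 hv0)
  have hsz := sz_card (m := 1) (map (Int.castRingHom (ZMod p)) (dehom i φ)) hne Finset.univ k
    ((totalDegree_map_le' _ _).trans ((dehom_deg i φ).trans hφd))
  rw [Finset.card_univ, ZMod.card, pow_one] at hsz
  refine (Finset.card_le_mul_card_image_of_maps_to (s := S)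
    (f := fun v j => (u v j : ZMod p)) (t := _) ?_ (2 * (k + 1)) ?_).trans (Nat.mul_le_mul_left _ hsz)
  · intro v hv
    refine (@Finset.mem_filter _ _ (_) _ _).2 ⟨Fintype.mem_piFinset.2 fun _ => Finset.mem_univ _, ?_⟩
    rw [eval_cast, ZMod.intCast_zmod_eq_zero_iff_dvd]
    exact hpp.trans (hf v hv)
  · intro c _
    refine plane_card _ k hφ (hk.map _) hk2 h0 _ (fun v hv => ?_) ?_
    · have := hS v (Finset.mem_filter.1 hv).1
      exact ⟨this.2.1, (eval_cast_zero _ _).2 this.2.2.1⟩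
    intro v1 h1 v2 h2 v3 h3
    rw [Finset.mem_filter] at h1 h2 h3
    obtain ⟨V, hV⟩ : ∃ V : Fin 3 → Fin 3 → ℤ, V = ![v1, v2, v3] := ⟨_, rfl⟩
    have hVS : ∀ j, V j ∈ S ∧ (fun i => (u (V j) i : ZMod p)) = c := by
      intro j; rw [hV]; fin_cases j
      exacts [h1, h2, h3]
    have hdet := det_hensel (r := 1) (s := 3) (dehom i φ) p hp (u v1) ⟨0, hgr v1 h1.1⟩ 3
      (fun α hα => comb1 3 α hα) (fun j => dehom i (X j)) (fun j => u (V j)) (fun j m => by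
        have := congrFun ((hVS j).2.trans h1.2.symm) m
        beta_reduce at this
        rw [← ZMod.intCast_zmod_eq_zero_iff_dvd, Int.cast_sub, this, sub_self])
      (fun j => hf _ (hVS j).1) (Matrix.of fun j m => l (V j) * V j m) (fun j m => by
        rw [dvd_sub_comm]
        have := hE (X m) (V j) (hVS j).1
        rwa [eval_X] at this)
    have hd2 : (Matrix.of fun j m => l (V j) * V j m).det = (∏ j, l (V j)) * (Matrix.of V).det :=
      Matrix.det_mul_column (fun j => l (V j)) (Matrix.of V)
    have hd3 : (Matrix.of V).det = ∑ j, crs v1 v2 j * v3 j := by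
      rw [Matrix.det_fin_three, Fin.sum_univ_three, hV]
      simp [crs]
      ring
    rw [hd2] at hdet
    have hcop : IsCoprime ((p : ℤ) ^ 3) (∏ j, l (V j)) := by
      refine IsCoprime.pow_left (IsCoprime.prod_right fun j _ => ?_)
      exact (Nat.prime_iff_prime_int.1 hp).irreducible.coprime_iff_not_dvd.2 (hl2 _ (hVS j).1)
    have hdvd := hcop.dvd_of_dvd_mul_left hdet
    rw [← hd3]
    refine Int.eq_zero_of_abs_lt_dvd hdvd ?_
    have hb := det_bound (Matrix.of V) (fun _ => (H : ℝ)) (fun a b => by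
      exact_mod_cast (hS _ (hVS a).1).1 b)
    have hb' : |(Matrix.of V).det| ≤ 6 * (H : ℤ) ^ 3 := by
      have : (|((Matrix.of V).det : ℝ)|) ≤ 6 * (H : ℝ) ^ 3 := by
        simpa [Nat.factorial] using hb
      exact_mod_cast this
    have h7 : (2 * (H : ℤ) + 1) ^ 3 ≤ (p : ℤ) ^ 3 := pow_le_pow_left₀ (by positivity) (by exact_mod_cast hpH) 3
    have : 0 ≤ (H : ℤ) := by positivity
    nlinarith [pow_nonneg this 3, pow_nonneg this 2]

lemma hom_top {K : Type*} [Field K] [CharZero K] {m : ℕ} (φ : MvPolynomial (Fin (m + 1)) K) (k : ℕ) (hk : φ.IsHomogeneous k) :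
    (uni 0 φ).coeff k = C (eval (Fin.cons 1 (fun _ => 0) : Fin (m + 1) → K) φ) := by
  have h := uni_top φ k hk.totalDegree_le
  rwa [homogeneousComponent_of_mem hk, if_pos rfl] at h

open Classical in
lemma propC_core (D A K : ℕ) : ∃ C' : ℕ, ∀ k, 2 ≤ k → k ≤ D → ∀ φ : MvPolynomial (Fin 3) ℤ,
    Irreducible (map (Int.castRingHom ℚ) φ) → φ.IsHomogeneous k →
    eval (Fin.cons 1 (fun _ => 0) : Fin 3 → ℚ) (map (Int.castRingHom ℚ) φ) ≠ 0 → ∀ H : ℕ, 1 ≤ H →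
    (∀ α, |coeff α φ| ≤ A * H ^ K) → ∀ S : Finset (Fin 3 → ℤ),
    (∀ v ∈ S, (∀ j, |v j| ≤ H) ∧ prim v ∧ eval v φ = 0) → S.card ≤ C' * H := by
  obtain ⟨A0, k0, hgp⟩ := grad_primes 3 D 1 A K
  obtain ⟨r, hr⟩ : ∃ r, r = k0 + 1 := ⟨_, rfl⟩
  refine ⟨3 * (D * (2 * D * D + D)) + 3 * (r * (2 * (D + 1) * (D * (2 ^ r * (2 + A0))))),
    fun k hk2 hkD φ hφ hk h0 H hH hco S hS => ?_⟩
  obtain ⟨X, hX⟩ : ∃ X, X = 2 * H + A0 := ⟨_, rfl⟩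
  obtain ⟨P, hPr, hP⟩ := pool r X (by omega)
  have hinj := RingHom.injective_int (Int.castRingHom ℚ)
  have hφd : φ.totalDegree = k := hk.totalDegree fun h => hφ.ne_zero (by rw [h, map_zero])
  have hsub : S ⊆ (S.filter fun v => eval v (pderiv 0 φ) = 0) ∪ (Finset.univ ×ˢ P).biUnion fun ip =>
      if ip.1 = (0 : Fin 3) then ∅ else
      S.filter fun v => ¬ (ip.2 : ℤ) ∣ v ip.1 ∧ ¬ (ip.2 : ℤ) ∣ eval v (pderiv 0 φ) := by
    intro v hv
    by_cases h1 : eval v (pderiv 0 φ) = 0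
    · exact Finset.mem_union_left _ (Finset.mem_filter.2 ⟨hv, h1⟩)
    refine Finset.mem_union_right _ ?_
    have h2 := hgp H X hH (by omega) (by rw [pow_one]; omega) P (fun p hp => ⟨(hP p hp).1, (hP p hp).2.1⟩) φ
      (by omega) hco v 0 (hS v hv).1 h1
    obtain ⟨p, hpP, hpd⟩ : ∃ p ∈ P, ¬ (p : ℤ) ∣ eval v (pderiv 0 φ) := by
      by_contra! h
      rw [Finset.filter_true_of_mem h] at h2
      omega
    have hpp := Nat.prime_iff_prime_int.1 (hP p hpP).1
    obtain ⟨i, hi0, hi⟩ : ∃ i : Fin 3, i ≠ 0 ∧ ¬ (p : ℤ) ∣ v i := by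
      by_contra! h
      have he := congrArg (eval v) hk.sum_X_mul_pderiv
      rw [map_sum, Fin.sum_univ_three] at he
      simp only [map_mul, eval_X, map_nsmul, (hS v hv).2.2, smul_zero] at he
      have e1 : (p : ℤ) ∣ v 0 * eval v (pderiv 0 φ) := by
        rw [show v 0 * eval v (pderiv 0 φ) = - (v 1 * eval v (pderiv 1 φ)) - v 2 * eval v (pderiv 2 φ) by
          linear_combination he]
        exact dvd_sub (((h 1 (by decide)).mul_right _).neg_right) ((h 2 (by decide)).mul_right _)
      have e2 := (hpp.dvd_or_dvd e1).resolve_right hpd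
      obtain ⟨c, hc⟩ := (hS v hv).2.1
      rw [Fin.sum_univ_three] at hc
      apply hpp.not_isUnit
      apply isUnit_of_dvd_one
      rw [← hc]
      exact dvd_add (dvd_add (e2.mul_left _) ((h 1 (by decide)).mul_left _)) ((h 2 (by decide)).mul_left _)
    refine Finset.mem_biUnion.2 ⟨(i, p), Finset.mem_product.2 ⟨Finset.mem_univ _, hpP⟩, ?_⟩
    rw [if_neg hi0]
    exact Finset.mem_filter.2 ⟨hv, hi, hpd⟩
  refine (Finset.card_le_card hsub).trans ((Finset.card_union_le _ _).trans ?_)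
  have e1 := sing_card φ k hφd (by omega) hφ ⟨_, h0, hom_top _ k (hk.map _)⟩ H hH
    (S.filter fun v => eval v (pderiv 0 φ) = 0) (fun x hx => by
      rw [Finset.mem_filter] at hx
      exact ⟨(hS x hx.1).1, (hS x hx.1).2.2, hx.2⟩)
  have e2 := Finset.card_biUnion_le_card_mul (Finset.univ ×ˢ P) (fun ip : Fin 3 × ℕ =>
      if ip.1 = (0 : Fin 3) then ∅ else
      S.filter fun v => ¬ (ip.2 : ℤ) ∣ v ip.1 ∧ ¬ (ip.2 : ℤ) ∣ eval v (pderiv 0 φ))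
      (2 * (D + 1) * (D * (2 ^ r * X))) (by
        rintro ⟨i, p⟩ hip
        have hpP := (Finset.mem_product.1 hip).2
        by_cases hi : i = 0
        · simp [hi]
        rw [if_neg hi]
        refine (propC_cls φ k H p (hP p hpP).1 (by have := (hP p hpP).2.1; omega) hφ hk hk2 h0 i hi _ ?_).trans ?_
        · intro v hv
          rw [Finset.mem_filter] at hv
          exact ⟨(hS v hv.1).1, (hS v hv.1).2.1, (hS v hv.1).2.2, hv.2⟩
        · have := (hP p hpP).2.2
          gcongr)
  rw [Finset.card_product, hPr, Finset.card_univ, Fintype.card_fin] at e2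
  have e3 : X ≤ (2 + A0) * H := by rw [hX]; nlinarith
  refine (Nat.add_le_add e1 e2).trans ?_
  calc _ ≤ 3 * (D * (2 * D * D + D)) * H + 3 * r * (2 * (D + 1) * (D * (2 ^ r * ((2 + A0) * H)))) := by gcongr
    _ = _ := by ring

lemma propC (D : ℕ) : ∃ C' : ℕ, ∀ k, 2 ≤ k → k ≤ D → ∀ φ : MvPolynomial (Fin 3) ℤ,
    Irreducible (map (Int.castRingHom ℚ) φ) → φ.IsHomogeneous k →
    eval (Fin.cons 1 (fun _ => 0) : Fin 3 → ℚ) (map (Int.castRingHom ℚ) φ) ≠ 0 → ∀ H : ℕ, 1 ≤ H →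
    ∀ S : Finset (Fin 3 → ℤ),
    (∀ v ∈ S, (∀ j, |v j| ≤ H) ∧ prim v ∧ eval v φ = 0) → S.card ≤ C' * H := by
  obtain ⟨A, K, hAK⟩ : ∃ A K : ℕ → ℕ, ∀ k, _ := by
    choose A K h using height_red 3; exact ⟨A, K, h⟩
  choose c hc using fun k => propC_core D (A k) (K k)
  refine ⟨∑ k ∈ Finset.range (D + 1), (c k + k * ((2 * k * k + k) * 3)),
    fun k hk2 hkD φ hφ hk h0 H hH S hS => ?_⟩
  have hsum : c k + k * ((2 * k * k + k) * 3) ≤ ∑ k ∈ Finset.range (D + 1), (c k + k * ((2 * k * k + k) * 3)) :=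
    Finset.single_le_sum (f := fun k => c k + k * ((2 * k * k + k) * 3)) (fun _ _ => Nat.zero_le _)
      (Finset.mem_range.2 (by omega))
  refine le_trans ?_ (Nat.mul_le_mul_right H hsum)
  have hinj := RingHom.injective_int (Int.castRingHom ℚ)
  have hφ0 : φ ≠ 0 := fun h => hφ.ne_zero (by rw [h, map_zero])
  have hφd : φ.totalDegree = k := hk.totalDegree hφ0
  obtain ⟨T, hT0, hTd, hTS, hTc⟩ := hAK k φ H hH S hφ0 hφd.le (fun x hx => ⟨(hS x hx).1, (hS x hx).2.2⟩)
  have hTd' : (map (Int.castRingHom ℚ) T).totalDegree ≤ (map (Int.castRingHom ℚ) φ).totalDegree := by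
    rw [totalDegree_map_inj _ hinj, totalDegree_map_inj _ hinj]; omega
  by_cases hdvd : map (Int.castRingHom ℚ) φ ∣ map (Int.castRingHom ℚ) T
  · obtain ⟨e, he0, hTF⟩ := const_quot _ _ (int_map_ne T hT0) hTd' hdvd
    have hu : IsUnit (C e : MvPolynomial (Fin 3) ℚ) := (IsUnit.mk0 e he0).map C
    have hTh : T.IsHomogeneous k := by
      refine IsHomogeneous.of_map hinj ?_
      rw [hTF]
      have := (isHomogeneous_C (Fin 3) e).mul (hk.map (Int.castRingHom ℚ))
      rwa [zero_add] at this
    refine (hc k k hk2 hkD T (by rw [hTF, irreducible_isUnit_mul hu]; exact hφ) hTh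
      (by rw [hTF, map_mul, eval_C]; exact mul_ne_zero he0 h0) H hH hTc S
      fun v hv => ⟨(hS v hv).1, (hS v hv).2.1, hTS v hv⟩).trans (Nat.mul_le_mul_right _ (by omega))
  · have := codim2 (m := 1) _ _ hφ hdvd k (by rw [totalDegree_map_inj _ hinj]; omega)
      (by rw [totalDegree_map_inj _ hinj]; omega) ⟨k, _, h0, hom_top _ k (hk.map _)⟩ H S
      (fun y hy => ⟨(hS y hy).1, (eval_cast_zero _ _).2 (hS y hy).2.2, (eval_cast_zero _ _).2 (hTS y hy)⟩)
    rw [pow_one] at this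
    refine this.trans ?_
    calc k * ((2 * k * k + k) * (2 * H + 1)) ≤ k * ((2 * k * k + k) * (3 * H)) := by gcongr; omega
      _ = k * ((2 * k * k + k) * 3) * H := by ring
      _ ≤ _ := Nat.mul_le_mul_right _ (by omega)

end Sal


namespace Sal

/-- directional derivative -/
noncomputable def dd {R : Type*} [CommRing R] {n : ℕ} (v : Fin n → R) (f : MvPolynomial (Fin n) R) :
    MvPolynomial (Fin n) R := ∑ i, C (v i) * pderiv i f

lemma dd_mul {R : Type*} [CommRing R] {n : ℕ} (v : Fin n → R) (a b : MvPolynomial (Fin n) R) :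
    dd v (a * b) = dd v a * b + a * dd v b := by
  unfold dd
  rw [Finset.sum_mul, Finset.mul_sum, ← Finset.sum_add_distrib]
  exact Finset.sum_congr rfl fun i _ => by rw [pderiv_mul]; ring

lemma dd_X {R : Type*} [CommRing R] {n : ℕ} (v : Fin n → R) (i : Fin n) : dd v (X i) = C (v i) := by
  simp [dd, pderiv_X, Pi.single_apply]

lemma dd_onLine {R : Type*} [CommRing R] {n : ℕ} (x v : Fin n → R) (f : MvPolynomial (Fin n) R) :
    Polynomial.derivative (onLine x v f) = onLine x v (dd v f) := by
  induction f using MvPolynomial.induction_on with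
  | C a => simp [onLine, dd]
  | add a b ha hb =>
    have : dd v (a + b) = dd v a + dd v b := by simp [dd, mul_add, Finset.sum_add_distrib]
    unfold onLine at *
    simp only [map_add, ha, hb, this]
  | mul_X a i ha =>
    rw [dd_mul, dd_X]
    unfold onLine at *
    rw [map_mul, Polynomial.derivative_mul, ha]; simp

lemma dd_deg {R : Type*} [CommRing R] {n : ℕ} (v : Fin n → R) (F : MvPolynomial (Fin n) R) (d : ℕ)
    (hd : F.totalDegree ≤ d + 1) : (dd v F).totalDegree ≤ d := by
  refine totalDegree_finsetSum_le fun l _ => (totalDegree_mul _ _).trans ?_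
  rw [totalDegree_C, zero_add]
  refine Finset.sup_le fun α hα => ?_
  rw [mem_support_iff, coeff_pderiv] at hα
  have h1 := (le_totalDegree (mem_support_iff.2 (left_ne_zero_of_mul hα))).trans hd
  have h2 : (α + Finsupp.single l 1).degree = α.degree + 1 := by simp
  have h3 : (α + Finsupp.single l 1).degree ≤ d + 1 := h1
  have : α.degree ≤ d := by omega
  exact this

lemma not_dvd_deg {K : Type*} [Field K] {n : ℕ} (f g : MvPolynomial (Fin n) K) (hg : g ≠ 0)
    (h : g.totalDegree < f.totalDegree) : ¬ f ∣ g := by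
  rintro ⟨c, rfl⟩
  rw [totalDegree_mul_of_isDomain (left_ne_zero_of_mul hg) (right_ne_zero_of_mul hg)] at h
  omega

lemma homog_dvd {K : Type*} [Field K] {n k : ℕ} (f g : MvPolynomial (Fin n) K) (hf : f.IsHomogeneous k)
    (hf0 : f ≠ 0) (h : g ∣ f) : g.IsHomogeneous g.totalDegree := by
  obtain ⟨σ, hσ⟩ : ∃ σ : MvPolynomial (Fin n) K →ₐ[K] Polynomial (MvPolynomial (Fin n) K),
    σ = aeval (fun i => Polynomial.X * Polynomial.C (X i)) := ⟨_, rfl⟩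
  have hh : ∀ (j : ℕ) (p : MvPolynomial (Fin n) K), p.IsHomogeneous j →
      σ p = Polynomial.X ^ j * Polynomial.C p := fun j p hp => by
    have h1 : ∀ w : Fin n → Polynomial (MvPolynomial (Fin n) K), aeval w p =
      eval w (map (algebraMap K _) p) := fun w => by rw [eval_map, aeval_def]
    rw [hσ, h1, hom_eval_smul _ (hp.map _), ← h1]
    congr 1
    have : (aeval fun i => Polynomial.C (X i : MvPolynomial (Fin n) K)) p =
      Polynomial.CAlgHom (R := K) (aeval X p) := by
      rw [← AlgHom.comp_apply, comp_aeval]; rfl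
    rw [this, aeval_X_left_apply]; rfl
  have hc : ∀ (p : MvPolynomial (Fin n) K) (j : ℕ), (σ p).coeff j = homogeneousComponent j p := by
    intro p j
    conv_lhs => rw [← sum_homogeneousComponent p]
    rw [map_sum, Polynomial.finsetSum_coeff]
    simp only [hh _ _ (homogeneousComponent_isHomogeneous _ p), Polynomial.coeff_X_pow_mul',
      Polynomial.coeff_C]
    rw [Finset.sum_eq_single j]
    · simp
    · intro b _ hb
      split_ifs with h1 h2
      · omega
      · rfl
      · rfl
    · intro hj
      rw [if_pos le_rfl, Nat.sub_self, if_pos rfl]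
      exact homogeneousComponent_eq_zero _ _ (by simpa using hj)
  obtain ⟨q, rfl⟩ := h
  have h1 := hh k _ hf
  rw [map_mul] at h1
  have hne : σ g * σ q ≠ 0 := by rw [h1]; simpa using hf0
  have e1 := Polynomial.natDegree_mul (left_ne_zero_of_mul hne) (right_ne_zero_of_mul hne)
  have e2 := Polynomial.natTrailingDegree_mul (left_ne_zero_of_mul hne) (right_ne_zero_of_mul hne)
  have m1 := Polynomial.natTrailingDegree_le_natDegree (σ g)
  have m2 := Polynomial.natTrailingDegree_le_natDegree (σ q)
  have e3 : (σ g * σ q).natDegree = k := by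
    rw [h1, mul_comm, Polynomial.natDegree_C_mul_X_pow _ _ hf0]
  have e4 : (σ g * σ q).natTrailingDegree = k := by
    rw [h1, mul_comm, Polynomial.C_mul_X_pow_eq_monomial, Polynomial.natTrailingDegree_monomial hf0]
  have h2 : g = homogeneousComponent (σ g).natDegree g := by
    conv_lhs => rw [← sum_homogeneousComponent g]
    refine Finset.sum_eq_single_of_mem _ ?_ fun j _ hj => ?_
    · rw [Finset.mem_range]
      by_contra hcon
      have := homogeneousComponent_eq_zero (σ g).natDegree g (by omega)
      rw [← hc, Polynomial.coeff_natDegree, Polynomial.leadingCoeff_eq_zero] at this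
      exact left_ne_zero_of_mul hne this
    · rw [← hc]
      rcases lt_or_gt_of_ne hj with h | h
      · exact Polynomial.coeff_eq_zero_of_lt_natTrailingDegree (by omega)
      · exact Polynomial.coeff_eq_zero_of_natDegree_lt h
  have h3 := homogeneousComponent_isHomogeneous (σ g).natDegree g
  rw [← h2] at h3
  rwa [h3.totalDegree (left_ne_zero_of_mul hf0)]

lemma onLine_zero {n : ℕ} (F : MvPolynomial (Fin n) ℤ) (x w : Fin n → ℤ) (g : ℤ) (hg : g ≠ 0)
    (h : ∀ t : ℤ, eval (fun i => x i + t * (g * w i)) F = 0) :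
    onLine (fun i => (x i : ℚ)) (fun i => (w i : ℚ)) (map (Int.castRingHom ℚ) F) = 0 := by
  refine Polynomial.eq_zero_of_infinite_isRoot _ ((Set.infinite_range_of_injective
    (f := fun t : ℤ => ((t * g : ℤ) : ℚ)) fun a b hab => ?_).mono ?_)
  · exact mul_right_cancel₀ hg (Int.cast_injective hab)
  · rintro _ ⟨t, rfl⟩
    have := (eval_cast_zero (K := ℚ) F _).2 (h t)
    rw [Set.mem_ofPred_eq, Polynomial.IsRoot, onLine_eval, ← this]
    congr 2
    funext i; push_cast; ring

lemma kap (P : MvPolynomial (Fin 2) ℚ) (hP : P ≠ 0) (D : ℕ) (hD : P.totalDegree ≤ D) (w : Fin 2 → ℚ)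
    (K : Finset ℚ) (hK : ∀ κ ∈ K, ∃ x : Fin 2 → ℚ, w 0 * x 1 - w 1 * x 0 = κ ∧
      ∀ τ : ℚ, eval (fun i => x i + τ * w i) P = 0) (hD1 : 1 ≤ D) : K.card ≤ D := by
  by_cases hw : w 0 ^ 2 + w 1 ^ 2 = 0
  · have h0 : w 0 = 0 := by nlinarith [sq_nonneg (w 0), sq_nonneg (w 1)]
    have h1 : w 1 = 0 := by nlinarith [sq_nonneg (w 0), sq_nonneg (w 1)]
    refine (Finset.card_le_card (t := {0}) fun κ hκ => ?_).trans (by simpa using hD1)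
    obtain ⟨x, hx, _⟩ := hK κ hκ
    rw [Finset.mem_singleton, ← hx, h0, h1]; ring
  by_contra! hlt
  refine hP (MvPolynomial.funext fun y => ?_)
  obtain ⟨q, hq⟩ : ∃ q, q = onLine y ![-w 1, w 0] P := ⟨_, rfl⟩
  have h0 : q = 0 := by
    refine Polynomial.eq_zero_of_natDegree_lt_card_of_eval_eq_zero' q
      (K.image fun κ => (κ - (w 0 * y 1 - w 1 * y 0)) / (w 0 ^ 2 + w 1 ^ 2)) ?_ ?_
    · intro s hs
      obtain ⟨κ, hκ, rfl⟩ := Finset.mem_image.1 hs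
      obtain ⟨x, hx, hz⟩ := hK κ hκ
      rw [hq, onLine_eval, ← hz ((w 0 * (y 0 - x 0) + w 1 * (y 1 - x 1)) / (w 0 ^ 2 + w 1 ^ 2)), ← hx]
      congr 2
      funext i
      fin_cases i <;> simp <;> field_simp <;> ring
    · rw [Finset.card_image_of_injective]
      · rw [hq]; exact (onLine_deg _ _ _).trans_lt (hD.trans_lt hlt)
      · intro a b hab
        simpa [div_left_inj' hw] using hab
  have := onLine_eval y ![-w 1, w 0] P 0
  rw [← hq, h0] at this
  simpa using this.symm

lemma lines_card (F G : MvPolynomial (Fin 3) ℚ) (hF : Irreducible F) (hG : ¬ F ∣ G) (d : ℕ)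
    (hd1 : 1 ≤ d) (hFd : F.totalDegree ≤ d) (hGd : G.totalDegree ≤ d) (w : Fin 3 → ℤ) (hw : prim w) (N j : ℕ)
    (a : Fin 3) (ha : 2 ^ j ≤ |w a|) (ha2 : |w a| ≤ 2 * N) (S : Finset (Fin 3 → ℤ))
    (hS : ∀ x ∈ S, (∀ i, |x i| ≤ N) ∧ ∀ τ : ℚ, eval (fun i => (x i : ℚ) + τ * w i) F = 0 ∧
      eval (fun i => (x i : ℚ) + τ * w i) G = 0) :
    S.card * 2 ^ j ≤ (2 * d * d + d) ^ 3 * (6 * N) := by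
  classical
  obtain ⟨κ, hκ⟩ : ∃ κ : (Fin 3 → ℤ) → Fin 3 → ℤ, κ = fun x b => w (b.succAbove 0) * x (b.succAbove 1) -
    w (b.succAbove 1) * x (b.succAbove 0) := ⟨_, rfl⟩
  have h1 : ∀ b, (S.image fun x => κ x b).card ≤ 2 * d * d + d := fun b => by
    obtain ⟨P, hP0, hPd, hP⟩ := elim b F G hF hG d hFd hGd
    rw [← Finset.card_image_of_injective _ (Int.cast_injective (α := ℚ)), Finset.image_image]
    refine kap P hP0 _ hPd (fun i => (w (b.succAbove i) : ℚ)) _ (fun k hk => ?_) (Nat.le_add_left_of_le hd1)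
    obtain ⟨x, hx, rfl⟩ := Finset.mem_image.1 hk
    refine ⟨fun i => (x (b.succAbove i) : ℚ), by simp only [Function.comp, hκ]; push_cast; rfl, fun τ => ?_⟩
    exact hP (fun i => (x i : ℚ) + τ * w i) ((hS x hx).2 τ).1 ((hS x hx).2 τ).2
  have h2 : (S.image κ).card ≤ (2 * d * d + d) ^ 3 := by
    refine (Finset.card_le_card (t := Fintype.piFinset fun b => S.image fun x => κ x b) ?_).trans ?_
    · intro k hk
      obtain ⟨x, hx, rfl⟩ := Finset.mem_image.1 hk
      exact Fintype.mem_piFinset.2 fun b => Finset.mem_image_of_mem (fun x => κ x b) hx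
    · rw [Fintype.card_piFinset]
      exact (Finset.prod_le_prod' fun b _ => h1 b).trans (by simp)
  obtain ⟨c, hc⟩ := hw
  have h3 : ∀ k ∈ S.image κ, (S.filter fun x => κ x = k).card ≤ 2 * (2 * N / 2 ^ j) + 1 := fun k hk => by
    obtain ⟨x0, hx0, rfl⟩ := Finset.mem_image.1 hk
    have h4 : ∀ x ∈ S.filter (fun x => κ x = κ x0), ∀ i, x i - x0 i = (∑ l, c l * (x l - x0 l)) * w i := by
      intro x hx i
      have h5 := fun b => congrFun (Finset.mem_filter.1 hx).2 b
      rw [hκ] at h5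
      have e0 := h5 0
      have e1 := h5 1
      have e2 := h5 2
      simp only [Fin.sum_univ_three, Fin.succAbove, Fin.lt_def] at hc e0 e1 e2 ⊢
      norm_num at e0 e1 e2
      fin_cases i <;> simp
      · linear_combination (-(x 0 - x0 0)) * hc - c 1 * e2 - c 2 * e1
      · linear_combination (-(x 1 - x0 1)) * hc + c 0 * e2 - c 2 * e0
      · linear_combination (-(x 2 - x0 2)) * hc + c 0 * e1 + c 1 * e0
    have h6 : ((2 * N / 2 ^ j : ℕ) : ℤ) = 2 * N / 2 ^ j := by push_cast; rfl
    calc _ ≤ (Finset.Icc (-((2 * N / 2 ^ j : ℕ) : ℤ)) ((2 * N / 2 ^ j : ℕ) : ℤ)).card := by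
          refine Finset.card_le_card_of_injOn (fun x => ∑ l, c l * (x l - x0 l)) ?_ ?_
          · intro x hx
            have e := h4 x hx a
            have b1 := abs_le.1 ((hS x (Finset.mem_filter.1 hx).1).1 a)
            have b2 := abs_le.1 ((hS x0 hx0).1 a)
            have b3 : |x a - x0 a| ≤ 2 * N := abs_le.2 ⟨by linarith, by linarith⟩
            rw [e, abs_mul] at b3
            simp only [Finset.coe_Icc, Set.mem_Icc]
            rw [← abs_le, h6, Int.le_ediv_iff_mul_le (by positivity)]
            exact (mul_le_mul_of_nonneg_left ha (abs_nonneg _)).trans b3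
          · intro x hx y hy hxy
            funext i
            have e1 := h4 x hx i
            have e2 := h4 y hy i
            beta_reduce at hxy
            rw [hxy, ← e2] at e1
            linarith
      _ ≤ _ := by rw [Int.card_Icc]; omega
  have h4 := Finset.card_le_mul_card_image_of_maps_to (s := S) (t := S.image κ) (f := κ)
    (fun x hx => Finset.mem_image_of_mem _ hx) _ h3
  have h5 : (2 ^ j : ℤ) ≤ 2 * N := ha.trans ha2
  have h6 : 2 ^ j ≤ 2 * N := by exact_mod_cast h5
  have h7 := Nat.div_mul_le_self (2 * N) (2 ^ j)
  calc S.card * 2 ^ j ≤ ((2 * (2 * N / 2 ^ j) + 1) * (2 * d * d + d) ^ 3) * 2 ^ j := by gcongr; exact h4.trans (by gcongr)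
    _ = (2 * d * d + d) ^ 3 * (2 * (2 * N / 2 ^ j * 2 ^ j) + 2 ^ j) := by ring
    _ ≤ _ := by gcongr; omega

end Sal


namespace Sal

lemma dirs (d : ℕ) : ∃ C' : ℕ, ∀ Φ : MvPolynomial (Fin 3) ℚ, Φ.IsHomogeneous d →
    eval (Fin.cons 1 (fun _ => 0) : Fin 3 → ℚ) Φ ≠ 0 → ∀ H : ℕ, 1 ≤ H → ∀ S : Finset (Fin 3 → ℤ),
    (∀ v ∈ S, (∀ j, |v j| ≤ H) ∧ prim v ∧ ∃ h, Irreducible h ∧ h ∣ Φ ∧ 2 ≤ h.totalDegree ∧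
      eval (fun i => (v i : ℚ)) h = 0) → S.card ≤ C' * H := by
  classical
  obtain ⟨C0, hC0⟩ := propC d
  refine ⟨d * C0, fun Φ hΦ h0 H hH S hS => ?_⟩
  have hΦ0 : Φ ≠ 0 := by rintro rfl; simp at h0
  obtain ⟨I, hI1, hI2, hI3, -⟩ := facs Φ hΦ0
  rw [hΦ.totalDegree hΦ0] at hI1 hI2
  have hsub : S ⊆ (I.filter fun h => 2 ≤ h.totalDegree).biUnion fun h =>
      S.filter fun v => eval (fun i => (v i : ℚ)) h = 0 := fun v hv => by
    obtain ⟨h, h1, h2, h3, h4⟩ := (hS v hv).2.2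
    obtain ⟨h', h5, h6⟩ := hI3 h h1 h2
    have h7 : h'.totalDegree = h.totalDegree := deg_assoc _ _ h6 h1.ne_zero
    exact Finset.mem_biUnion.2 ⟨h', Finset.mem_filter.2 ⟨h5, by omega⟩, Finset.mem_filter.2 ⟨hv,
      zero_dvd_iff.1 (h4 ▸ map_dvd (eval fun i => (v i : ℚ)) h6.dvd)⟩⟩
  calc S.card ≤ _ := Finset.card_le_card hsub
    _ ≤ (I.filter fun h => 2 ≤ h.totalDegree).card * (C0 * H) := by
        refine Finset.card_biUnion_le_card_mul _ _ _ fun h hh => ?_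
        obtain ⟨hhI, hh2⟩ := Finset.mem_filter.1 hh
        obtain ⟨hirr, hdvd, hdeg⟩ := hI2 h hhI
        obtain ⟨G, c, hc, hG⟩ := clear_den h
        have hu : IsUnit (C (c : ℚ) : MvPolynomial (Fin 3) ℚ) := by
          exact (isUnit_iff_ne_zero.2 (by exact_mod_cast hc : (c : ℚ) ≠ 0)).map C
        have hhom := homog_dvd Φ h hΦ hΦ0 hdvd
        refine hC0 _ hh2 hdeg G ?_ ?_ ?_ H hH _ fun v hv => ?_
        · rw [hG, irreducible_isUnit_mul hu]; exact hirr
        · refine IsHomogeneous.of_map (f := Int.castRingHom ℚ) Int.cast_injective ?_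
          rw [hG]; simpa using (isHomogeneous_C (Fin 3) (c : ℚ)).mul hhom
        · rw [hG, map_mul, eval_C]
          refine mul_ne_zero (by exact_mod_cast hc) fun h => h0 ?_
          have := map_dvd (eval (Fin.cons 1 (fun _ => 0) : Fin 3 → ℚ)) hdvd
          rw [h] at this; exact zero_dvd_iff.1 this
        · obtain ⟨hv1, hv2⟩ := Finset.mem_filter.1 hv
          refine ⟨(hS v hv1).1, (hS v hv1).2.1, (eval_cast_zero (K := ℚ) G v).1 ?_⟩
          rw [hG, map_mul, hv2, mul_zero]
    _ ≤ d * (C0 * H) := by gcongr; exact (Finset.card_filter_le _ _).trans hI1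
    _ = _ := by ring

/-- points on a "bad" line of the surface -/
def bad (F : MvPolynomial (Fin 3) ℚ) (x : Fin 3 → ℤ) : Prop :=
  ∃ v : Fin 3 → ℚ, v ≠ 0 ∧ onLine (fun i => (x i : ℚ)) v F = 0 ∧ (dd v F = 0 ∨
    ∃ l, Irreducible l ∧ l.totalDegree ≤ 1 ∧ l ∣ homogeneousComponent F.totalDegree F ∧ eval v l = 0)

lemma thm3_lines (d : ℕ) (hd : 4 ≤ d) : ∃ C' : ℕ, ∀ N : ℕ, 1 ≤ N →
    ∀ F : MvPolynomial (Fin 3) ℤ, F.totalDegree = d → Irreducible (map (Int.castRingHom ℚ) F) →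
    (∃ c : ℚ, c ≠ 0 ∧ (uni 0 (map (Int.castRingHom ℚ) F)).coeff d = C c) →
    ∀ S : Finset (Fin 3 → ℤ), (∀ x ∈ S, (∀ i, |x i| ≤ N) ∧ eval x F = 0 ∧ ¬ star N F x ∧
      ¬ bad (map (Int.castRingHom ℚ) F) x) → S.card ≤ C' * N * (Nat.log 2 (2 * N) + 1) := by
  classical
  obtain ⟨C0, hC0⟩ := dirs d
  refine ⟨C0 * (2 * ((2 * d * d + d) ^ 3 * 6)), fun N hN F hFd hF ⟨c, hc0, hc⟩ S hS => ?_⟩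
  obtain ⟨Fq, hFq⟩ : ∃ Fq, Fq = map (Int.castRingHom ℚ) F := ⟨_, rfl⟩
  have hdq : Fq.totalDegree = d := by rw [hFq, totalDegree_map_inj _ Int.cast_injective, hFd]
  rw [← hFq] at hF hc
  rw [uni_top Fq d hdq.le] at hc
  have h0 : eval (Fin.cons 1 (fun _ => 0) : Fin 3 → ℚ) (homogeneousComponent d Fq) ≠ 0 := by
    rw [C_injective _ _ hc]; exact hc0
  have hΦ0 : homogeneousComponent d Fq ≠ 0 := by intro h; simp [h] at h0
  have hw : ∀ x ∈ S, ∃ w : Fin 3 → ℤ, prim w ∧ (∀ i, |w i| ≤ 2 * N) ∧ dd (fun i => (w i : ℚ)) Fq ≠ 0 ∧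
      onLine (fun i => (x i : ℚ)) (fun i => (w i : ℚ)) Fq = 0 ∧
      ∃ h, Irreducible h ∧ h ∣ homogeneousComponent d Fq ∧ 2 ≤ h.totalDegree ∧
        eval (fun i => (w i : ℚ)) h = 0 := by
    intro x hx
    obtain ⟨h1, h2, h3, h4⟩ := hS x hx
    have h5 : ∃ v : Fin 3 → ℤ, v ≠ 0 ∧ (∀ i, |v i| ≤ 2 * N) ∧ ∀ t : ℤ, eval (fun i => x i + t * v i) F = 0 := by
      by_contra hcon; exact h3 ⟨h2, hcon, h1⟩
    obtain ⟨v, hv0, hvN, hv⟩ := h5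
    obtain ⟨g, w, hg, hwp, hvw⟩ := exists_prim v hv0
    have hl := onLine_zero F x w g hg fun t => by simpa only [hvw] using hv t
    rw [← hFq] at hl h4
    have hw0 : (fun i => (w i : ℚ)) ≠ 0 := by
      intro h
      refine hv0 (funext fun i => ?_)
      have : (w i : ℚ) = 0 := congrFun h i
      rw [hvw, Int.cast_eq_zero.1 this]; simp
    have hz : eval (fun i => (w i : ℚ)) (homogeneousComponent d Fq) = 0 := by
      rw [← onLine_coeff (fun i => (x i : ℚ)) _ Fq d hdq.le, hl, Polynomial.coeff_zero]
    obtain ⟨I, -, hI2, -, hI4⟩ := facs _ hΦ0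
    obtain ⟨h, hhI, hh⟩ := hI4 _ hz
    refine ⟨w, hwp, fun i => ?_, fun h => h4 ⟨_, hw0, hl, Or.inl h⟩, hl, h, (hI2 h hhI).1,
      (hI2 h hhI).2.1, ?_, hh⟩
    · refine le_trans ?_ (hvN i)
      rw [hvw, abs_mul]
      exact le_mul_of_one_le_left (abs_nonneg _) (Int.one_le_abs hg)
    · by_contra hlt
      exact h4 ⟨_, hw0, hl, Or.inr ⟨h, (hI2 h hhI).1, by omega, hdq.symm ▸ (hI2 h hhI).2.1, hh⟩⟩
  choose! w hwp hwN hwd hwl hwh using hw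
  have ha : ∀ x ∈ S, ∃ a, ∀ i, |w x i| ≤ |w x a| := fun x _ => Finite.exists_max fun i => |w x i|
  choose! a ha using ha
  have ha0 : ∀ x ∈ S, (w x (a x)).natAbs ≠ 0 := fun x hx h => by
    obtain ⟨e, he⟩ := hwp x hx
    have h1 : ∀ i, w x i = 0 := fun i => by
      have h2 := ha x hx i
      rw [Int.natAbs_eq_zero.1 h, abs_zero] at h2
      exact abs_nonpos_iff.1 h2
    simp [h1] at he
  have haN : ∀ x ∈ S, (w x (a x)).natAbs ≤ 2 * N := fun x hx => by
    have := hwN x hx (a x); rw [Int.abs_eq_natAbs] at this; exact_mod_cast this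
  have key : ∀ j ∈ Finset.range (Nat.log 2 (2 * N) + 1),
      (S.filter fun x => Nat.log 2 (w x (a x)).natAbs = j).card ≤
        C0 * (2 * ((2 * d * d + d) ^ 3 * 6)) * N := by
    intro j _
    obtain ⟨T, hT⟩ : ∃ T, T = S.filter fun x => Nat.log 2 (w x (a x)).natAbs = j := ⟨_, rfl⟩
    rw [← hT]
    have hTS : ∀ x ∈ T, x ∈ S ∧ 2 ^ j ≤ (w x (a x)).natAbs ∧ (w x (a x)).natAbs < 2 ^ (j + 1) := fun x hx => by
      rw [hT, Finset.mem_filter] at hx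
      exact ⟨hx.1, hx.2 ▸ Nat.pow_log_le_self 2 (ha0 x hx.1), hx.2 ▸ Nat.lt_pow_succ_log_self (by norm_num) _⟩
    have hW : (T.image w).card ≤ C0 * 2 ^ (j + 1) := by
      refine hC0 _ (homogeneousComponent_isHomogeneous d Fq) h0 _ Nat.one_le_two_pow _ fun v hv => ?_
      obtain ⟨x, hx, rfl⟩ := Finset.mem_image.1 hv
      obtain ⟨hxS, -, h2⟩ := hTS x hx
      refine ⟨fun i => (ha x hxS i).trans ?_, hwp x hxS, hwh x hxS⟩
      rw [Int.abs_eq_natAbs]; exact_mod_cast h2.le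
    have hf : ∀ v ∈ T.image w, (T.filter fun x => w x = v).card ≤ ((2 * d * d + d) ^ 3 * (6 * N)) / 2 ^ j := by
      intro v hv
      obtain ⟨x, hx, rfl⟩ := Finset.mem_image.1 hv
      obtain ⟨hxS, h1, -⟩ := hTS x hx
      rw [Nat.le_div_iff_mul_le (by positivity)]
      refine lines_card Fq (dd (fun i => (w x i : ℚ)) Fq) hF (not_dvd_deg _ _ (hwd x hxS) ?_) d (by omega) hdq.le
        ?_ (w x) (hwp x hxS) N j (a x) ?_ (hwN x hxS _) _ fun y hy => ?_
      · have := dd_deg (fun i => (w x i : ℚ)) Fq (d - 1) (by omega); omega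
      · have := dd_deg (fun i => (w x i : ℚ)) Fq (d - 1) (by omega); omega
      · rw [Int.abs_eq_natAbs]; exact_mod_cast h1
      · obtain ⟨hy, hyw⟩ := Finset.mem_filter.1 hy
        have hyS := (hTS y hy).1
        refine ⟨(hS y hyS).1, fun τ => ?_⟩
        have h2 := hwl y hyS
        rw [hyw] at h2
        rw [← onLine_eval (fun i => (y i : ℚ)) (fun i => (w x i : ℚ)),
          ← onLine_eval (fun i => (y i : ℚ)) (fun i => (w x i : ℚ)), ← dd_onLine, h2]
        simp
    have h4 := Finset.card_le_mul_card_image_of_maps_to (s := T) (t := T.image w) (f := w)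
      (fun x hx => Finset.mem_image_of_mem _ hx) _ hf
    calc T.card ≤ _ := h4
      _ ≤ ((2 * d * d + d) ^ 3 * (6 * N)) / 2 ^ j * (C0 * 2 ^ (j + 1)) := by gcongr
      _ = C0 * 2 * (((2 * d * d + d) ^ 3 * (6 * N)) / 2 ^ j * 2 ^ j) := by ring
      _ ≤ C0 * 2 * ((2 * d * d + d) ^ 3 * (6 * N)) := Nat.mul_le_mul_left _ (Nat.div_mul_le_self _ _)
      _ = _ := by ring
  refine (Finset.card_le_mul_card_image_of_maps_to
    (f := fun x => Nat.log 2 (w x (a x)).natAbs) (fun x hx => ?_) _ key).trans (by rw [Finset.card_range])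
  rw [Finset.mem_range, Nat.lt_succ_iff]
  exact Nat.log_mono_right (haN x hx)

theorem thm3 (d : ℕ) (hd : 4 ≤ d) (ε : ℝ) (hε : 0 < ε) : ∃ C' : ℝ, 0 ≤ C' ∧ ∀ N : ℕ, 1 ≤ N →
    ∀ F : MvPolynomial (Fin 3) ℤ, F.totalDegree = d → Irreducible (map (Int.castRingHom ℚ) F) →
    (∃ c : ℚ, c ≠ 0 ∧ (uni 0 (map (Int.castRingHom ℚ) F)).coeff d = C c) →
    ∀ S : Finset (Fin 3 → ℤ), (∀ x ∈ S, (∀ i, |x i| ≤ N) ∧ eval x F = 0 ∧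
      ¬ bad (map (Int.castRingHom ℚ) F) x) → (S.card : ℝ) ≤ C' * (N : ℝ) ^ (1 + ε) := by
  classical
  obtain ⟨C1, hC1, H1⟩ := propA d hd ε hε
  obtain ⟨C2, H2⟩ := thm3_lines d hd
  refine ⟨C1 + C2 * (1 / (ε * Real.log 2) + 2), by positivity, fun N hN F hFd hF hc S hS => ?_⟩
  have e1 := H1 N hN F hFd hF hc (S.filter fun x => star N F x) fun x hx =>
    ⟨(hS x (Finset.mem_filter.1 hx).1).1, (Finset.mem_filter.1 hx).2⟩
  have e2 := H2 N hN F hFd hF hc (S.filter fun x => ¬ star N F x) fun x hx => by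
    obtain ⟨h1, h2⟩ := Finset.mem_filter.1 hx
    exact ⟨(hS x h1).1, (hS x h1).2.1, h2, (hS x h1).2.2⟩
  have e3 := Finset.card_filter_add_card_filter_not (s := S) (fun x => star N F x)
  have hNp : (0 : ℝ) < N := by exact_mod_cast hN
  have hN1 : (1 : ℝ) ≤ (N : ℝ) ^ ε := Real.one_le_rpow (by exact_mod_cast hN) hε.le
  have hl : 0 < Real.log 2 := Real.log_pos (by norm_num)
  have e4 : ((Nat.log 2 (2 * N) + 1 : ℕ) : ℝ) ≤ (1 / (ε * Real.log 2) + 2) * (N : ℝ) ^ ε := by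
    rw [mul_comm 2 N, Nat.log_mul_base (by norm_num) (by omega)]
    have h1 : (Nat.log 2 N : ℝ) * Real.log 2 ≤ Real.log N := by
      rw [← Real.log_pow]
      exact Real.log_le_log (by positivity) (by exact_mod_cast Nat.pow_log_le_self 2 (by omega))
    have h2 := Real.log_le_rpow_div hNp.le hε
    have h3 : (Nat.log 2 N : ℝ) ≤ 1 / (ε * Real.log 2) * (N : ℝ) ^ ε := by
      rw [← le_div_iff₀ hl] at h1
      refine h1.trans (((div_le_div_iff_of_pos_right hl).2 h2).trans (le_of_eq ?_))
      field_simp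
    push_cast
    linarith
  rw [← e3]
  push_cast
  calc _ ≤ C1 * (N : ℝ) ^ (1 + ε) + (C2 * N) * ((1 / (ε * Real.log 2) + 2) * (N : ℝ) ^ ε) := by
        refine add_le_add e1 ((?_ : _ ≤ ((C2 * N * (Nat.log 2 (2 * N) + 1) : ℕ) : ℝ)).trans ?_)
        · exact_mod_cast e2
        · push_cast at e4 ⊢; gcongr
    _ = _ := by rw [Real.rpow_add hNp, Real.rpow_one]; ring

end Sal

namespace Sal

/-- first basis vector -/
def e0 {K : Type*} [Field K] {m : ℕ} : Fin (m + 1) → K := Fin.cons 1 fun _ => 0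

/-- `f` has degree at most `d` and nonzero coefficient of `X 0 ^ d` -/
def mon {K : Type*} [Field K] {m : ℕ} (f : MvPolynomial (Fin (m + 1)) K) (d : ℕ) : Prop :=
  f.totalDegree ≤ d ∧ ∀ x, (onLine x e0 f).coeff d ≠ 0

section
variable {K : Type*} [Field K] {m : ℕ}

lemma mon_root [IsAlgClosed K] {f : MvPolynomial (Fin (m + 1)) K} {d : ℕ} (hf : mon f d)
    (hd : d ≠ 0) (u : Fin m → K) : ∃ t, eval (Fin.cons t u : Fin (m + 1) → K) f = 0 := by
  obtain ⟨t, ht⟩ := IsAlgClosed.exists_root (onLine (Fin.cons 0 u : Fin (m + 1) → K) e0 f) (by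
    intro h
    have := Polynomial.le_degree_of_ne_zero (hf.2 (Fin.cons 0 u))
    rw [h] at this
    exact hd (by exact_mod_cast Nat.le_zero.1 (by exact_mod_cast this)))
  refine ⟨t, ?_⟩
  rw [Polynomial.IsRoot, onLine_eval] at ht
  rw [← ht]; congr 2
  funext i
  refine Fin.cases ?_ (fun i => ?_) i <;> simp [e0]

lemma mon_ne {f : MvPolynomial (Fin (m + 1)) K} {d : ℕ} (hf : mon f d) : f ≠ 0 := by
  rintro rfl
  exact hf.2 0 (by simp [onLine])

lemma mon_deg {f : MvPolynomial (Fin (m + 1)) K} {d : ℕ} (hf : mon f d) : f.totalDegree = d :=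
  le_antisymm hf.1 (((Polynomial.le_natDegree_of_ne_zero (hf.2 0)).trans (onLine_deg _ _ _)))

lemma mon_mul {g h : MvPolynomial (Fin (m + 1)) K} {d : ℕ} (hf : mon (g * h) d) :
    mon g g.totalDegree := by
  have h0 := mon_ne hf
  have hd := mon_deg hf
  rw [totalDegree_mul_of_isDomain (left_ne_zero_of_mul h0) (right_ne_zero_of_mul h0)] at hd
  refine ⟨le_rfl, fun x hx => hf.2 x ?_⟩
  have : onLine x e0 (g * h) = onLine x e0 g * onLine x e0 h := by simp [onLine]
  rw [this, ← hd, Polynomial.coeff_mul_add_eq_of_natDegree_le (onLine_deg _ _ _) (onLine_deg _ _ _),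
    hx, zero_mul]

lemma mon_uni {f : MvPolynomial (Fin (m + 1)) K} {d : ℕ} [CharZero K] (hf : mon f d) :
    ∃ c, c ≠ 0 ∧ (uni 0 f).coeff d = C c := by
  refine ⟨_, ?_, uni_top f d hf.1⟩
  have := hf.2 0
  rwa [onLine_coeff _ _ _ _ hf.1] at this

lemma mon_natDeg {f : MvPolynomial (Fin (m + 1)) K} {d : ℕ} [CharZero K] (hf : mon f d) :
    (uni 0 f).natDegree = d := by
  obtain ⟨c, hc, h⟩ := mon_uni hf
  exact le_antisymm ((uni_natDegree_le 0 f).trans hf.1) (natDegree_of_monic f d c hc h)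

lemma onLine_aeval {R : Type*} [CommRing R] {n k : ℕ} (x v : Fin k → R)
    (θ : Fin n → MvPolynomial (Fin k) R) (f : MvPolynomial (Fin n) R) :
    onLine x v (aeval θ f) = aeval (fun i => onLine x v (θ i)) f := by
  induction f using MvPolynomial.induction_on with
  | C r => simp [onLine]
  | add p q hp hq => simp only [map_add, ← hp, ← hq]; simp [onLine]
  | mul_X p i hp => rw [map_mul, map_mul, ← hp, aeval_X, aeval_X]; simp [onLine]

/-- derivation killing `f` -/
noncomputable def DD {σ : Type*} (f : MvPolynomial σ K) (b : σ → MvPolynomial σ K) (z : σ) :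
    Derivation K (MvPolynomial σ K) (MvPolynomial σ K) :=
  pderiv z f • mkDerivation K b - (mkDerivation K b f) • pderiv z

lemma DD_apply {σ : Type*} (f h : MvPolynomial σ K) (b : σ → MvPolynomial σ K) (z : σ) :
    DD f b z h = pderiv z f * mkDerivation K b h - mkDerivation K b f * pderiv z h := by
  simp [DD]

lemma DD_dvd {σ : Type*} (g h q : MvPolynomial σ K) (b : σ → MvPolynomial σ K) (z : σ) (j : ℕ)
    (hq : g ∣ q) : g ∣ (DD (g * h) b z)^[j] q := by
  induction j with
  | zero => exact hq
  | succ j ih =>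
    rw [Function.iterate_succ_apply']
    obtain ⟨k, hk⟩ := ih
    rw [hk, DD_apply]
    simp only [Derivation.leibniz, smul_eq_mul]
    exact ⟨h * mkDerivation K b g * 0 + pderiv z g * h * mkDerivation K b k +
      pderiv z h * (g * mkDerivation K b k + k * mkDerivation K b g)
      - (mkDerivation K b g * h * pderiv z k +
      mkDerivation K b h * (g * pderiv z k + k * pderiv z g)), by ring⟩

lemma der_map {σ τ : Type*} (ψ : MvPolynomial σ K →ₐ[K] MvPolynomial τ K)
    (E : Derivation K (MvPolynomial σ K) (MvPolynomial σ K))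
    (E' : Derivation K (MvPolynomial τ K) (MvPolynomial τ K))
    (h : ∀ i, ψ (E (X i)) = E' (ψ (X i))) (q : MvPolynomial σ K) : ψ (E q) = E' (ψ q) := by
  induction q using MvPolynomial.induction_on with
  | C r =>
    rw [derivation_C, map_zero, ← algebraMap_eq, AlgHom.commutes, Derivation.map_algebraMap]
  | add p q hp hq => simp only [map_add, hp, hq]
  | mul_X p i hp => simp only [map_mul, Derivation.leibniz, smul_eq_mul, map_add, hp, h]

lemma iter_add {A : Type*} [CommRing A] [Algebra K A] (D : Derivation K A A) (n : ℕ) (a b : A) :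
    D^[n] (a + b) = D^[n] a + D^[n] b := by
  induction n generalizing a b with
  | zero => rfl
  | succ n ih => simp only [Function.iterate_succ_apply, map_add, ih]

lemma iter_sum {A : Type*} [CommRing A] [Algebra K A] (D : Derivation K A A) (n : ℕ) {ι : Type*}
    (s : Finset ι) (c : ι → K) (a : ι → A) :
    D^[n] (∑ i ∈ s, c i • a i) = ∑ i ∈ s, c i • D^[n] (a i) := by
  induction n generalizing a with
  | zero => rfl
  | succ n ih => simp only [Function.iterate_succ_apply, map_sum, Derivation.map_smul, ih]

lemma lead {A : Type*} [CommRing A] [Algebra K A] (D : Derivation K A A) (ev : A →+* K) (n : ℕ)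
    (u q : A) (h : ∀ i < n, ev (D^[i] q) = 0) :
    ev (D^[n] (u * q)) = ev u * ev (D^[n] q) := by
  induction n generalizing u q with
  | zero => simp
  | succ n ih =>
    rw [Function.iterate_succ_apply, Derivation.leibniz, smul_eq_mul, smul_eq_mul, iter_add,
      map_add, ih u (D q) (fun i hi => h (i + 1) (by omega)), mul_comm q,
      ih (D u) q (fun i hi => h i (by omega)), h n (by omega), mul_zero, add_zero,
      Function.iterate_succ_apply]

lemma mk01 : mkDerivation K (![0, 1] : Fin 2 → MvPolynomial (Fin 2) K) = pderiv 1 := by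
  refine derivation_ext fun i => ?_
  rw [mkDerivation_X]
  fin_cases i <;> simp [pderiv_X]

lemma pl_B [CharZero K] (g : MvPolynomial (Fin 2) K) (p : Fin 2 → K) (hz : eval p (pderiv 0 g) ≠ 0)
    (N : ℕ) (P : MvPolynomial (Fin (0 + 1)) K) (hP : P.totalDegree ≤ N)
    (h : ∀ j ≤ N, eval p ((DD g ![0, 1] 0)^[j] (rename (0 : Fin 2).succAbove P)) = 0) :
    P = 0 := by
  obtain ⟨ι, hι⟩ : ∃ ι : MvPolynomial (Fin (0 + 1)) K →ₐ[K] MvPolynomial (Fin 2) K,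
    ι = rename (0 : Fin 2).succAbove := ⟨_, rfl⟩
  have hD : ∀ P, DD g ![0, 1] 0 (ι P) = pderiv 0 g * ι (pderiv 0 P) := by
    intro P
    rw [DD_apply]
    have h1 : ∀ P, ι (pderiv 0 P) = pderiv 1 (ι P) := fun P => by
      refine der_map ι _ _ (fun i => ?_) P
      obtain rfl : i = 0 := by omega
      simp [hι]
    have h2 : ∀ P, ι ((0 : Derivation K _ _) P) = pderiv 0 (ι P) := fun P => by
      refine der_map ι _ _ (fun i => ?_) P
      obtain rfl : i = 0 := by omega
      simp [hι, pderiv_X]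
    have h3 := h2 P
    rw [← h3, h1, mk01]; simp
  have key : ∀ P : MvPolynomial (Fin (0 + 1)) K, pderiv 0 P = 0 → eval p (ι P) = 0 → P = 0 := by
    intro P h0 h1
    have h2 : (uni 0 P).natDegree = 0 := by
      apply Polynomial.derivative_eq_zero.1
      rw [← uni_pderiv, h0, map_zero]
    have h4 : P = C (coeff 0 ((uni 0 P).coeff 0)) := by
      apply (uni 0).injective
      rw [uni_C, ← eq_C_of_isEmpty, ← Polynomial.eq_C_of_natDegree_eq_zero h2]
    rw [h4] at h1 ⊢
    rw [hι, rename_C, eval_C] at h1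
    rw [h1, C_0]
  rw [← hι] at h
  induction N generalizing P with
  | zero =>
    refine key P ?_ (h 0 le_rfl)
    rw [totalDegree_eq_zero_iff_eq_C.1 (Nat.le_zero.1 hP), pderiv_C]
  | succ N ih =>
    refine key P (ih _ (by simpa [dd] using dd_deg (fun _ => 1) P N hP) ?_) (h 0 (by omega))
    · intro j hj
      induction j using Nat.strong_induction_on with
      | _ j ihj =>
      have := h (j + 1) (by omega)
      rw [Function.iterate_succ_apply, hD, lead _ (eval p) j _ _ (fun i hi => ihj i hi (by omega))] at this
      exact (mul_eq_zero.1 this).resolve_left hz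

end
end Sal

namespace Sal
section
variable {K : Type*} [Field K] {m : ℕ}

lemma pl_main [CharZero K] [IsAlgClosed K] (g q : MvPolynomial (Fin 2) K) (p : Fin 2 → K) (d D : ℕ)
    (hm : mon g d) (hp : eval p g = 0) (hz : eval p (pderiv 0 g) ≠ 0)
    (hg : g.totalDegree ≤ D) (hq : q.totalDegree ≤ D)
    (h : ∀ j ≤ 2 * D * D + D, eval p ((DD g ![0, 1] 0)^[j] q) = 0) (x : K) :
    ∃ z, eval ![z, x] g = 0 ∧ eval ![z, x] q = 0 := by
  obtain ⟨I, -, hI, -, hI2⟩ := facs g (mon_ne hm)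
  obtain ⟨t, ht, htp⟩ := hI2 p hp
  obtain ⟨hti, ⟨k, rfl⟩, htd⟩ := hI t ht
  by_cases hd : t ∣ q
  · obtain ⟨z, h0⟩ := mon_root (mon_mul hm) (by have := irr_deg t hti; omega) fun _ => x
    have h0 : eval ![z, x] t = 0 := by
      rw [← h0]; congr 2; funext i; fin_cases i <;> rfl
    refine ⟨z, by rw [map_mul, h0, zero_mul], ?_⟩
    obtain ⟨s, rfl⟩ := hd
    rw [map_mul, h0, zero_mul]
  · exfalso
    obtain ⟨P, hP0, hPd, u, v, e⟩ := elim' (0 : Fin 2) t q hti hd D (htd.trans hg) hq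
    refine hP0 (pl_B (t * k) p hz _ P hPd fun j hj => ?_)
    rw [e, iter_add, map_add, lead _ (eval p) j _ _ (fun i hi => h i (by omega)), h j hj, mul_zero,
      add_zero]
    obtain ⟨w, hw⟩ := DD_dvd t k (u * t) ![0, 1] 0 j ⟨u, mul_comm _ _⟩
    rw [hw, map_mul, htp, zero_mul]

/-- monomials `X 1 ^ (c / d) * X 0 ^ (c % d)` -/
noncomputable def col {σ : Type*} (x z : σ) (d : ℕ) (c : Fin ((d + 1) * d)) : MvPolynomial σ K :=
  X x ^ ((c : ℕ) / d) * X z ^ ((c : ℕ) % d)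

lemma col_span (d : ℕ) (G : MvPolynomial (Fin 2) K) (h0 : degreeOf 0 G < d)
    (h1 : G.totalDegree ≤ d) : ∃ γ : Fin ((d + 1) * d) → K, G = ∑ c, γ c • col 1 0 d c := by
  have : G ∈ Submodule.span K (Set.range (col (K := K) (1 : Fin 2) 0 d)) := by
    rw [G.as_sum]
    refine Submodule.sum_mem _ fun s hs => ?_
    have h2 := monomial_le_degreeOf 0 hs
    have h3 := (monomial_le_degreeOf 1 hs).trans (degreeOf_le_totalDegree G 1)
    have h4 : s 0 + d * s 1 < (d + 1) * d := by
      have := Nat.mul_le_mul_left d (h3.trans h1); rw [Nat.add_mul, mul_comm d d] at *; omega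
    have h5 : monomial s (coeff s G) = coeff s G • col 1 0 d ⟨s 0 + d * s 1, h4⟩ := by
      rw [monomial_eq, smul_eq_C_mul, Finsupp.prod_fintype _ _ (by simp), Fin.prod_univ_two, col]
      simp only [Nat.add_mul_div_left _ _ (show 0 < d by omega), Nat.add_mul_mod_self_left,
        Nat.mod_eq_of_lt (h2.trans_lt h0), Nat.div_eq_of_lt (h2.trans_lt h0), zero_add]
      ring
    rw [h5]
    exact Submodule.smul_mem _ _ (Submodule.subset_span ⟨_, rfl⟩)
  obtain ⟨γ, hγ⟩ := (Submodule.mem_span_range_iff_exists_fun K).1 this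
  exact ⟨γ, hγ.symm⟩

lemma col_indep (d : ℕ) (γ : Fin ((d + 1) * d) → K) (h : ∑ c, γ c • col (K := K) (1 : Fin 2) 0 d c = 0) :
    γ = 0 := by
  funext c
  have h1 := congrArg (coeff (Finsupp.single 1 ((c : ℕ) / d) + Finsupp.single 0 ((c : ℕ) % d))) h
  have h2 : ∀ c : Fin ((d + 1) * d), col (K := K) (1 : Fin 2) 0 d c =
      monomial (Finsupp.single 1 ((c : ℕ) / d) + Finsupp.single 0 ((c : ℕ) % d)) 1 := fun c => by
    rw [col, X_pow_eq_monomial, X_pow_eq_monomial, monomial_mul, one_mul]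
  rw [coeff_sum, coeff_zero, Finset.sum_eq_single c] at h1
  · simpa [h2] using h1
  · intro b _ hb
    rw [coeff_smul, h2, coeff_monomial, if_neg, smul_zero]
    intro he
    have e1 := DFunLike.congr_fun he 1
    have e2 := DFunLike.congr_fun he 0
    simp at e1 e2
    apply hb; ext
    rw [← Nat.div_add_mod b d, e1, e2, Nat.div_add_mod]
  · simp

lemma mon_sub {k d : ℕ} (θ : Fin (m + 1) → MvPolynomial (Fin (k + 1)) K)
    (h1 : ∀ i, (θ i).totalDegree ≤ 1)
    (h2 : ∀ x i, onLine x e0 (θ i) = Polynomial.C (eval x (θ i)) + Polynomial.X * Polynomial.C (e0 i))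
    (f : MvPolynomial (Fin (m + 1)) K) (hf : mon f d) : mon (aeval θ f) d := by
  refine ⟨(aeval_deg f θ 1 h1).trans (by simpa using hf.1), fun x => ?_⟩
  have h3 := onLine_aeval x e0 θ f
  simp only [h2] at h3
  rw [h3]
  exact hf.2 fun i => eval x (θ i)

/-- vector field on `(y, β)` space -/
noncomputable def bb : Fin (m + 3) ⊕ Fin (m + 1) → MvPolynomial (Fin (m + 3) ⊕ Fin (m + 1)) K :=
  Sum.elim (Fin.cons 0 (Fin.cons 1 fun j => X (Sum.inr j))) fun _ => 0

/-- plane through `y` -/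
noncomputable def th2 (y : Fin (m + 3) → K) (β : Fin (m + 1) → K) :
    Fin (m + 3) → MvPolynomial (Fin 2) K :=
  Fin.cons (X 0) (Fin.cons (X 1) fun j => C (y j.succ.succ) + (X 1 - C (y 1)) * C (β j))

/-- restriction to the plane -/
noncomputable def psi (y : Fin (m + 3) → K) (β : Fin (m + 1) → K) :
    MvPolynomial (Fin (m + 3) ⊕ Fin (m + 1)) K →ₐ[K] MvPolynomial (Fin 2) K :=
  aeval (Sum.elim (th2 y β) fun j => C (β j))

/-- the derivation on the big space -/
noncomputable def DF (f : MvPolynomial (Fin (m + 3)) K) :=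
  DD (rename (Sum.inl (β := Fin (m + 1))) f) bb (Sum.inl 0)

/-- the minors -/
noncomputable def MM (f : MvPolynomial (Fin (m + 3)) K) (d N : ℕ) (r : Fin ((d + 1) * d) → Fin N) :
    MvPolynomial (Fin (m + 3) ⊕ Fin (m + 1)) K :=
  (Matrix.of fun a c => (DF f)^[(r a : ℕ)] (col (Sum.inl 1) (Sum.inl 0) d c)).det

variable (y : Fin (m + 3) → K) (β : Fin (m + 1) → K)

lemma psi_inl (f : MvPolynomial (Fin (m + 3)) K) :
    psi y β (rename Sum.inl f) = aeval (th2 y β) f := by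
  rw [psi, aeval_rename]; rfl

lemma psi_eval (h : MvPolynomial (Fin (m + 3) ⊕ Fin (m + 1)) K) :
    eval ![y 0, y 1] (psi y β h) = eval (Sum.elim y β) h := by
  rw [psi, ← coe_aeval_eq_eval, ← coe_aeval_eq_eval, RingHom.coe_coe, RingHom.coe_coe,
    ← AlgHom.comp_apply, comp_aeval]
  congr 2
  funext i
  rcases i with i | i
  · refine Fin.cases ?_ (fun i => Fin.cases ?_ (fun i => ?_) i) i <;> simp [th2]
  · simp

lemma psi_z (h : MvPolynomial (Fin (m + 3) ⊕ Fin (m + 1)) K) :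
    psi y β (pderiv (Sum.inl 0) h) = pderiv 0 (psi y β h) := by
  refine der_map _ _ _ (fun i => ?_) h
  rcases i with i | i
  · refine Fin.cases ?_ (fun i => ?_) i
    · simp [th2, psi]
    · rw [pderiv_X_of_ne (by simp), map_zero]
      refine Fin.cases ?_ (fun i => ?_) i
      · simp [th2, psi, pderiv_X]
      · simp [th2, psi]
  · simp [psi]

lemma psi_b (h : MvPolynomial (Fin (m + 3) ⊕ Fin (m + 1)) K) :
    psi y β (mkDerivation K bb h) = pderiv 1 (psi y β h) := by
  refine der_map _ _ _ (fun i => ?_) h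
  rw [mkDerivation_X]
  rcases i with i | i
  · refine Fin.cases ?_ (fun i => Fin.cases ?_ (fun i => ?_) i) i <;>
      simp [th2, psi, bb, pderiv_X]
  · simp [psi, bb]

lemma psi_DF (f : MvPolynomial (Fin (m + 3)) K) (j : ℕ) (h : MvPolynomial (Fin (m + 3) ⊕ Fin (m + 1)) K) :
    psi y β ((DF f)^[j] h) = (DD (aeval (th2 y β) f) ![0, 1] 0)^[j] (psi y β h) := by
  induction j generalizing h with
  | zero => rfl
  | succ j ih =>
    rw [Function.iterate_succ_apply, ih, Function.iterate_succ_apply]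
    congr 1
    rw [DF, DD_apply, DD_apply, map_sub, map_mul, map_mul, psi_z, psi_z, psi_b, psi_b, psi_inl, mk01]

lemma psi_col (d : ℕ) (c) : psi y β (col (Sum.inl 1) (Sum.inl 0) d c) = col 1 0 d c := by
  rw [col, col, map_mul, map_pow, map_pow, psi, aeval_X, aeval_X]
  rfl

lemma th2_mon {f : MvPolynomial (Fin (m + 3)) K} {d : ℕ} (hf : mon f d) : mon (aeval (th2 y β) f) d := by
  refine mon_sub _ (fun i => ?_) (fun x i => ?_) f hf
  · refine Fin.cases ?_ (fun i => Fin.cases ?_ (fun i => ?_) i) i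
    · simp [th2]
    · simp [th2]
    · refine (totalDegree_add _ _).trans (max_le (by simp) ((totalDegree_mul _ _).trans ?_))
      rw [totalDegree_C, add_zero]
      exact (totalDegree_sub _ _).trans (by simp)
  · refine Fin.cases ?_ (fun i => Fin.cases ?_ (fun i => ?_) i) i
    · simp [th2, e0, onLine]
    · have : (1 : Fin 2) = Fin.succ 0 := rfl
      simp only [th2, e0, onLine, Fin.cons_succ, Fin.cons_zero, aeval_X, this]; simp
    · have : (1 : Fin 2) = Fin.succ 0 := rfl
      simp only [th2, e0, onLine, Fin.cons_succ, aeval_X, this, map_add, map_mul, map_sub]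
      simp

lemma crit [CharZero K] (f : MvPolynomial (Fin (m + 3)) K) (d N : ℕ) (hf : mon f d) (r)
    (G H : MvPolynomial (Fin 2) K) (e : aeval (th2 y β) f = G * H) (hH : H.totalDegree ≠ 0)
    (hG : eval ![y 0, y 1] G = 0) : eval (Sum.elim y β) (MM f d N r) = 0 := by
  have hm := th2_mon y β hf
  have h1 := mon_deg hm
  have h0 := mon_ne hm
  rw [e] at h1 h0
  rw [totalDegree_mul_of_isDomain (left_ne_zero_of_mul h0) (right_ne_zero_of_mul h0)] at h1
  obtain ⟨γ, hγ⟩ := col_span d G ((degreeOf_le_totalDegree G 0).trans_lt (by omega)) (by omega)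
  rw [MM, RingHom.map_det]
  refine Matrix.exists_mulVec_eq_zero_iff.1 ⟨γ, ?_, ?_⟩
  · rintro rfl
    exact left_ne_zero_of_mul h0 (by simpa using hγ)
  · funext a
    obtain ⟨w, hw⟩ := DD_dvd G H G ![0, 1] 0 (r a) dvd_rfl
    have h2 := congrArg (eval ![y 0, y 1]) hw
    rw [map_mul, hG, zero_mul, ← e] at h2
    nth_rw 1 [hγ] at h2
    rw [iter_sum, map_sum] at h2
    rw [Pi.zero_apply, ← h2, Matrix.mulVec, dotProduct]
    refine Finset.sum_congr rfl fun c _ => ?_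
    rw [RingHom.mapMatrix_apply, Matrix.map_apply, Matrix.of_apply, ← psi_eval, psi_DF, psi_col, smul_eval,
      mul_comm]

end
end Sal

namespace Sal
section
variable {K : Type*} [Field K] {m : ℕ}

lemma MM_deg (f : MvPolynomial (Fin (m + 3)) K) (d N : ℕ) (hf : f.totalDegree ≤ d) (r) :
    (MM f d N r).totalDegree ≤ (d + 1) * d * ((d + 1 + d) + (d + 1) * N) := by
  refine totalDegree_det_le _ fun a c => ?_
  rw [Matrix.of_apply]
  have h1 : ∀ h : MvPolynomial (Fin (m + 3) ⊕ Fin (m + 1)) K,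
      (mkDerivation K (bb (K := K) (m := m)) h).totalDegree ≤ 1 + h.totalDegree := by
    intro h
    have : mkDerivation K (bb (K := K) (m := m)) h = ∑ i, bb (K := K) (m := m) i * pderiv i h := by
      classical
      induction h using MvPolynomial.induction_on with
      | C r => simp [derivation_C]
      | add p q hp hq => simp only [map_add, hp, hq, mul_add, Finset.sum_add_distrib]
      | mul_X p i hp =>
        simp only [Derivation.leibniz, smul_eq_mul, hp, mkDerivation_X, mul_add, Finset.sum_add_distrib]
        congr 1
        · rw [Finset.sum_eq_single i]
          · rw [pderiv_X_self]; ring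
          · intro b _ hb
            rw [pderiv_X_of_ne hb.symm]; ring
          · simp
        · rw [Finset.mul_sum]
          exact Finset.sum_congr rfl fun _ _ => by ring
    rw [this]
    refine totalDegree_finsetSum_le fun i _ => (totalDegree_mul _ _).trans
      (Nat.add_le_add ?_ (pderiv_totalDegree h _ le_rfl i))
    rcases i with i | i
    · refine Fin.cases ?_ (fun i => Fin.cases ?_ (fun i => ?_) i) i <;> simp [bb]
    · simp [bb]
  have h2 : (rename (Sum.inl (β := Fin (m + 1))) f).totalDegree ≤ d := (totalDegree_rename_le _ _).trans hf
  have h3 : ∀ j, ((DF f)^[j] (col (Sum.inl 1) (Sum.inl 0) d c)).totalDegree ≤ (d + 1 + d) + (d + 1) * j := by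
    intro j
    induction j with
    | zero =>
      rw [mul_zero, add_zero]
      refine (totalDegree_mul _ _).trans (Nat.add_le_add ?_ ?_) <;>
        refine (totalDegree_X_pow _ _).le.trans ?_
      · exact (Nat.div_lt_of_lt_mul (c.2.trans_eq (mul_comm _ _))).le
      · have : 0 < d := Nat.pos_of_ne_zero fun h => by subst h; exact absurd c.2 (by simp)
        exact (Nat.mod_lt _ this).le
    | succ j ih =>
      rw [Function.iterate_succ_apply', DF, DD_apply]
      rw [DF] at ih
      refine (totalDegree_sub _ _).trans (max_le ?_ ?_) <;> refine (totalDegree_mul _ _).trans ?_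
      · have := pderiv_totalDegree _ d h2 (Sum.inl 0)
        have h4 := h1 ((DD (rename Sum.inl f) bb (Sum.inl 0))^[j] (col (Sum.inl 1) (Sum.inl 0) d c))
        rw [Nat.mul_succ]; omega
      · have := pderiv_totalDegree _ _ ih (Sum.inl 0)
        have h4 := h1 (rename Sum.inl f)
        rw [Nat.mul_succ]; omega
  exact (h3 _).trans (Nat.add_le_add_left (Nat.mul_le_mul_left _ (r a).2.le) _)

lemma X_sub_ne {σ : Type*} (i : σ) (a : K) : (X i - C a : MvPolynomial σ K) ≠ 0 := fun h => by
  have := congrArg (eval fun _ => a + 1) h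
  simp at this

lemma clr (a : Fin (m + 1) → K) (γ : MvPolynomial (Fin m) K) :
    ∃ M0, ∀ M ≥ M0, ∃ Γ : MvPolynomial (Fin (m + 1)) K, ∀ u, u 0 - a 0 ≠ 0 →
      eval u Γ = (u 0 - a 0) ^ M * eval (fun j => (u j.succ - a j.succ) / (u 0 - a 0)) γ := by
  induction γ using MvPolynomial.induction_on with
  | C r => exact ⟨0, fun M _ => ⟨(X 0 - C (a 0)) ^ M * C r, fun u _ => by simp⟩⟩
  | add p q hp hq =>
    obtain ⟨M1, h1⟩ := hp
    obtain ⟨M2, h2⟩ := hq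
    refine ⟨max M1 M2, fun M hM => ?_⟩
    obtain ⟨P, hP⟩ := h1 M (le_of_max_le_left hM)
    obtain ⟨Q, hQ⟩ := h2 M (le_of_max_le_right hM)
    exact ⟨P + Q, fun u hu => by rw [map_add, hP u hu, hQ u hu, map_add, mul_add]⟩
  | mul_X p i hp =>
    obtain ⟨M1, h1⟩ := hp
    refine ⟨M1 + 1, fun M hM => ?_⟩
    obtain ⟨M, rfl⟩ : ∃ k, M = k + 1 := ⟨M - 1, by omega⟩
    obtain ⟨P, hP⟩ := h1 M (by omega)
    refine ⟨P * (X i.succ - C (a i.succ)), fun u hu => ?_⟩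
    rw [map_mul, hP u hu, map_mul, eval_X, map_sub, eval_X, eval_C]
    field_simp
    ring

lemma exist [CharZero K] [IsAlgClosed K] (f : MvPolynomial (Fin (m + 3)) K) (d : ℕ) (hd : 1 ≤ d)
    (hf : mon f d) (hi : Irreducible f) (y : Fin (m + 3) → K) (hy : eval y f = 0)
    (hz : eval y (pderiv 0 f) ≠ 0) :
    ∃ r, aeval (Sum.elim (fun i => C (y i)) X : _ → MvPolynomial (Fin (m + 1)) K)
      (MM f d (2 * (d + d) * (d + d) + (d + d) + 1) r) ≠ 0 := by
  by_contra! hcon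
  obtain ⟨γ, hγ0, hγ, -⟩ := null_vec (R := MvPolynomial (Fin (m + 1)) K) (fun _ => True) trivial
    ((d + 1) * d) (fun (j : Fin (2 * (d + d) * (d + d) + (d + d) + 1)) c =>
      aeval (Sum.elim (fun i => C (y i)) X : _ → MvPolynomial (Fin (m + 1)) K)
        ((DF f)^[(j : ℕ)] (col (Sum.inl 1) (Sum.inl 0) d c))) (fun _ _ _ _ _ => trivial) (fun r => by
      rw [← hcon r, MM, AlgHom.map_det]; rfl)
  have key : ∀ (β : Fin (m + 1) → K) x, ∃ z, eval ![z, x] (aeval (th2 y β) f) = 0 ∧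
      eval ![z, x] (∑ c, eval β (γ c) • col 1 0 d c) = 0 := by
    intro β x
    have hm := th2_mon y β hf
    refine pl_main _ _ ![y 0, y 1] d (d + d) hm ?_ ?_ (hm.1.trans (by omega)) ?_ (fun j hj => ?_) x
    · rw [← psi_inl, psi_eval, eval_rename]; exact hy
    · rw [← psi_inl, ← psi_z, psi_eval]
      have := congrArg (eval (Sum.elim y β)) (pderiv_rename (Sum.inl_injective (β := Fin (m + 1))) 0 f)
      rw [this, eval_rename]; exact hz
    · refine totalDegree_finsetSum_le fun c _ => (totalDegree_smul_le _ _).trans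
        ((totalDegree_mul _ _).trans (Nat.add_le_add ?_ ?_)) <;>
        refine (totalDegree_X_pow _ _).le.trans ?_
      · have := Nat.div_lt_of_lt_mul (c.2.trans_eq (mul_comm _ _))
        omega
      · exact (Nat.mod_lt _ hd).le
    · rw [iter_sum, map_sum]
      have := congrArg (eval β) (hγ ⟨j, by omega⟩)
      rw [map_sum, map_zero] at this
      rw [← this]
      refine Finset.sum_congr rfl fun c _ => ?_
      rw [smul_eval, map_mul, ← psi_col y β, ← psi_DF, psi_eval]
      congr 1
      rw [← coe_aeval_eq_eval, ← coe_aeval_eq_eval, RingHom.coe_coe, RingHom.coe_coe, ← AlgHom.comp_apply, comp_aeval]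
      congr 2
      funext i
      rcases i with i | i <;> simp
  choose M0 hM0 using fun c => clr (fun j => y j.succ) (γ c)
  choose Γ hΓ using fun c => hM0 c (∑ c, M0 c) (Finset.single_le_sum (by simp) (Finset.mem_univ c))
  obtain ⟨T, hT⟩ : ∃ T : MvPolynomial (Fin (m + 3)) K,
    T = ∑ c, rename (0 : Fin (m + 3)).succAbove (Γ c) * col 1 0 d c := ⟨_, rfl⟩
  have hTe : ∀ (z : K) (u : Fin (m + 2) → K), u 0 - y 1 ≠ 0 → eval (Fin.cons z u : Fin (m + 3) → K) T =
      (u 0 - y 1) ^ (∑ c, M0 c) * eval ![z, u 0] (∑ c, eval (fun j : Fin (m + 1) =>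
        (u j.succ - y j.succ.succ) / (u 0 - y 1)) (γ c) • col 1 0 d c) := by
    intro z u hu
    rw [hT, map_sum, map_sum, Finset.mul_sum]
    refine Finset.sum_congr rfl fun c _ => ?_
    have h1 := hΓ c u hu
    have h2 : eval ((Fin.cons z u : Fin (m + 3) → K) ∘ (0 : Fin (m + 3)).succAbove) (Γ c) = _ := h1
    rw [map_mul, eval_rename, smul_eval, ← mul_assoc, h2]
    congr 1
    · simp only [col, map_mul, map_pow, eval_X]; rfl
  have hTd : ¬ f ∣ T := by
    have hT0 : T ≠ 0 := by
      intro hT0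
      obtain ⟨c, hc⟩ := Function.ne_iff.1 hγ0
      obtain ⟨β, -, hβ⟩ := pick (γ c) hc _ le_rfl
      have h1 : (∑ c, eval (fun i => (β i : K)) (γ c) • col (1 : Fin 2) 0 d c) ≠ 0 := fun h => by
        have := congrFun (col_indep d _ h) c
        exact hβ this
      obtain ⟨p, -, hp⟩ := pick (_ * (X 1 - C (y 1))) (mul_ne_zero h1 (X_sub_ne _ _)) _ le_rfl
      rw [map_mul, map_sub, eval_X, eval_C] at hp
      have h2 := right_ne_zero_of_mul hp
      have h3 := hTe (p 0) (Fin.cons (p 1 : K) fun j => y j.succ.succ + β j * (p 1 - y 1)) (by simpa using h2)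
      rw [hT0, map_zero, eq_comm, mul_eq_zero] at h3
      rcases h3 with h3 | h3
      · exact h2 (by simpa using eq_zero_of_pow_eq_zero h3)
      · apply left_ne_zero_of_mul hp
        rw [← h3]
        congr 1
        · congr 1; funext i; fin_cases i <;> rfl
        · refine Finset.sum_congr rfl fun c _ => ?_
          congr 3
          funext j
          simp only [Fin.cons_succ, Fin.cons_zero]
          rw [add_sub_cancel_left, mul_div_cancel_right₀ _ h2]
    refine not_dvd_of_natDegree f T hT0 ?_
    rw [mon_natDeg hf, hT, map_sum]
    refine (Polynomial.natDegree_sum_le_of_forall_le (n := d - 1) _ _ fun c _ => ?_).trans_lt (by omega)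
    have h1 : uni 0 (X 1 : MvPolynomial (Fin (m + 3)) K) = Polynomial.C (X 0) := uni_X_succAbove 0 0
    rw [map_mul, uni_rename, col, map_mul, map_pow, map_pow, h1, uni_X_self, ← Polynomial.C_pow, ← mul_assoc,
      ← Polynomial.C_mul]
    refine (Polynomial.natDegree_C_mul_X_pow_le _ _).trans ?_
    have := Nat.mod_lt (c : ℕ) hd
    omega
  obtain ⟨P, hP0, -, hP⟩ := elim 0 f T hi hTd (max f.totalDegree T.totalDegree) (le_max_left _ _) (le_max_right _ _)
  have h9 : P * (X 0 - C (y 1)) = 0 := by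
    refine MvPolynomial.funext fun u => ?_
    rw [map_mul, map_zero, map_sub, eval_X, eval_C]
    by_cases hu : u 0 - y 1 = 0
    · rw [hu, mul_zero]
    · obtain ⟨z, h1, h2⟩ := key (fun j => (u j.succ - y j.succ.succ) / (u 0 - y 1)) (u 0)
      have h3 := hP (Fin.cons z u) ?_ (by rw [hTe z u hu, h2, mul_zero])
      · rw [mul_eq_zero]; left; exact h3
      · rw [← h1, ← coe_aeval_eq_eval, ← coe_aeval_eq_eval, RingHom.coe_coe, RingHom.coe_coe, ← AlgHom.comp_apply,
          comp_aeval]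
        congr 2
        funext i
        refine Fin.cases ?_ (fun i => Fin.cases ?_ (fun i => ?_) i) i
        · simp [th2]
        · simp [th2]
        · simp only [th2, Fin.cons_succ]
          simp [mul_div_cancel₀ _ hu]
  exact (mul_ne_zero hP0 (X_sub_ne _ _)) h9

end
end Sal

namespace Sal
section
variable {K : Type*} [Field K] [CharZero K] {m : ℕ}

lemma ev_ae {K : Type*} [Field K] {n k : ℕ} (x : Fin k → K) (θ : Fin n → MvPolynomial (Fin k) K) (f : MvPolynomial (Fin n) K) :
    eval x (aeval θ f) = eval (fun i => eval x (θ i)) f := by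
  rw [← coe_aeval_eq_eval, ← coe_aeval_eq_eval, RingHom.coe_coe, RingHom.coe_coe, ← AlgHom.comp_apply,
    comp_aeval]

lemma exNZ [IsAlgClosed K] (f g : MvPolynomial (Fin (m + 1)) K) (hi : Irreducible f) {d : ℕ} (hm : mon f d)
    (hd : 1 ≤ d) (hg : ¬ f ∣ g) : ∃ y, eval y f = 0 ∧ eval y g ≠ 0 := by
  obtain ⟨P, hP0, -, hP⟩ := elim 0 f g hi hg (max f.totalDegree g.totalDegree) (le_max_left _ _) (le_max_right _ _)
  obtain ⟨u, -, hu⟩ := pick (K := K) P hP0 P.totalDegree le_rfl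
  obtain ⟨t, ht⟩ := mon_root hm (by omega) fun i => (u i : K)
  refine ⟨_, ht, fun h => hu ?_⟩
  have h3 := hP _ ht h
  simpa only [Fin.zero_succAbove, Fin.cons_succ] using h3

/-- generic points of `f = 0` are on no linear subspace of codimension 2 contained in `f = 0` -/
def Inf (f : MvPolynomial (Fin (m + 3)) K) : Prop := ∀ M, ¬ f ∣ M → ∃ y, eval y f = 0 ∧ eval y M ≠ 0 ∧
  ∀ A : Matrix (Fin (m + 3)) (Fin (m + 1)) K, (∀ u, A.mulVec u = 0 → u = 0) →
    ∃ u, eval (y + A.mulVec u) f ≠ 0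

lemma inf_of [IsAlgClosed K] (f f1 : MvPolynomial (Fin (m + 3)) K)
    (A : (Fin (m + 3) → K) ≃ₗ[K] (Fin (m + 3) → K))
    (hA : ∀ y, eval y f1 = eval (A y) f) (hi : Irreducible f1) {d : ℕ} (hm : mon f1 d) (hd : 2 ≤ d)
    (hfin : {S : AffineSubspace K (Fin (m + 3) → K) | Module.finrank K S.direction = m + 1 ∧
      ∀ y ∈ S, eval y f = 0}.Finite) : Inf f1 := by
  have h1 : ∀ S : AffineSubspace K (Fin (m + 3) → K), ∃ l, ¬ f1 ∣ l ∧
      (Module.finrank K S.direction = m + 1 → ∀ y, A y ∈ S → eval y l = 0) := by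
    intro S
    by_cases h : Module.finrank K S.direction = m + 1 ∧ ∃ s, s ∈ S
    · obtain ⟨h, s, hs⟩ := h
      obtain ⟨φ, hφ, hS⟩ := Submodule.exists_le_ker_of_lt_top S.direction (lt_top_iff_ne_top.2 fun h0 => by
        rw [h0, finrank_top, Module.finrank_fin_fun] at h; omega)
      obtain ⟨l, hl⟩ : ∃ l : MvPolynomial (Fin (m + 3)) K,
        l = ∑ i, C (φ (A (Pi.single i 1))) * X i - C (φ s) := ⟨_, rfl⟩
      have he : ∀ y, eval y l = φ (A y) - φ s := fun y => by
        have h2 : A y = ∑ i, y i • A (Pi.single i 1) := by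
          conv_lhs => rw [← Finset.univ_sum_single y, map_sum]
          refine Finset.sum_congr rfl fun i _ => ?_
          rw [← map_smul, ← Pi.single_smul, smul_eq_mul, mul_one]
        rw [hl, h2]; simp [map_sum, mul_comm]
      refine ⟨l, not_dvd_deg _ _ ?_ ?_, fun _ y hy => ?_⟩
      · rintro h0
        apply hφ
        refine LinearMap.ext fun v => ?_
        have h2 := he (A.symm v)
        have h3 := he 0
        rw [h0, map_zero] at h2 h3
        rw [LinearEquiv.apply_symm_apply] at h2
        rw [map_zero, map_zero] at h3
        rw [LinearMap.zero_apply]; linear_combination h3 - h2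
      · rw [mon_deg hm]
        refine lt_of_le_of_lt ?_ hd
        rw [hl]
        refine (totalDegree_sub _ _).trans (max_le (totalDegree_finsetSum_le fun i _ =>
          (totalDegree_mul _ _).trans (by simp)) (by simp))
      · rw [he, ← map_sub]
        exact hS (AffineSubspace.vsub_mem_direction hy hs)
    · exact ⟨1, fun h => hi.not_isUnit (isUnit_of_dvd_one h), fun h1 y hy => absurd ⟨h1, _, hy⟩ h⟩
  choose l hl1 hl2 using h1
  intro M hM
  have hp : Prime f1 := hi.prime
  obtain ⟨y, hy, hy1⟩ := exNZ f1 (M * ∏ S ∈ hfin.toFinset, l S) hi hm (by omega) (fun h => by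
    rcases hp.dvd_or_dvd h with h | h
    · exact hM h
    · obtain ⟨S, -, hS⟩ := (hp.dvd_finsetProd_iff l).1 h
      exact hl1 S hS)
  rw [map_mul, map_prod] at hy1
  refine ⟨y, hy, left_ne_zero_of_mul hy1, fun B hB => ?_⟩
  by_contra! hcon
  have hd : Module.finrank K (AffineSubspace.mk' (A y) (LinearMap.range (A.toLinearMap ∘ₗ B.mulVecLin))).direction
      = m + 1 := by
    rw [AffineSubspace.direction_mk', LinearMap.finrank_range_of_inj, Module.finrank_fin_fun]
    rw [LinearMap.coe_comp]
    refine A.injective.comp ((injective_iff_map_eq_zero _).2 hB)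
  refine Finset.prod_ne_zero_iff.1 (right_ne_zero_of_mul hy1) _ (hfin.mem_toFinset.2 ⟨hd, fun z hz => ?_⟩)
    (hl2 _ hd y (AffineSubspace.self_mem_mk' _ _))
  obtain ⟨u, hu⟩ := AffineSubspace.mem_mk'.1 hz
  have : z = A (y + B.mulVec u) := by
    rw [map_add, add_comm (A y)]; exact eq_add_of_sub_eq hu.symm
  rw [this, ← hA, hcon u]

/-- the polynomial detecting lines in a given pencil -/
noncomputable def M2 (f : MvPolynomial (Fin (m + 3)) K) (w l : Fin (m + 3) → K) (t : K) :=
  aeval (fun i => X i + C t * (C (w i) * dd l f - C (l i) * dd w f)) f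

/-- second direction -/
def b2 {R : Type*} [Zero R] [One R] (γ : Fin m → R) : Fin (m + 3) → R := Fin.cons 0 (Fin.cons 0 (Fin.cons 1 γ))

/-- the vector `L b` -/
def LL (α : K) (lam b : Fin (m + 3) → K) : Fin (m + 3) → K := fun i => α * b i - (∑ j, lam j * b j) * e0 i

lemma dehomQ (R : MvPolynomial (Fin (m + 1)) K) (hR : R ≠ 0) : ∃ (t : K) (Q : MvPolynomial (Fin m) K), Q ≠ 0 ∧
    Q.totalDegree ≤ R.totalDegree ∧
    ∀ γ : Fin m → K, eval γ Q = eval (fun j => t * (Fin.cons 1 γ : Fin (m + 1) → K) j) R := by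
  obtain ⟨u, -, hu⟩ := pick (R * X 0) (mul_ne_zero hR (X_ne_zero _)) _ le_rfl
  rw [map_mul, eval_X] at hu
  obtain ⟨hu1, hu0⟩ := mul_ne_zero_iff.1 hu
  obtain ⟨Q, hQ⟩ : ∃ Q : MvPolynomial (Fin m) K, Q = aeval (Fin.cons (C (u 0 : K)) fun j => C (u 0 : K) * X j :
    Fin (m + 1) → MvPolynomial (Fin m) K) R := ⟨_, rfl⟩
  have hQe : ∀ γ : Fin m → K, eval γ Q = eval (fun j => u 0 * (Fin.cons 1 γ : Fin (m + 1) → K) j) R := fun γ => by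
    rw [hQ, ev_ae]; congr 2; funext i
    refine Fin.cases ?_ (fun i => ?_) i <;> simp
  refine ⟨u 0, Q, fun h => hu1 ?_, ?_, hQe⟩
  · have := hQe fun j => u j.succ / u 0
    rw [h, map_zero] at this
    rw [this]; congr 2; funext i
    refine Fin.cases ?_ (fun i => ?_) i <;> simp [mul_div_cancel₀ _ hu0]
  · rw [hQ]
    refine (aeval_deg R _ 1 fun i => ?_).trans (mul_one _).le
    refine Fin.cases ?_ (fun i => ?_) i
    · exact (totalDegree_C _).le.trans zero_le_one
    · exact (totalDegree_mul _ _).trans (by rw [totalDegree_C, totalDegree_X])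

lemma perp (f : MvPolynomial (Fin (m + 3)) K) (d : ℕ) (hd : f.totalDegree = d + 1) (hI : Inf f)
    (w : Fin (m + 3) → K) (hw1 : w 1 = 1) (hw : dd w f ≠ 0) (α : K) (hα : α ≠ 0) (lam : Fin (m + 3) → K) :
    ∃ (t : K) (Q : MvPolynomial (Fin m) K), Q ≠ 0 ∧ Q.totalDegree ≤ d + 1 ∧
      ∀ γ, eval γ Q ≠ 0 → ¬ f ∣ M2 f w (LL α lam (b2 γ)) t := by
  obtain ⟨y, hy, hB, hu⟩ := hI (dd w f) (not_dvd_deg _ _ hw (by have := dd_deg w f d hd.le; omega))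
  obtain ⟨E, hE⟩ : ∃ E : Fin (m + 1) → Fin (m + 3) → K,
    E = fun j => LL α lam (Pi.single j.succ.succ 1) := ⟨_, rfl⟩
  obtain ⟨A, hA⟩ : ∃ A : Matrix (Fin (m + 3)) (Fin (m + 1)) K,
    A = Matrix.of fun i j => eval y (dd (E j) f) * w i - E j i * eval y (dd w f) := ⟨_, rfl⟩
  have hE1 : ∀ j, E j 1 = 0 := fun j => by
    have : (1 : Fin (m + 3)) = Fin.succ 0 := rfl
    rw [this, hE]
    change α * (Pi.single j.succ.succ 1 : Fin (m + 3) → K) (Fin.succ 0) - _ * 0 = 0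
    rw [Pi.single_eq_of_ne (fun h => Fin.succ_ne_zero j (Fin.succ_inj.1 h).symm)]; ring
  have hE2 : ∀ j k : Fin (m + 1), E j k.succ.succ = if k = j then α else 0 := fun j k => by
    simp only [hE, LL]; simp [e0, Pi.single_apply]
  obtain ⟨u, hu⟩ := hu A (fun u h => by
    have h1 := congrFun h 1
    have h2 : ∑ j, eval y (dd (E j) f) * u j = 0 := by
      simpa [hA, Matrix.mulVec, dotProduct, hE1, hw1] using h1
    funext k
    have h3 := congrFun h k.succ.succ
    have h4 : ∑ j, (eval y (dd (E j) f) * u j * w k.succ.succ -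
        (if k = j then α * eval y (dd w f) * u j else 0)) = 0 := by
      refine Eq.trans ?_ h3
      rw [hA, Matrix.mulVec, dotProduct]
      refine Finset.sum_congr rfl fun j _ => ?_
      rw [Matrix.of_apply, hE2]; split_ifs <;> ring
    rw [Finset.sum_sub_distrib, ← Finset.sum_mul, h2] at h4
    simpa [hα, hB] using h4)
  obtain ⟨R, hR⟩ : ∃ R : MvPolynomial (Fin (m + 1)) K,
    R = aeval (fun i => C (y i) + ∑ j, C (A i j) * X j) f := ⟨_, rfl⟩
  have hRe : ∀ u, eval u R = eval (y + A.mulVec u) f := fun u => by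
    rw [hR, ev_ae]; congr 2; funext i; simp [Matrix.mulVec, dotProduct]
  obtain ⟨t, Q, hQ0, hQd, hQe⟩ := dehomQ R fun h => hu (by rw [← hRe, h, map_zero])
  refine ⟨t, Q, hQ0, hQd.trans ?_, fun γ hγ hdvd => hγ ?_⟩
  · rw [hR, ← hd]
    refine (aeval_deg f _ 1 fun i => ?_).trans (by simp)
    exact (totalDegree_add _ _).trans (max_le (by simp) (totalDegree_finsetSum_le fun j _ =>
        (totalDegree_mul _ _).trans (by simp)))
  · obtain ⟨q, hq⟩ := hdvd
    have h1 := congrArg (eval y) hq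
    rw [map_mul, hy, zero_mul, M2, ev_ae] at h1
    rw [hQe, hRe, ← h1]
    congr 2
    funext i
    have hL : ∀ i, LL α lam (b2 γ) i = ∑ j, E j i * (Fin.cons 1 γ : Fin (m + 1) → K) j := by
      intro i
      simp only [hE, LL, sub_mul, Finset.sum_sub_distrib]
      have hb : ∀ i, b2 γ i = ∑ j : Fin (m + 1), (Pi.single j.succ.succ 1 : Fin (m + 3) → K) i *
          (Fin.cons 1 γ : Fin (m + 1) → K) j := by
        intro i
        refine Fin.cases ?_ (fun i => Fin.cases ?_ (fun i => ?_) i) i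
        · refine (Finset.sum_eq_zero fun j _ => ?_).symm
          rw [Pi.single_eq_of_ne (Fin.succ_ne_zero _).symm, zero_mul]
        · refine (Finset.sum_eq_zero fun j _ => ?_).symm
          rw [Pi.single_eq_of_ne (fun h => Fin.succ_ne_zero j (Fin.succ_inj.1 h).symm), zero_mul]
        · simp [b2, Pi.single_apply]
      congr 1
      · simp only [hb, Finset.mul_sum, mul_assoc]
      · simp only [hb, Finset.mul_sum, Finset.sum_mul]
        rw [Finset.sum_comm]
        exact Finset.sum_congr rfl fun _ _ => Finset.sum_congr rfl fun _ _ => by ring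
    have hLd : eval y (dd (LL α lam (b2 γ)) f) = ∑ j, eval y (dd (E j) f) * (Fin.cons 1 γ : Fin (m + 1) → K) j := by
      simp only [dd, map_sum, map_mul, eval_C, hL, Finset.sum_mul]
      rw [Finset.sum_comm]
      exact Finset.sum_congr rfl fun _ _ => Finset.sum_congr rfl fun _ _ => by ring
    rw [Pi.add_apply, map_add, eval_X, map_mul, map_sub, map_mul, map_mul, eval_C, eval_C, eval_C, hLd, hL]
    rw [Matrix.mulVec, dotProduct, Finset.mul_sum, Finset.sum_mul, ← Finset.sum_sub_distrib, Finset.mul_sum, hA]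
    congr 1
    exact Finset.sum_congr rfl fun j _ => by rw [Matrix.of_apply]; ring

end
end Sal

namespace Sal
section
variable {K : Type*} [Field K] [CharZero K] {m : ℕ}

/-- first direction, modified -/
def w1 (l : K) (β : Fin (m + 1) → K) : Fin (m + 3) → K := Fin.cons l (Fin.cons 1 β)
/-- second direction, modified -/
def w2 (l : K) (γ : Fin m → K) : Fin (m + 3) → K := Fin.cons l (Fin.cons 0 (Fin.cons 1 γ))

lemma lemI (h : MvPolynomial (Fin (m + 3)) K) (hi : Irreducible h) (hh : h.IsHomogeneous h.totalDegree)
    (hm : mon h h.totalDegree) (d : ℕ) (hd : h.totalDegree ≤ d) :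
    ∃ Q : MvPolynomial (Fin (m + 1)) K, Q ≠ 0 ∧ Q.totalDegree ≤ 2 * d * d + d ∧ ∀ β, eval β Q ≠ 0 →
      ∀ l, eval (w1 l β) h = 0 → eval (w1 l β) (pderiv 0 h) ≠ 0 := by
  obtain ⟨c, hc, hk⟩ := mon_uni hm
  obtain ⟨P, hP0, hPd, hP⟩ := elim 0 h (pderiv 0 h) hi (pderiv0_not_dvd h _ c hc hk (irr_deg h hi)) d hd
    (pderiv_totalDegree _ _ hd _)
  obtain ⟨t, Q, hQ0, hQd, hQ⟩ := dehomQ P hP0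
  refine ⟨Q, hQ0, hQd.trans hPd, fun β hβ l h1 h2 => hβ ?_⟩
  rw [hQ]
  have := hP (fun i => t * w1 l β i) (by rw [hom_eval_smul h hh, h1, mul_zero])
    (by rw [hom_eval_smul _ hh.pderiv, h2, mul_zero])
  simpa only [Fin.zero_succAbove, w1, Fin.cons_succ] using this

lemma eval_dd {K : Type*} [Field K] {n : ℕ} (x v : Fin n → K) (f : MvPolynomial (Fin n) K) :
    eval x (dd v f) = ∑ i, v i * eval x (pderiv i f) := by
  simp [dd, map_sum]

lemma lemII (f : MvPolynomial (Fin (m + 3)) K) (d : ℕ) (h1 : 1 ≤ d) (hm : mon f d) (hi : Irreducible f) (hI : Inf f) :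
    ∃ Q : MvPolynomial (Fin (m + 1)) K, Q ≠ 0 ∧ Q.totalDegree ≤ 1 ∧ ∀ β, eval β Q ≠ 0 →
      ∀ l, dd (w1 l β) f ≠ 0 := by
  obtain ⟨c, hc, hk⟩ := mon_uni hm
  obtain ⟨y', hy'⟩ : ∃ y', eval y' (pderiv 0 f) ≠ 0 := by
    by_contra! hcon
    exact pderiv0_not_dvd f _ c hc hk h1 ((funext fun x => (hcon x).trans (map_zero _).symm :
      pderiv 0 f = 0) ▸ dvd_zero _)
  by_cases hcon : ∃ y, ∃ j : Fin (m + 2), eval y (pderiv j.succ f) * eval y' (pderiv 0 f) -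
      eval y' (pderiv j.succ f) * eval y (pderiv 0 f) ≠ 0
  · obtain ⟨y, j, hj⟩ := hcon
    obtain ⟨R, hR⟩ : ∃ R : MvPolynomial (Fin (m + 2)) K, R = ∑ j, C (eval y (pderiv j.succ f) *
      eval y' (pderiv 0 f) - eval y' (pderiv j.succ f) * eval y (pderiv 0 f)) * X j := ⟨_, rfl⟩
    obtain ⟨t, Q, hQ0, hQd, hQ⟩ := dehomQ R fun h => hj (by
      have := congrArg (eval (Pi.single j 1)) (hR.symm.trans h)
      simpa [map_sum, Pi.single_apply] using this)
    refine ⟨Q, hQ0, hQd.trans ?_, fun β hβ l h => hβ ?_⟩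
    · rw [hR]
      exact totalDegree_finsetSum_le fun j _ => (totalDegree_mul _ _).trans (by rw [totalDegree_C, totalDegree_X])
    · have h2 := congrArg (eval y) h
      have h3 := congrArg (eval y') h
      rw [eval_dd, Fin.sum_univ_succ, map_zero] at h2 h3
      simp only [w1, Fin.cons_zero, Fin.cons_succ] at h2 h3
      rw [hQ, hR, map_sum]
      simp only [map_mul, eval_C, eval_X]
      calc _ = t * (eval y' (pderiv 0 f) * (∑ j : Fin (m + 2), (Fin.cons 1 β : Fin (m + 2) → K) j * eval y (pderiv j.succ f))
          - eval y (pderiv 0 f) * (∑ j : Fin (m + 2), (Fin.cons 1 β : Fin (m + 2) → K) j * eval y' (pderiv j.succ f))) := by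
            rw [Finset.mul_sum, Finset.mul_sum, ← Finset.sum_sub_distrib, Finset.mul_sum]
            exact Finset.sum_congr rfl fun j _ => by ring
        _ = 0 := by linear_combination t * eval y' (pderiv 0 f) * h2 - t * eval y (pderiv 0 f) * h3
  · push Not at hcon
    exfalso
    obtain ⟨κ, hκ⟩ : ∃ κ : Fin (m + 1) → K, κ = fun j => eval y' (pderiv j.succ.succ f) / eval y' (pderiv 0 f) :=
      ⟨_, rfl⟩
    obtain ⟨y, hy, -, hu⟩ := hI 1 (fun h => hi.not_isUnit (isUnit_of_dvd_one h))
    obtain ⟨A, hA⟩ : ∃ A : Matrix (Fin (m + 3)) (Fin (m + 1)) K, A = Matrix.of fun i j =>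
      (Fin.cons (-κ j) (Fin.cons 0 (Pi.single j 1)) : Fin (m + 3) → K) i := ⟨_, rfl⟩
    have hA0 : ∀ u, A.mulVec u 0 = - ∑ j, κ j * u j := fun u => by
      simp [hA, Matrix.mulVec, dotProduct]
    have hA1 : ∀ u, A.mulVec u (Fin.succ 0) = 0 := fun u => by
      simp only [hA, Matrix.mulVec, dotProduct, Matrix.of_apply, Fin.cons_succ, Fin.cons_zero]; simp
    have hA2 : ∀ u k, A.mulVec u (Fin.succ (Fin.succ k)) = u k := fun u k => by
      simp [hA, Matrix.mulVec, dotProduct, Pi.single_apply]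
    obtain ⟨u, hu⟩ := hu A (fun u h => funext fun k => by rw [← hA2 u k, h]; rfl)
    have h2 : dd (A.mulVec u) f = 0 := funext fun x => by
      rw [eval_dd, Fin.sum_univ_succ, Fin.sum_univ_succ, hA0, hA1, map_zero, zero_mul, zero_add, neg_mul,
        neg_add_eq_zero, Finset.sum_mul]
      refine Finset.sum_congr rfl fun j _ => ?_
      rw [hA2, hκ]
      have := hcon x j.succ
      field_simp
      linear_combination (- u j) * this
    have h3 := dd_onLine y (A.mulVec u) f
    rw [h2, show onLine y (A.mulVec u) (0 : MvPolynomial (Fin (m + 3)) K) = 0 from map_zero _] at h3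
    have h4 := Polynomial.eq_C_of_derivative_eq_zero h3
    have h5 := onLine_eval y (A.mulVec u) f 1
    have h6 := onLine_eval y (A.mulVec u) f 0
    rw [h4, Polynomial.eval_C] at h5 h6
    apply hu
    have e1 : y + A.mulVec u = fun i => y i + 1 * A.mulVec u i := by funext i; simp
    have e2 : (fun i => y i + 0 * A.mulVec u i) = y := by funext i; simp
    rw [e1, ← h5, h6, e2, hy]

/-- bound for the generic choices -/
def GD (d : ℕ) : ℕ := (d * (2 * d * d + d) + 1 + (d + 1) * d * ((d + 1 + d) + (d + 1) *
  (2 * (d + d) * (d + d) + (d + d) + 1))) + d * d * d * d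

lemma mon_top {K : Type*} [Field K] {m d : ℕ} {f : MvPolynomial (Fin (m + 1)) K} (hm : mon f d) :
    mon (homogeneousComponent d f) d := by
  have hΦh := homogeneousComponent_isHomogeneous d f
  refine ⟨hΦh.totalDegree_le, fun x => ?_⟩
  have h0 := hm.2 x
  rw [onLine_coeff _ _ _ _ hm.1] at h0
  rwa [onLine_coeff _ _ _ _ hΦh.totalDegree_le, homogeneousComponent_of_mem hΦh, if_pos rfl]

lemma gen [IsAlgClosed K] (f : MvPolynomial (Fin (m + 3)) K) (d : ℕ) (hd : 2 ≤ d) (hm : mon f d)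
    (hi : Irreducible f) (hI : Inf f) : ∃ (β : Fin (m + 1) → ℤ) (γ : Fin m → ℤ) (M : MvPolynomial (Fin (m + 3)) K),
    (∀ i, |β i| ≤ GD d) ∧ (∀ i, |γ i| ≤ GD d) ∧ M.totalDegree ≤ GD d ∧ ¬ f ∣ M ∧
    ∀ y, eval y f = 0 → eval y M ≠ 0 →
      (∀ G H, aeval (th2 y fun i => (β i : K)) f = G * H → eval ![y 0, y 1] G = 0 → H.totalDegree = 0) ∧
      ∀ l1 l2, (∀ x w, eval (fun i => x * w1 l1 (fun i => (β i : K)) i + w * w2 l2 (fun i => (γ i : K)) i)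
        (homogeneousComponent d f) = 0) → ∀ s u, (s ≠ 0 ∨ u ≠ 0) →
        onLine y (fun i => s * w1 l1 (fun i => (β i : K)) i + u * w2 l2 (fun i => (γ i : K)) i) f ≠ 0 := by
  classical
  have hp := hi.prime
  have hfd := mon_deg hm
  obtain ⟨Φ, hΦ⟩ : ∃ Φ, Φ = homogeneousComponent d f := ⟨_, rfl⟩
  have hΦh : Φ.IsHomogeneous d := hΦ ▸ homogeneousComponent_isHomogeneous d f
  have hΦm : mon Φ d := hΦ ▸ mon_top hm
  have hΦ0 := mon_ne hΦm
  obtain ⟨I, hIc, hIi, -, hI0⟩ := facs Φ hΦ0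
  rw [mon_deg hΦm] at hIc hIi
  have hIm : ∀ h ∈ I, mon h h.totalDegree := fun h hh => by
    obtain ⟨g, hg⟩ := (hIi h hh).2.1
    exact mon_mul (hg ▸ hΦm)
  choose! Q1 hQ1 hQ1d hQ1e using fun h hh => lemI h (hIi h hh).1 (homog_dvd _ _ hΦh hΦ0 (hIi h hh).2.1)
    (hIm h hh) d (hIi h hh).2.2
  obtain ⟨Q2, hQ2, hQ2d, hQ2e⟩ := lemII f d (by omega) hm hi hI
  obtain ⟨c, hc, hk⟩ := mon_uni hm
  obtain ⟨y0, hy0, hz0⟩ := exNZ f (pderiv 0 f) hi hm (by omega) (pderiv0_not_dvd f _ c hc hk (by omega))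
  obtain ⟨r, hr⟩ := exist f d (by omega) hm hi y0 hy0 hz0
  have hMM := MM_deg f d (2 * (d + d) * (d + d) + (d + d) + 1) hm.1 r
  obtain ⟨MM1, hMM1⟩ : ∃ P, P = MM f d (2 * (d + d) * (d + d) + (d + d) + 1) r := ⟨_, rfl⟩
  rw [← hMM1] at hr hMM
  obtain ⟨β, hβ, hβ0⟩ := pick ((∏ h ∈ I, Q1 h) * Q2 * aeval (Sum.elim (fun i => C (y0 i)) X :
    _ → MvPolynomial (Fin (m + 1)) K) MM1) (mul_ne_zero (mul_ne_zero (Finset.prod_ne_zero_iff.2 hQ1) hQ2) hr)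
    (d * (2 * d * d + d) + 1 + (d + 1) * d * ((d + 1 + d) + (d + 1) * (2 * (d + d) * (d + d) + (d + d) + 1))) (by
      refine (totalDegree_mul _ _).trans (add_le_add ((totalDegree_mul _ _).trans (add_le_add
        ((totalDegree_prod_le I Q1 _ hQ1d).trans (Nat.mul_le_mul_right _ hIc)) hQ2d)) ?_)
      refine ((aeval_deg MM1 _ 1 ?_).trans (mul_one _).le).trans hMM
      rintro (i | i) <;> simp)
  obtain ⟨b, hb⟩ : ∃ b : Fin (m + 1) → K, b = fun i => (β i : K) := ⟨_, rfl⟩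
  rw [← hb, map_mul, map_mul, map_prod] at hβ0
  obtain ⟨⟨h1, h2⟩, h3⟩ := (mul_ne_zero_iff.1 hβ0).imp_left mul_ne_zero_iff.1
  rw [Finset.prod_ne_zero_iff] at h1
  have key : ∀ p : (MvPolynomial (Fin (m + 3)) K) × K, ∃ (t : K) (Q : MvPolynomial (Fin m) K),
      p.1 ∈ I ∧ eval (w1 p.2 b) p.1 = 0 → Q ≠ 0 ∧ Q.totalDegree ≤ d ∧ ∀ γ, eval γ Q ≠ 0 →
      ¬ f ∣ M2 f (w1 p.2 b) (LL (eval (w1 p.2 b) (pderiv 0 p.1)) (fun i => eval (w1 p.2 b) (pderiv i p.1))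
        (b2 γ)) t := fun p => by
    by_cases hpI : p.1 ∈ I ∧ eval (w1 p.2 b) p.1 = 0
    · obtain ⟨t, Q, hQ⟩ := perp f (d - 1) (by omega) hI (w1 p.2 b) rfl (hQ2e b h2 p.2)
        _ (hQ1e _ hpI.1 b (h1 _ hpI.1) _ hpI.2) (fun i => eval (w1 p.2 b) (pderiv i p.1))
      rw [Nat.sub_add_cancel (by omega)] at hQ
      exact ⟨t, Q, fun _ => hQ⟩
    · exact ⟨0, 0, fun h => absurd h hpI⟩
  choose t Q hQ using key
  obtain ⟨T, hT⟩ : ∃ T, T = I.biUnion fun h => (onLine (w1 0 b) e0 h).roots.toFinset.image fun l => (h, l) := ⟨_, rfl⟩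
  have ew : ∀ l, (fun i => w1 0 b i + l * e0 i) = w1 l b := fun l => funext fun i => by
    refine Fin.cases ?_ (fun i => ?_) i <;> simp [w1, e0]
  have hTm : ∀ p, p ∈ T ↔ p.1 ∈ I ∧ eval (w1 p.2 b) p.1 = 0 := fun p => by
    have h0 : p.1 ∈ I → onLine (w1 0 b) e0 p.1 ≠ 0 := fun hh h => (hIm _ hh).2 (w1 0 b) (by rw [h, Polynomial.coeff_zero])
    rw [hT, ← ew p.2, ← onLine_eval, Finset.mem_biUnion]
    constructor
    · rintro ⟨h, hh, hp⟩
      obtain ⟨l, hl, rfl⟩ := Finset.mem_image.1 hp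
      rw [Multiset.mem_toFinset, Polynomial.mem_roots'] at hl
      exact ⟨hh, hl.2⟩
    · rintro ⟨hh, hp⟩
      refine ⟨_, hh, Finset.mem_image.2 ⟨p.2, ?_, rfl⟩⟩
      rw [Multiset.mem_toFinset, Polynomial.mem_roots']
      exact ⟨h0 hh, hp⟩
  have hTc : T.card ≤ d * d := by
    rw [hT]
    refine Finset.card_biUnion_le.trans ((Finset.sum_le_card_nsmul _ _ d fun h hh => ?_).trans
      (Nat.mul_le_mul_right _ hIc))
    exact Finset.card_image_le.trans ((Multiset.toFinset_card_le _).trans ((Polynomial.card_roots' _).trans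
      ((onLine_deg _ _ _).trans (hIi h hh).2.2)))
  obtain ⟨γ, hγ, hγ0⟩ := pick (∏ p ∈ T, Q p) (Finset.prod_ne_zero_iff.2 fun p hp => (hQ p ((hTm p).1 hp)).1)
    (d * d * d) ((totalDegree_prod_le T Q d fun p hp => (hQ p ((hTm p).1 hp)).2.1).trans
      (Nat.mul_le_mul_right _ hTc))
  obtain ⟨g, hg⟩ : ∃ g : Fin m → K, g = fun i => (γ i : K) := ⟨_, rfl⟩
  rw [← hg, map_prod, Finset.prod_ne_zero_iff] at hγ0
  obtain ⟨N, hN⟩ : ∃ N : (MvPolynomial (Fin (m + 3)) K) × K → MvPolynomial (Fin (m + 3)) K, N = fun p =>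
    M2 f (w1 p.2 b) (LL (eval (w1 p.2 b) (pderiv 0 p.1)) (fun i => eval (w1 p.2 b) (pderiv i p.1)) (b2 g)) (t p) :=
      ⟨_, rfl⟩
  obtain ⟨M1, hM1⟩ : ∃ M1, M1 = aeval (Sum.elim X (fun i => C (b i)) : _ → MvPolynomial (Fin (m + 3)) K) MM1 :=
    ⟨_, rfl⟩
  have evS : ∀ y, eval y M1 = eval (Sum.elim y b) MM1 := fun y => by
    rw [hM1, ← coe_aeval_eq_eval, ← coe_aeval_eq_eval, RingHom.coe_coe, RingHom.coe_coe, ← AlgHom.comp_apply,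
      comp_aeval]
    congr 2; funext i; rcases i with i | i <;> simp
  have hd1 : ∀ v, (dd v f).totalDegree ≤ d := fun v => dd_deg v f d (by omega)
  refine ⟨β, γ, M1 * ∏ p ∈ T, N p, fun i => (hβ i).trans ?_, fun i => (hγ i).trans ?_, ?_, ?_, fun y hy hyM => ?_⟩
  · exact_mod_cast Nat.le_add_right _ _
  · have : d * d * d ≤ GD d := (Nat.le_mul_of_pos_right _ (by omega)).trans (Nat.le_add_left _ _)
    exact_mod_cast this
  · refine (totalDegree_mul _ _).trans (add_le_add ?_ ?_)
    · rw [hM1]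
      refine (((aeval_deg MM1 _ 1 ?_).trans (mul_one _).le).trans hMM).trans (Nat.le_add_left _ _)
      rintro (i | i) <;> simp
    · refine (totalDegree_prod_le T N (d * d) fun p _ => ?_).trans ((Nat.mul_le_mul_right _ hTc).trans_eq (by ring))
      rw [hN]
      have hC : ∀ (a : K) (P : MvPolynomial (Fin (m + 3)) K), P.totalDegree ≤ d → (C a * P).totalDegree ≤ d := fun a P h =>
        (totalDegree_mul _ _).trans (by rw [totalDegree_C, zero_add]; exact h)
      refine (aeval_deg f _ d fun i => ?_).trans (by rw [hfd])
      refine (totalDegree_add _ _).trans (max_le (by rw [totalDegree_X]; omega) (hC _ _ ?_))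
      exact (totalDegree_sub _ _).trans (max_le (hC _ _ (hd1 _)) (hC _ _ (hd1 _)))
  · intro h
    rcases hp.dvd_or_dvd h with ⟨q, hq⟩ | h
    · have := congrArg (eval y0) hq
      rw [map_mul, hy0, zero_mul, evS] at this
      apply h3
      rw [← this, ← coe_aeval_eq_eval, ← coe_aeval_eq_eval, RingHom.coe_coe, RingHom.coe_coe, ← AlgHom.comp_apply,
        comp_aeval]
      congr 2; funext i; rcases i with i | i <;> simp
    · obtain ⟨p, hpT, h⟩ := (hp.dvd_finsetProd_iff N).1 h
      rw [hN] at h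
      exact (hQ p ((hTm p).1 hpT)).2.2 g (hγ0 p hpT) h
  rw [map_mul, map_prod] at hyM
  have hyN := Finset.prod_ne_zero_iff.1 (right_ne_zero_of_mul hyM)
  rw [← hb, ← hg, ← hΦ]
  refine ⟨fun G H e hG => ?_, fun l1 l2 h s u hsu hl => ?_⟩
  · by_contra hH
    refine left_ne_zero_of_mul hyM ?_
    rw [evS, hMM1]
    exact crit y b f d _ hm r G H e hH hG
  obtain ⟨h, hh, h4⟩ : ∃ h ∈ I, onLine (w1 l1 b) (w2 l2 g) h = 0 := by
    refine Finset.prod_eq_zero_iff.1 (Polynomial.funext fun x => ?_ : ∏ h ∈ I, onLine (w1 l1 b) (w2 l2 g) h = 0)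
    obtain ⟨k, hk, hk0⟩ := hI0 _ (h 1 x)
    rw [Polynomial.eval_prod, Polynomial.eval_zero]
    refine Finset.prod_eq_zero hk ?_
    rw [onLine_eval]; simpa using hk0
  have h5 : eval (w1 l1 b) h = 0 := by
    have := onLine_eval (w1 l1 b) (w2 l2 g) h 0
    rw [h4] at this
    simpa using this.symm
  have h6 : eval (w1 l1 b) (dd (w2 l2 g) h) = 0 := by
    have := onLine_eval (w1 l1 b) (w2 l2 g) (dd (w2 l2 g) h) 0
    rw [← dd_onLine, h4] at this
    simpa using this.symm
  have h7 : s * eval y (dd (w1 l1 b) f) + u * eval y (dd (w2 l2 g) f) = 0 := by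
    have := onLine_eval y (fun i => s * w1 l1 b i + u * w2 l2 g i) (dd (fun i => s * w1 l1 b i + u * w2 l2 g i) f) 0
    rw [← dd_onLine, hl] at this
    have h8 : eval y (dd (fun i => s * w1 l1 b i + u * w2 l2 g i) f) = 0 := by simpa using this.symm
    rw [← h8, eval_dd, eval_dd, eval_dd, Finset.mul_sum, Finset.mul_sum, ← Finset.sum_add_distrib]
    exact Finset.sum_congr rfl fun _ _ => by ring
  have h8 := hyN (h, l1) ((hTm _).2 ⟨hh, h5⟩)
  rw [hN] at h8
  obtain ⟨α, hα⟩ : ∃ α, α = eval (w1 l1 b) (pderiv 0 h) := ⟨_, rfl⟩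
  have hw : w2 l2 g = fun i => b2 g i + l2 * e0 i := funext fun i => by
    refine Fin.cases ?_ (fun i => ?_) i <;> simp [w2, b2, e0]
  have h9 : LL α (fun i => eval (w1 l1 b) (pderiv i h)) (b2 g) = fun i => α * w2 l2 g i := by
    have h10 : ∑ i, eval (w1 l1 b) (pderiv i h) * b2 g i = - (l2 * α) := by
      rw [eval_dd, hw] at h6
      simp only [add_mul, Finset.sum_add_distrib] at h6
      rw [Fin.sum_univ_succ (fun i => l2 * e0 i * _)] at h6
      simp only [mul_comm (eval _ _)]
      rw [hα]
      have : ∀ i : Fin (m + 2), (e0 : Fin (m + 3) → K) i.succ = 0 := fun i => rfl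
      simp only [this, mul_zero, zero_mul, Finset.sum_const_zero] at h6
      have : (e0 : Fin (m + 3) → K) 0 = 1 := rfl
      rw [this] at h6
      linear_combination h6
    funext i
    rw [LL, h10, hw]; ring
  simp only [← hα] at h8
  rw [h9, M2, ev_ae] at h8
  have h10 : eval y (dd (fun i => α * w2 l2 g i) f) = α * eval y (dd (w2 l2 g) f) := by
    rw [eval_dd, eval_dd, Finset.mul_sum]
    exact Finset.sum_congr rfl fun _ _ => by ring
  apply h8
  rcases hsu with hs | hu
  · have := onLine_eval y (fun i => s * w1 l1 b i + u * w2 l2 g i) f (t (h, l1) * α * eval y (dd (w2 l2 g) f) / s)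
    rw [hl, Polynomial.eval_zero] at this
    rw [this]
    congr 2; funext i
    simp only [map_add, map_sub, map_mul, eval_C, eval_X, h10]
    field_simp
    linear_combination (- t (h, l1) * α * w2 l2 g i) * h7
  · have := onLine_eval y (fun i => s * w1 l1 b i + u * w2 l2 g i) f (- t (h, l1) * α * eval y (dd (w1 l1 b) f) / u)
    rw [hl, Polynomial.eval_zero] at this
    rw [this]
    congr 2; funext i
    simp only [map_add, map_sub, map_mul, eval_C, eval_X, h10]
    field_simp
    linear_combination (t (h, l1) * α * w1 l1 b i) * h7
end
end Sal

namespace Sal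
section
variable {K : Type*} [Field K] {m : ℕ}

lemma e0_0 : (e0 : Fin (m + 1) → K) 0 = 1 := rfl
lemma e0_1 : (e0 : Fin (m + 2) → K) 1 = 0 := rfl
lemma e0_2 : (e0 : Fin 3 → K) 2 = 0 := rfl
lemma e0_s (i) : (e0 : Fin (m + 1) → K) (Fin.succ i) = 0 := rfl

/-- parametrisation of a three dimensional slice -/
noncomputable def sl {R : Type*} [CommRing R] (c β : Fin (m + 1) → R) (γ : Fin m → R) :
    Fin (m + 3) → MvPolynomial (Fin 3) R := Fin.cons (X 0) (Fin.cons (X 1) fun j =>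
      C (c j) + X 1 * C (β j) + X 2 * C ((Fin.cons 1 γ : Fin (m + 1) → R) j))

/-- its linear part -/
def slL (β : Fin (m + 1) → K) (γ : Fin m → K) (q : Fin 3 → K) : Fin (m + 3) → K :=
  Fin.cons (q 0) (Fin.cons (q 1) fun j => q 1 * β j + q 2 * (Fin.cons 1 γ : Fin (m + 1) → K) j)

lemma sl_lin (c β : Fin (m + 1) → K) (γ : Fin m → K) (p q : Fin 3 → K) (i) : onLine p q (sl c β γ i) =
    Polynomial.C (eval p (sl c β γ i)) + Polynomial.X * Polynomial.C (slL β γ q i) := by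
  refine Fin.cases ?_ (fun i => Fin.cases ?_ (fun i => ?_) i) i
  · simp [sl, slL, onLine]
  · simp only [sl, slL, Fin.cons_succ, Fin.cons_zero]; simp [onLine]
  · simp only [sl, slL, Fin.cons_succ]; simp [onLine]; ring

lemma sl_onLine (c β : Fin (m + 1) → K) (γ : Fin m → K) (p q : Fin 3 → K) (f : MvPolynomial (Fin (m + 3)) K) :
    onLine p q (aeval (sl c β γ) f) = onLine (fun i => eval p (sl c β γ i)) (slL β γ q) f := by
  rw [onLine_aeval]; simp only [sl_lin]; rfl

lemma sl_mon (c β : Fin (m + 1) → K) (γ : Fin m → K) {f : MvPolynomial (Fin (m + 3)) K} {d : ℕ} (hf : mon f d) :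
    mon (aeval (sl c β γ) f) d := by
  refine mon_sub _ (fun i => ?_) (fun x i => ?_) f hf
  · refine Fin.cases ?_ (fun i => Fin.cases ?_ (fun i => ?_) i) i
    · simp [sl]
    · simp [sl]
    · refine (totalDegree_add _ _).trans (max_le ((totalDegree_add _ _).trans (max_le (by simp) ?_)) ?_) <;>
        exact (totalDegree_mul _ _).trans (by rw [totalDegree_C, totalDegree_X])
  · rw [sl_lin]
    congr 3
    refine Fin.cases ?_ (fun i => Fin.cases ?_ (fun i => ?_) i) i <;> simp [slL, e0_0, e0_1, e0_2, e0_s]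

lemma sl_top (c β : Fin (m + 1) → K) (γ : Fin m → K) {f : MvPolynomial (Fin (m + 3)) K} {d : ℕ} (hf : mon f d)
    (q : Fin 3 → K) : eval q (homogeneousComponent d (aeval (sl c β γ) f)) =
      eval (slL β γ q) (homogeneousComponent d f) := by
  rw [← onLine_coeff 0 q _ d (sl_mon c β γ hf).1, sl_onLine, onLine_coeff _ _ _ _ hf.1]

variable [CharZero K] [IsAlgClosed K]

lemma badK (F : MvPolynomial (Fin 3) K) (d : ℕ) (hd : d ≠ 0) (hm : mon F d) (p v : Fin 3 → K) (hv : v ≠ 0)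
    (hl : onLine p v F = 0) (h : dd v F = 0 ∨ ∃ l, l.totalDegree = 1 ∧ l ∣ homogeneousComponent d F ∧ eval v l = 0) :
    ∃ l1 l2, (∀ x w, eval ![x * l1 + w * l2, x, w] (homogeneousComponent d F) = 0) ∧
      v 0 = v 1 * l1 + v 2 * l2 ∧ (v 1 ≠ 0 ∨ v 2 ≠ 0) := by
  have hΦm := mon_top hm
  have hΦh := homogeneousComponent_isHomogeneous d F
  obtain ⟨Φ, hΦ⟩ : ∃ Φ, Φ = homogeneousComponent d F := ⟨_, rfl⟩
  have hco : ∀ q, (onLine 0 q F).coeff d = eval q Φ := fun q => by rw [hΦ, onLine_coeff _ _ _ _ hm.1]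
  have hst : v 1 ≠ 0 ∨ v 2 ≠ 0 := by
    by_contra! hst
    have h1 := congrArg (fun P => Polynomial.coeff P d) hl
    simp only [onLine_coeff p v F d hm.1, Polynomial.coeff_zero, ← hΦ] at h1
    have h2 : v = fun i => v 0 * e0 i := by
      funext i; fin_cases i <;> simp [e0_0, e0_1, e0_2, hst.1, hst.2]
    rw [h2, hom_eval_smul Φ (hΦ ▸ hΦh), ← hco] at h1
    rcases mul_eq_zero.1 h1 with h3 | h3
    · refine hv (h2.trans ?_)
      rw [eq_zero_of_pow_eq_zero h3]; simp; rfl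
    · exact hm.2 0 h3
  rw [← hΦ] at h hΦm hΦh ⊢
  rcases h with h | ⟨l, hl1, ⟨g, hg⟩, hlv⟩
  · have hinv : ∀ q t, eval (fun i => q i + t * v i) Φ = eval q Φ := fun q t => by
      rw [← hco, ← hco]
      congr 1
      refine Polynomial.funext fun T => ?_
      rw [onLine_eval, onLine_eval]
      have h3 := dd_onLine (fun i => T * q i) v F
      rw [h, show onLine _ _ (0 : MvPolynomial (Fin 3) K) = 0 from map_zero _] at h3
      have h4 := Polynomial.eq_C_of_derivative_eq_zero h3
      have h5 := onLine_eval (fun i => T * q i) v F (T * t)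
      have h6 := onLine_eval (fun i => T * q i) v F 0
      rw [h4, Polynomial.eval_C] at h5 h6
      refine Eq.trans ?_ ((h5.symm.trans h6).trans ?_) <;> congr 2 <;> funext i
      · rw [Pi.zero_apply]; ring
      · rw [Pi.zero_apply]; ring
    have key : ∀ w q, eval w Φ = 0 → ∀ a b, (∀ i, q i = a * w i + b * v i) → eval q Φ = 0 := fun w q hw a b hq => by
      rw [_root_.funext hq, hinv, hom_eval_smul Φ hΦh, hw, mul_zero]
    rcases hst with hs | hs
    · obtain ⟨l2, hl2⟩ := mon_root hΦm hd ![0, 1]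
      refine ⟨(v 0 - l2 * v 2) / v 1, l2, fun x w => key _ _ hl2 (w - x * v 2 / v 1) (x / v 1) fun i => ?_, ?_, Or.inl hs⟩
      · fin_cases i <;> simp [Matrix.vecHead] <;> field_simp <;> ring
      · field_simp; ring
    · obtain ⟨l1, hl1⟩ := mon_root hΦm hd ![1, 0]
      refine ⟨l1, (v 0 - l1 * v 1) / v 2, fun x w => key _ _ hl1 (x - w * v 1 / v 2) (w / v 2) fun i => ?_, ?_, Or.inr hs⟩
      · fin_cases i <;> simp [Matrix.vecHead] <;> field_simp <;> ring
      · field_simp; ring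
  · have hlm := mon_mul (hg ▸ hΦm)
    have hlh := homog_dvd Φ l hΦh (mon_ne hΦm) ⟨g, hg⟩
    rw [hl1] at hlm hlh
    have h0 : coeff 0 l = 0 := by
      have h1 := hom_eval_smul l hlh 0 0
      rw [lin_eval l hl1.le] at h1
      simpa using h1
    have he : ∀ q : Fin 3 → K, eval q l = coeff (Finsupp.single 0 1) l * q 0 + coeff (Finsupp.single 1 1) l * q 1 +
        coeff (Finsupp.single 2 1) l * q 2 := fun q => by
      rw [lin_eval l hl1.le, h0, zero_add, Fin.sum_univ_three]
    have hc : coeff (Finsupp.single 0 1) l ≠ 0 := fun hc => by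
      have h2 := hlm.2 0
      rw [onLine_coeff _ _ _ _ hl1.le, homogeneousComponent_of_mem hlh, if_pos rfl, he, hc] at h2
      exact h2 (by simp [e0_1, e0_2])
    rw [he] at hlv
    refine ⟨-(coeff (Finsupp.single 1 1) l) / coeff (Finsupp.single 0 1) l,
      -(coeff (Finsupp.single 2 1) l) / coeff (Finsupp.single 0 1) l, fun x w => ?_, ?_, hst⟩
    · rw [hg, map_mul, he]
      simp only [Matrix.cons_val]
      field_simp; ring
    · field_simp; linear_combination hlv

lemma slIrr (f : MvPolynomial (Fin (m + 3)) K) (d : ℕ) (hd : d ≠ 0) (hm : mon f d) (c β : Fin (m + 1) → K)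
    (γ : Fin m → K) (y : Fin (m + 3) → K) (p : Fin 3 → K) (hp : (fun i => eval p (sl c β γ i)) = y) (hy : eval y f = 0)
    (hA : ∀ G H, aeval (th2 y β) f = G * H → eval ![y 0, y 1] G = 0 → H.totalDegree = 0) :
    Irreducible (aeval (sl c β γ) f) := by
  have hF := sl_mon c β γ hm
  have key : ∀ G H, aeval (sl c β γ) f = G * H → eval p G = 0 → IsUnit H := fun G H e hG => by
    obtain ⟨σ, hσ⟩ : ∃ σ : Fin 3 → MvPolynomial (Fin 2) K, σ = ![X 0, X 1, C (p 2)] := ⟨_, rfl⟩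
    have hH : mon H H.totalDegree := mon_mul (g := H) (h := G) (mul_comm H G ▸ e ▸ hF)
    have h1 : mon (aeval σ H) H.totalDegree := by
      refine mon_sub σ (fun i => ?_) (fun x i => ?_) H hH
      · fin_cases i <;> simp [hσ]
      · fin_cases i <;> simp [hσ, onLine, e0_0, e0_1, e0_2]
    have y0 : p 0 = y 0 := by rw [← hp]; simp [sl]
    have y1 : p 1 = y 1 := by rw [← hp]; simp [sl]
    have h2 := hA (aeval σ G) (aeval σ H) (by
      rw [← map_mul, ← e, ← AlgHom.comp_apply, comp_aeval]
      congr 2; funext i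
      refine Fin.cases ?_ (fun i => Fin.cases ?_ (fun i => ?_) i) i
      · simp [sl, th2, hσ]
      · simp [sl, th2, hσ]
      · rw [← hp]
        simp only [sl, th2, Fin.cons_succ]
        simp [hσ, y1]; ring) (by
      rw [ev_ae, ← hG]; congr 2; funext i; fin_cases i <;> simp [hσ, y0, y1])
    rw [mon_deg h1] at h2
    have h3 := totalDegree_eq_zero_iff_eq_C.1 h2
    rw [h3]
    exact (IsUnit.mk0 _ fun h => mon_ne hH (by rw [h3, h, map_zero])).map C
  refine ⟨fun h => hd ?_, fun {G H} e => ?_⟩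
  · rw [← mon_deg hF]
    exact (isUnit_iff_totalDegree_of_isReduced.1 h).2
  · have h1 : eval p G * eval p H = 0 := by rw [← map_mul, ← e, ev_ae, hp, hy]
    rcases mul_eq_zero.1 h1 with h | h
    · exact Or.inr (key _ _ e h)
    · exact Or.inl (key _ _ (e.trans (mul_comm _ _)) h)
end
end Sal

namespace Sal
section
variable {k K : Type*} [Field k] [Field K] {m : ℕ}

lemma onLine_map {R S : Type*} [CommRing R] [CommRing S] {n : ℕ} (φ : R →+* S) (x v : Fin n → R)
    (f : MvPolynomial (Fin n) R) :
    onLine (fun i => φ (x i)) (fun i => φ (v i)) (map φ f) = (onLine x v f).map φ := by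
  unfold onLine
  induction f using MvPolynomial.induction_on with
  | C a => simp
  | add p q hp hq => simp only [map_add, hp, hq, Polynomial.map_add]
  | mul_X p i hp => simp only [map_mul, hp, Polynomial.map_mul, map_X, aeval_X]; simp

lemma homComp_map {R S : Type*} [CommRing R] [CommRing S] {σ : Type*} (φ : R →+* S) (d : ℕ)
    (f : MvPolynomial σ R) :
    homogeneousComponent d (map φ f) = map φ (homogeneousComponent d f) := by
  ext a
  rw [coeff_homogeneousComponent, coeff_map, coeff_map, coeff_homogeneousComponent]
  split_ifs <;> simp

lemma mon_iff {f : MvPolynomial (Fin (m + 1)) K} {d : ℕ} :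
    mon f d ↔ f.totalDegree ≤ d ∧ eval e0 (homogeneousComponent d f) ≠ 0 := by
  constructor
  · rintro ⟨h, h2⟩; exact ⟨h, by rw [← onLine_coeff 0 _ _ _ h]; exact h2 0⟩
  · rintro ⟨h, h2⟩; exact ⟨h, fun x => by rwa [onLine_coeff _ _ _ _ h]⟩

lemma eval_mapφ {R S : Type*} [CommRing R] [CommRing S] {n : ℕ} (φ : R →+* S) (x : Fin n → R)
    (f : MvPolynomial (Fin n) R) : eval (fun i => φ (x i)) (map φ f) = φ (eval x f) := by
  induction f using MvPolynomial.induction_on with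
  | C a => simp
  | add p q hp hq => simp only [map_add, hp, hq]
  | mul_X p i hp => simp only [map_mul, hp, map_X, eval_X]

lemma mon_map (φ : k →+* K) {f : MvPolynomial (Fin (m + 1)) k} {d : ℕ} (hf : mon f d) :
    mon (map φ f) d := by
  rw [mon_iff] at *
  refine ⟨(totalDegree_map_inj φ φ.injective f).le.trans hf.1, ?_⟩
  have he : (e0 : Fin (m + 1) → K) = fun i => φ (e0 i) := by
    refine funext fun i => Fin.cases ?_ (fun i => ?_) i <;> simp [e0]
  rw [homComp_map, he, eval_mapφ]
  simpa using hf.2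

lemma irr_desc (φ : k →+* K) {n : ℕ} (f : MvPolynomial (Fin n) k) (h : Irreducible (map φ f)) :
    Irreducible f := by
  have hu : ∀ g : MvPolynomial (Fin n) k, IsUnit (map φ g) → IsUnit g := by
    intro g hg
    rw [isUnit_iff_totalDegree_of_isReduced] at hg ⊢
    rw [totalDegree_map_inj φ φ.injective, coeff_map] at hg
    refine ⟨?_, hg.2⟩
    have := hg.1
    simpa using this
  constructor
  · intro h'; exact h.1 (h'.map (map φ))
  · intro a b hab
    rcases h.2 (by rw [hab, map_mul]) with h1 | h1
    · exact Or.inl (hu _ h1)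
    · exact Or.inr (hu _ h1)

lemma dd_map (φ : k →+* K) {n : ℕ} (v : Fin n → k) (f : MvPolynomial (Fin n) k) :
    dd (fun i => φ (v i)) (map φ f) = map φ (dd v f) := by
  simp [dd, pderiv_map]

lemma sl_map {R S : Type*} [CommRing R] [CommRing S] (φ : R →+* S) (c β : Fin (m + 1) → R) (γ : Fin m → R) (i) :
    map φ (sl c β γ i) = sl (fun i => φ (c i)) (fun i => φ (β i)) (fun i => φ (γ i)) i := by
  refine Fin.cases ?_ (fun i => Fin.cases ?_ (fun i => ?_) i) i
  · simp [sl]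
  · simp [sl]
  · simp only [sl, Fin.cons_succ]
    refine Fin.cases ?_ (fun i => ?_) i <;> simp

lemma slf_map {R S : Type*} [CommRing R] [CommRing S] (φ : R →+* S) (c β : Fin (m + 1) → R) (γ : Fin m → R)
    (f : MvPolynomial (Fin (m + 3)) R) : map φ (aeval (sl c β γ) f) =
      aeval (sl (fun i => φ (c i)) (fun i => φ (β i)) (fun i => φ (γ i))) (map φ f) := by
  have := map_bind₁ φ (sl c β γ) f
  simp only [sl_map] at this
  exact this

lemma good [CharZero K] [IsAlgClosed K] (f : MvPolynomial (Fin (m + 3)) ℤ) (d : ℕ) (hd : d ≠ 0)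
    (hm : mon (map (Int.castRingHom ℚ) f) d) (c β : Fin (m + 1) → ℤ) (γ : Fin m → ℤ)
    (y : Fin (m + 3) → ℤ) (p : Fin 3 → ℤ) (hp : (fun i => eval p (sl c β γ i)) = y) (hy : eval y f = 0)
    (hA : ∀ G H, aeval (th2 (fun i => (y i : K)) fun i => (β i : K)) (map (Int.castRingHom K) f) = G * H →
      eval ![(y 0 : K), (y 1 : K)] G = 0 → H.totalDegree = 0)
    (hB : ∀ l1 l2, (∀ x w, eval (fun i => x * w1 l1 (fun i => (β i : K)) i + w * w2 l2 (fun i => (γ i : K)) i)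
        (homogeneousComponent d (map (Int.castRingHom K) f)) = 0) → ∀ s u, (s ≠ 0 ∨ u ≠ 0) →
        onLine (fun i => (y i : K)) (fun i => s * w1 l1 (fun i => (β i : K)) i + u * w2 l2 (fun i => (γ i : K)) i)
          (map (Int.castRingHom K) f) ≠ 0)
    (F : MvPolynomial (Fin 3) ℤ) (hF : F = aeval (sl c β γ) f) :
    F.totalDegree = d ∧ Irreducible (map (Int.castRingHom ℚ) F) ∧
    (∃ c : ℚ, c ≠ 0 ∧ (uni 0 (map (Int.castRingHom ℚ) F)).coeff d = C c) ∧ eval p F = 0 ∧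
    ¬ bad (map (Int.castRingHom ℚ) F) p := by
  have hQK : ∀ {n : ℕ} (g : MvPolynomial (Fin n) ℤ), map (Int.castRingHom K) g =
      map (Rat.castHom K) (map (Int.castRingHom ℚ) g) := fun g => by
    rw [map_map, RingHom.ext_int ((Rat.castHom K).comp (Int.castRingHom ℚ)) (Int.castRingHom K)]
  have hmK : mon (map (Int.castRingHom K) f) d := by rw [hQK]; exact mon_map _ hm
  have hFQ : map (Int.castRingHom ℚ) F = aeval (sl (fun i => (c i : ℚ)) (fun i => (β i : ℚ)) (fun i => (γ i : ℚ)))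
      (map (Int.castRingHom ℚ) f) := by rw [hF, slf_map]; rfl
  have hFK : map (Int.castRingHom K) F = aeval (sl (fun i => (c i : K)) (fun i => (β i : K)) (fun i => (γ i : K)))
      (map (Int.castRingHom K) f) := by rw [hF, slf_map]; rfl
  have hFm : mon (map (Int.castRingHom ℚ) F) d := by rw [hFQ]; exact sl_mon _ _ _ hm
  have hFmK : mon (map (Int.castRingHom K) F) d := by rw [hQK]; exact mon_map _ hFm
  have hpK : (fun i => eval (fun i => (p i : K)) (sl (fun i => (c i : K)) (fun i => (β i : K))
      (fun i => (γ i : K)) i)) = fun i => (y i : K) := by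
    refine funext fun i => ?_
    have := sl_map (Int.castRingHom K) c β γ i
    simp only [eq_intCast] at this
    rw [← this, eval_cast, ← hp]
  have hyK : eval (fun i => (y i : K)) (map (Int.castRingHom K) f) = 0 := (eval_cast_zero f y).2 hy
  have hirr : Irreducible (map (Int.castRingHom K) F) := by
    rw [hFK]
    exact slIrr _ d hd hmK _ _ _ _ _ hpK hyK hA
  have hdQ := mon_deg hFm
  refine ⟨?_, ?_, mon_uni hFm, ?_, ?_⟩
  · rw [← hdQ, totalDegree_map_inj _ (RingHom.injective_int _)]
  · refine irr_desc (Rat.castHom K) _ ?_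
    rwa [← hQK]
  · have := ev_ae (fun i => (p i : K)) (sl (fun i => (c i : K)) (fun i => (β i : K)) (fun i => (γ i : K)))
      (map (Int.castRingHom K) f)
    rw [← hFK, hpK, hyK] at this
    exact (eval_cast_zero F p).1 this
  · rintro ⟨v, hv, hl, h⟩
    obtain ⟨φ, hφ⟩ : ∃ φ, φ = Rat.castHom K := ⟨_, rfl⟩
    obtain ⟨V, hV⟩ : ∃ V : Fin 3 → K, V = fun i => φ (v i) := ⟨_, rfl⟩
    have hV0 : V ≠ 0 := fun h => hv (funext fun i => by
      have := congrFun h i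
      rw [hV] at this
      simpa using this)
    have hL : onLine (fun i => (p i : K)) V (map (Int.castRingHom K) F) = 0 := by
      have := onLine_map φ (fun i => (p i : ℚ)) v (map (Int.castRingHom ℚ) F)
      rw [hl, hφ, ← hQK, Polynomial.map_zero] at this
      rw [hV, hφ, ← this]
      simp
    obtain ⟨l1, l2, h1, h2, h3⟩ := badK _ d hd hFmK _ V hV0 hL (by
      rcases h with h | ⟨l, hli, hl1, hld, hl0⟩
      · left
        rw [hV, hQK, ← hφ, dd_map, h, map_zero]
      · right
        refine ⟨map φ l, ?_, ?_, ?_⟩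
        · rw [totalDegree_map_inj φ φ.injective]
          exact le_antisymm hl1 (irr_deg l hli)
        · rw [hQK, ← hφ, homComp_map]
          rw [hdQ] at hld
          exact _root_.map_dvd (map φ) hld
        · rw [hV, eval_mapφ, hl0, map_zero])
    have key : ∀ x w, slL (fun i => (β i : K)) (fun i => (γ i : K)) ![x * l1 + w * l2, x, w] =
        fun i => x * w1 l1 (fun i => (β i : K)) i + w * w2 l2 (fun i => (γ i : K)) i := fun x w => by
      refine funext fun i => ?_
      refine Fin.cases ?_ (fun i => Fin.cases ?_ (fun i => ?_) i) i
      · simp [slL, w1, w2]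
      · simp [slL, w1, w2]
      · simp only [slL, w1, w2, Fin.cons_succ]; simp
    refine hB l1 l2 (fun x w => ?_) (V 1) (V 2) h3 ?_
    · rw [← key, ← sl_top (fun i => (c i : K)) _ _ hmK, ← hFK, h1]
    · have e : V = ![V 1 * l1 + V 2 * l2, V 1, V 2] := by
        refine funext fun i => ?_
        fin_cases i
        · exact h2
        · rfl
        · rfl
      rw [← key, ← e, ← hpK, ← sl_onLine, ← hFK, hL]

end
end Sal

namespace Sal

lemma slice_pt {m : ℕ} (β : Fin (m + 1) → ℤ) (γ : Fin m → ℤ) (y : Fin (m + 3) → ℤ) (q : ℤ)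
    (hq : q = y 2 - y 1 * β 0) (c' : Fin m → ℤ)
    (hc : ∀ j, c' j = y j.succ.succ.succ - y 1 * β j.succ - q * γ j) :
    (fun i => eval ![y 0, y 1, q] (sl (Fin.cons 0 c' : Fin (m + 1) → ℤ) β γ i)) = y := by
  refine funext fun i => Fin.cases ?_ (fun i => Fin.cases ?_ (fun i => ?_) i) i
  · simp [sl]
  · simp [sl]
  · simp only [sl, Fin.cons_succ]
    refine Fin.cases ?_ (fun i => ?_) i
    · simp [hq]
    · simp [hc]; ring

lemma count_mon {K : Type*} [Field K] [CharZero K] [IsAlgClosed K] (m d : ℕ) (hd : 4 ≤ d) (ε : ℝ) (hε : 0 < ε) :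
    ∃ C : ℝ, 0 ≤ C ∧ ∀ N : ℕ, 1 ≤ N → ∀ f : MvPolynomial (Fin (m + 3)) ℤ, mon (map (Int.castRingHom ℚ) f) d →
      mon (map (Int.castRingHom K) f) d →
      Irreducible (map (Int.castRingHom K) f) → Inf (map (Int.castRingHom K) f) →
      ∀ S : Finset (Fin (m + 3) → ℤ), (∀ y ∈ S, (∀ i, |y i| ≤ N) ∧ eval y f = 0) →
      (S.card : ℝ) ≤ C * (N : ℝ) ^ ((m : ℝ) + 1 + ε) := by
  classical
  obtain ⟨C', hC', h3⟩ := thm3 d hd ε hε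
  obtain ⟨D, hD⟩ : ∃ D, D = GD d + d := ⟨_, rfl⟩
  obtain ⟨E, hE⟩ : ∃ E, E = (1 + GD d) ^ 2 := ⟨_, rfl⟩
  have hE1 : 1 ≤ E := hE ▸ Nat.one_le_pow _ _ (by omega)
  refine ⟨C' * (E : ℝ) ^ (1 + ε) * (3 * E : ℝ) ^ m + (D * (2 * D * D + D) : ℕ) * 3 ^ (m + 1), by positivity, ?_⟩
  intro N hN f hmQ hmK hirr hInf S hS
  obtain ⟨β, γ, M, hβ, hγ, hMd, hMn, hM⟩ := gen _ d (by omega) hmK hirr hInf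
  have hNr : (1 : ℝ) ≤ N := by exact_mod_cast hN
  have hEr : (1 : ℝ) ≤ E := by exact_mod_cast hE1
  -- the bad part
  obtain ⟨c0, hc0, hc1⟩ := mon_uni hmK
  have hb : ((S.filter fun y => eval (fun i => (y i : K)) M = 0).card : ℝ) ≤
      ((D * (2 * D * D + D) : ℕ) * 3 ^ (m + 1)) * (N : ℝ) ^ ((m : ℝ) + 1 + ε) := by
    have h := codim2 (m := m + 1) _ M hirr hMn D (by rw [mon_deg hmK]; omega) (by omega) ⟨_, c0, hc0, hc1⟩ N
      (S.filter fun y => eval (fun i => (y i : K)) M = 0) (by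
        intro y hy
        obtain ⟨hy1, hy2⟩ := Finset.mem_filter.1 hy
        exact ⟨(hS y hy1).1, (eval_cast_zero f y).2 (hS y hy1).2, hy2⟩)
    have h' : (S.filter fun y => eval (fun i => (y i : K)) M = 0).card ≤
        D * ((2 * D * D + D) * (3 * N) ^ (m + 1)) :=
      h.trans (by gcongr; omega)
    have h2 : (((S.filter fun y => eval (fun i => (y i : K)) M = 0).card : ℕ) : ℝ) ≤
      ((D * ((2 * D * D + D) * (3 * N) ^ (m + 1)) : ℕ) : ℝ) := by exact_mod_cast h'
    refine h2.trans ?_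
    have h4 : (N : ℝ) ^ (m + 1) ≤ (N : ℝ) ^ ((m : ℝ) + 1 + ε) := by
      rw [← Real.rpow_natCast]
      exact Real.rpow_le_rpow_of_exponent_le hNr (by push_cast; linarith)
    calc ((D * ((2 * D * D + D) * (3 * N) ^ (m + 1)) : ℕ) : ℝ) =
        ((D * (2 * D * D + D) : ℕ) * 3 ^ (m + 1)) * (N : ℝ) ^ (m + 1) := by push_cast; ring
      _ ≤ _ := by gcongr
  -- the good part
  obtain ⟨T, hT⟩ : ∃ T, T = S.filter fun y => ¬ eval (fun i => (y i : K)) M = 0 := ⟨_, rfl⟩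
  obtain ⟨q, hq⟩ : ∃ q : (Fin (m + 3) → ℤ) → ℤ, ∀ y, q y = y 2 - y 1 * β 0 := ⟨_, fun y => rfl⟩
  obtain ⟨c', hc'⟩ : ∃ c' : (Fin (m + 3) → ℤ) → Fin m → ℤ, ∀ y j, c' y j =
    y j.succ.succ.succ - y 1 * β j.succ - q y * γ j := ⟨_, fun y j => rfl⟩
  have hpt := fun y => slice_pt β γ y (q y) (hq y) (c' y) (hc' y)
  have hqb : ∀ y ∈ T, |q y| ≤ N * (1 + GD d) ∧ ∀ j, |c' y j| ≤ N * E := by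
    intro y hy
    rw [hT, Finset.mem_filter] at hy
    obtain ⟨hyb, -⟩ := hS y hy.1
    have hp : ∀ i, |y 1 * β i| ≤ N * GD d := fun i => by
      rw [abs_mul]; exact mul_le_mul (hyb 1) (hβ i) (abs_nonneg _) (by positivity)
    have h1 : |q y| ≤ N * (1 + GD d) := by
      rw [hq]
      exact (abs_sub _ _).trans (by linarith [hp 0, hyb 2])
    refine ⟨h1, fun j => ?_⟩
    rw [hc']
    have h2 : |q y * γ j| ≤ N * (1 + GD d) * GD d := by
      rw [abs_mul]; exact mul_le_mul h1 (hγ j) (abs_nonneg _) (by positivity)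
    refine (abs_sub _ _).trans ((add_le_add ((abs_sub _ _).trans (add_le_add (hyb _) (hp _))) h2).trans ?_)
    rw [hE]; push_cast
    linarith
  have hfib : ∀ b ∈ box m (N * E), (T.filter fun y => c' y = b).card ≤ ⌊C' * ((N * E : ℕ) : ℝ) ^ (1 + ε)⌋₊ := by
    intro b _
    rcases (T.filter fun y => c' y = b).eq_empty_or_nonempty with he | ⟨y0, hy0⟩
    · rw [he]; simp
    obtain ⟨F, hF⟩ : ∃ F, F = aeval (sl (Fin.cons 0 b : Fin (m + 1) → ℤ) β γ) f := ⟨_, rfl⟩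
    have hg : ∀ y ∈ T.filter fun y => c' y = b, F.totalDegree = d ∧ Irreducible (map (Int.castRingHom ℚ) F) ∧
        (∃ c : ℚ, c ≠ 0 ∧ (uni 0 (map (Int.castRingHom ℚ) F)).coeff d = C c) ∧ eval ![y 0, y 1, q y] F = 0 ∧
        ¬ bad (map (Int.castRingHom ℚ) F) ![y 0, y 1, q y] := by
      intro y hy
      rw [Finset.mem_filter, hT, Finset.mem_filter] at hy
      obtain ⟨⟨hyS, hyM⟩, hyb⟩ := hy
      obtain ⟨hA, hB⟩ := hM _ ((eval_cast_zero f y).2 (hS y hyS).2) hyM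
      exact good (K := K) f d (by omega) hmQ (Fin.cons 0 b) β γ y _ (hyb ▸ hpt y) (hS y hyS).2 hA hB F hF
    obtain ⟨g1, g2, g3, -⟩ := hg y0 hy0
    have hcard : ((T.filter fun y => c' y = b).image fun y => ![y 0, y 1, q y]).card =
        (T.filter fun y => c' y = b).card := by
      refine Finset.card_image_of_injOn fun y hy z hz hyz => ?_
      have hy' := (Finset.mem_filter.1 (Finset.mem_coe.1 hy)).2
      have hz' := (Finset.mem_filter.1 (Finset.mem_coe.1 hz)).2
      have hyz : (![y 0, y 1, q y] : Fin 3 → ℤ) = ![z 0, z 1, q z] := hyz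
      rw [← hpt y, ← hpt z, hy', hz', hyz]
    rw [← hcard]
    refine Nat.le_floor (h3 (N * E) (Nat.mul_pos hN hE1) F g1 g2 g3 _ ?_)
    intro x hx
    obtain ⟨y, hy, rfl⟩ := Finset.mem_image.1 hx
    have hyT := (Finset.mem_filter.1 hy).1
    obtain ⟨-, -, -, g4, g5⟩ := hg y hy
    refine ⟨fun i => ?_, g4, g5⟩
    have hyb := (hS y (Finset.mem_filter.1 (hT ▸ hyT)).1).1
    have e1 : (N : ℤ) ≤ ((N * E : ℕ) : ℤ) := by exact_mod_cast Nat.le_mul_of_pos_right N hE1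
    have e2 : (N : ℤ) * (1 + GD d) ≤ ((N * E : ℕ) : ℤ) := by
      rw [hE]; push_cast
      refine mul_le_mul_of_nonneg_left ?_ (by positivity)
      nlinarith
    fin_cases i
    · exact (hyb 0).trans e1
    · exact (hyb 1).trans e1
    · exact (hqb y hyT).1.trans e2
  have hTc := Finset.card_le_mul_card_image_of_maps_to (s := T) (t := box m (N * E)) (f := c')
    (fun y hy => mem_box.2 fun j => by exact_mod_cast (hqb y hy).2 j) _ hfib
  have hbox : (box m (N * E)).card ≤ (3 * E * N) ^ m := by
    have hNE : 1 ≤ N * E := Nat.mul_pos hN hE1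
    have : (box m (N * E)).card = (2 * (N * E) + 1) ^ m := by
      simp only [box, Fintype.card_piFinset, Int.card_Icc, Finset.prod_const, Finset.card_univ, Fintype.card_fin]
      congr 1
      omega
    rw [this]
    gcongr
    nlinarith
  have hTr : (T.card : ℝ) ≤ (C' * (E : ℝ) ^ (1 + ε) * (3 * E : ℝ) ^ m) * (N : ℝ) ^ ((m : ℝ) + 1 + ε) := by
    have h4 : (T.card : ℝ) ≤ (⌊C' * ((N * E : ℕ) : ℝ) ^ (1 + ε)⌋₊ : ℝ) * ((3 * E * N) ^ m : ℕ) := by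
      exact_mod_cast hTc.trans (Nat.mul_le_mul_left _ hbox)
    refine h4.trans ?_
    have h5 : (⌊C' * ((N * E : ℕ) : ℝ) ^ (1 + ε)⌋₊ : ℝ) ≤ C' * ((N * E : ℕ) : ℝ) ^ (1 + ε) :=
      Nat.floor_le (by positivity)
    have h6 : (N : ℝ) ^ ((m : ℝ) + 1 + ε) = (N : ℝ) ^ (1 + ε) * (N : ℝ) ^ m := by
      rw [← Real.rpow_natCast, ← Real.rpow_add (by linarith)]; congr 1; ring
    refine (mul_le_mul_of_nonneg_right h5 (by positivity)).trans (le_of_eq ?_)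
    rw [h6]; push_cast
    rw [Real.mul_rpow (by positivity) (by positivity), mul_pow, mul_pow]
    ring
  have := Finset.card_filter_add_card_filter_not (s := S) (fun y => eval (fun i => (y i : K)) M = 0)
  rw [← this, Nat.cast_add]
  rw [← hT, add_mul, add_comm]
  exact add_le_add hTr hb

end Sal

namespace Sal

/-- shear as a linear equivalence -/
def shL {K : Type*} [Field K] {m : ℕ} (γ : Fin m → K) : (Fin (m + 1) → K) ≃ₗ[K] (Fin (m + 1) → K) where
  toFun y := Fin.cons (y 0) fun j => y j.succ + γ j * y 0
  invFun y := Fin.cons (y 0) fun j => y j.succ - γ j * y 0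
  map_add' x y := funext fun i => by
    refine Fin.cases ?_ (fun i => ?_) i
    · simp
    · simp; ring
  map_smul' c y := funext fun i => by
    refine Fin.cases ?_ (fun i => ?_) i
    · simp
    · simp; ring
  left_inv y := funext fun i => by
    refine Fin.cases ?_ (fun i => ?_) i <;> simp
  right_inv y := funext fun i => by
    refine Fin.cases ?_ (fun i => ?_) i <;> simp

lemma final {K : Type*} [Field K] [CharZero K] [IsAlgClosed K] (m d : ℕ) (hd : 4 ≤ d) (ε : ℝ) (hε : 0 < ε) :
    ∃ C : ℝ, 0 ≤ C ∧ ∀ f : MvPolynomial (Fin (m + 3)) ℤ, f.totalDegree = d →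
      Irreducible (map (Int.castRingHom K) f) →
      {S : AffineSubspace K (Fin (m + 3) → K) | Module.finrank K S.direction = m + 1 ∧
        ∀ y ∈ S, eval y (map (Int.castRingHom K) f) = 0}.Finite →
      ∀ N : ℕ, 1 ≤ N → ∀ S : Finset (Fin (m + 3) → ℤ), (∀ y ∈ S, (∀ i, |y i| ≤ N) ∧ eval y f = 0) →
      (S.card : ℝ) ≤ C * (N : ℝ) ^ ((m : ℝ) + 1 + ε) := by
  classical
  obtain ⟨C, hC, hc⟩ := count_mon (K := K) m d hd ε hε
  refine ⟨C * (1 + d : ℝ) ^ ((m : ℝ) + 1 + ε), by positivity, ?_⟩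
  intro f hfd hirr hfin N hN S hS
  have hQK : ∀ {n : ℕ} (g : MvPolynomial (Fin n) ℤ), map (Int.castRingHom K) g =
      map (Rat.castHom K) (map (Int.castRingHom ℚ) g) := fun g => by
    rw [map_map, RingHom.ext_int ((Rat.castHom K).comp (Int.castRingHom ℚ)) (Int.castRingHom K)]
  have hdQ : (map (Int.castRingHom ℚ) f).totalDegree = d := by
    rw [totalDegree_map_inj _ (RingHom.injective_int _), hfd]
  have hf0 : map (Int.castRingHom ℚ) f ≠ 0 := fun h => by rw [h, totalDegree_zero] at hdQ; omega
  obtain ⟨γ, hγ, c, hc0, hc1⟩ := shear_monic _ hf0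
  rw [hdQ] at hγ hc1
  obtain ⟨g, hg⟩ : ∃ g, g = shear γ f := ⟨_, rfl⟩
  have hgQ : map (Int.castRingHom ℚ) g = shear (fun j => (γ j : ℚ)) (map (Int.castRingHom ℚ) f) := by
    rw [hg, shear_map]; rfl
  have hgK : map (Int.castRingHom K) g = shear (fun j => (γ j : K)) (map (Int.castRingHom K) f) := by
    rw [hg, shear_map]; rfl
  have hgd : (map (Int.castRingHom ℚ) g).totalDegree ≤ d := by rw [hgQ, shear_deg, hdQ]
  have hmQ : mon (map (Int.castRingHom ℚ) g) d := by
    rw [mon_iff]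
    refine ⟨hgd, ?_⟩
    rw [← hgQ, uni_top _ _ hgd] at hc1
    have := C_injective _ _ hc1
    exact this ▸ hc0
  have hmK : mon (map (Int.castRingHom K) g) d := by rw [hQK]; exact mon_map _ hmQ
  have hgi : Irreducible (map (Int.castRingHom K) g) := by rw [hgK]; exact shear_irr _ _ hirr
  have hI : Inf (map (Int.castRingHom K) g) :=
    inf_of _ _ (shL fun j => (γ j : K)) (fun y => by rw [hgK, shear_eval]; rfl) hgi hmK (by omega) hfin
  obtain ⟨T, hT⟩ : ∃ T : (Fin (m + 3) → ℤ) → Fin (m + 3) → ℤ,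
    ∀ y, T y = Fin.cons (y 0) fun j => y j.succ - γ j * y 0 := ⟨_, fun y => rfl⟩
  have hTi : ∀ y, (Fin.cons (T y 0) fun j => T y j.succ + γ j * T y 0 : Fin (m + 3) → ℤ) = y := fun y => by
    rw [hT]
    refine funext fun i => Fin.cases ?_ (fun i => ?_) i <;> simp
  have hcard : (S.image T).card = S.card := Finset.card_image_of_injective _ fun y z h => by
    rw [← hTi y, ← hTi z, h]
  have h := hc (N * (1 + d)) (Nat.mul_pos hN (by omega)) g hmQ hmK hgi hI (S.image T) (by
    intro x hx
    obtain ⟨y, hy, rfl⟩ := Finset.mem_image.1 hx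
    obtain ⟨hb, h0⟩ := hS y hy
    refine ⟨fun i => ?_, ?_⟩
    · rw [hT]; push_cast
      refine Fin.cases ?_ (fun i => ?_) i
      · rw [Fin.cons_zero]; nlinarith [hb 0]
      · rw [Fin.cons_succ]
        have h2 : |γ i * y 0| ≤ d * N := by
          rw [abs_mul]; exact mul_le_mul (hγ i) (hb 0) (abs_nonneg _) (by positivity)
        refine (abs_sub _ _).trans ((add_le_add (hb _) h2).trans (by linarith))
    · rw [hg, shear_eval, hTi, h0])
  rw [hcard] at h
  refine h.trans (le_of_eq ?_)
  push_cast
  rw [Real.mul_rpow (by positivity) (by positivity)]; ring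

end Sal

/-- Theorem 0.4 of Salberger, "On the density of rational and integral points on
algebraic varieties": if `f ∈ ℤ[y₁,…,yₙ]`, `n ≥ 3`, has degree `d ≥ 4`, is absolutely
irreducible over `ℚ`, and the affine hypersurface `f = 0` contains only finitely many
affine `(n-2)`-dimensional linear subspaces over `ℚ̄`, then
`n(Y;B) = O_{d,n,ε}(B^{n-2+ε})`. -/
theorem stmt_0 (n d : ℕ) (hn : 3 ≤ n) (hd : 4 ≤ d) (ε : ℝ) (hε : 0 < ε) :
    ∃ C : ℝ, ∀ f : MvPolynomial (Fin n) ℤ,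
      f.totalDegree = d →
      Irreducible (MvPolynomial.map (Int.castRingHom (AlgebraicClosure ℚ)) f) →
      {S : AffineSubspace (AlgebraicClosure ℚ) (Fin n → AlgebraicClosure ℚ) |
          Module.finrank (AlgebraicClosure ℚ) S.direction = n - 2 ∧
          (S : Set (Fin n → AlgebraicClosure ℚ)) ⊆ {y | aeval y f = 0}}.Finite →
      ∀ B : ℝ, 1 ≤ B →
        (({y : Fin n → ℤ | (∀ i, (|y i| : ℝ) ≤ B) ∧ eval y f = 0}.ncard : ℝ)
          ≤ C * B ^ ((n : ℝ) - 2 + ε)) := by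
  classical
  obtain ⟨m, rfl⟩ : ∃ m, n = m + 3 := ⟨n - 3, by omega⟩
  obtain ⟨C, hC, h⟩ := Sal.final (K := AlgebraicClosure ℚ) m d hd ε hε
  refine ⟨C, fun f hfd hirr hfin B hB => ?_⟩
  have hfin' : {S : AffineSubspace (AlgebraicClosure ℚ) (Fin (m + 3) → AlgebraicClosure ℚ) |
      Module.finrank (AlgebraicClosure ℚ) S.direction = m + 1 ∧
        ∀ y ∈ S, eval y (map (Int.castRingHom (AlgebraicClosure ℚ)) f) = 0}.Finite := by
    refine hfin.subset fun S hS => ⟨hS.1, fun y hy => ?_⟩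
    have := hS.2 y hy
    rw [eval_map] at this
    exact this
  have hN : 1 ≤ ⌊B⌋₊ := Nat.le_floor (by exact_mod_cast hB)
  have hsub : ∀ y ∈ {y : Fin (m + 3) → ℤ | (∀ i, (|y i| : ℝ) ≤ B) ∧ eval y f = 0},
      (∀ i, |y i| ≤ (⌊B⌋₊ : ℤ)) ∧ eval y f = 0 := fun y hy => ⟨fun i => by
    have h1 := hy.1 i
    have h2 : (y i).natAbs ≤ ⌊B⌋₊ := Nat.le_floor (by rw [Nat.cast_natAbs, Int.cast_abs]; exact h1)
    rw [Int.abs_eq_natAbs]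
    exact_mod_cast h2, hy.2⟩
  have hF : {y : Fin (m + 3) → ℤ | (∀ i, (|y i| : ℝ) ≤ B) ∧ eval y f = 0}.Finite :=
    (Sal.box (m + 3) ⌊B⌋₊).finite_toSet.subset fun y hy => Finset.mem_coe.2 (Sal.mem_box.2 (hsub y hy).1)
  have hmain := h f hfd hirr hfin' ⌊B⌋₊ hN hF.toFinset fun y hy => hsub y (hF.mem_toFinset.1 hy)
  rw [Set.ncard_eq_toFinset_card _ hF]
  refine hmain.trans ?_
  have e : (((m + 3 : ℕ) : ℝ) - 2 + ε) = (m : ℝ) + 1 + ε := by push_cast; ring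
  rw [e]
  refine mul_le_mul_of_nonneg_left (Real.rpow_le_rpow (by positivity) (Nat.floor_le (by linarith)) (by positivity)) hC
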